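/- Suppose b : ℝ → ℝ is positive with b(T) → 0 as T → ∞, and suppose that for all sufficiently large T, every nontrivial zero ρ = β + iγ of the Riemann zeta function with T < γ ≤ 2T satisfies |β − 1/2| < b(T)/(2 log T). Then, as T → ∞, the number of simple nontrivial zeros ρ = β + iγ of ζ with T < γ ≤ 2T is at least (2/3 + o(1)) times the total number of nontrivial zeros ρ = β + iγ of ζ with T < γ ≤ 2T (zeros counted with multiplicity). -/

import Mathlib

open Filter Topology MeasureTheory Set

/-- The multiplicity of `ρ` as a zero of the Riemann zeta function:
the least `n` such that the `n`-th iterated derivative of `ζ` is nonzero at `ρ`. -/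
noncomputable def zetaMult (ρ : ℂ) : ℕ :=
  sInf {n : ℕ | iteratedDeriv n riemannZeta ρ ≠ 0}

/-- `ρ` is a nontrivial zero of the Riemann zeta function. -/
def IsNontrivialZero (ρ : ℂ) : Prop :=
  riemannZeta ρ = 0 ∧ 0 < ρ.re ∧ ρ.re < 1

/-- The set of nontrivial zeros `ρ = β + iγ` with `T < γ ≤ 2T`. -/
def zeroBand (T : ℝ) : Set ℂ :=
  {ρ | IsNontrivialZero ρ ∧ T < ρ.im ∧ ρ.im ≤ 2 * T}

/-- Number of nontrivial zeros with `T < γ ≤ 2T`, counted with multiplicity. -/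
noncomputable def Ntot (T : ℝ) : ℝ :=
  ∑ᶠ ρ ∈ zeroBand T, (zetaMult ρ : ℝ)

/-- Number of simple nontrivial zeros with `T < γ ≤ 2T`. -/
noncomputable def Nsimple (T : ℝ) : ℝ :=
  ∑ᶠ ρ ∈ {ρ ∈ zeroBand T | zetaMult ρ = 1}, (1 : ℝ)

/-- Number of nontrivial zeros with `T < γ ≤ 2T` on the critical line, with multiplicity. -/
noncomputable def Nline (T : ℝ) : ℝ :=
  ∑ᶠ ρ ∈ {ρ ∈ zeroBand T | ρ.re = 1/2}, (zetaMult ρ : ℝ)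

/-- Number of simple critical-line nontrivial zeros with `T < γ ≤ 2T`. -/
noncomputable def NlineSimple (T : ℝ) : ℝ :=
  ∑ᶠ ρ ∈ {ρ ∈ zeroBand T | ρ.re = 1/2 ∧ zetaMult ρ = 1}, (1 : ℝ)

namespace TT
open Complex
set_option linter.unusedSimpArgs false

/-- boundary integral over a rectangle -/
noncomputable def rI (f : ℂ → ℂ) (a b c d : ℝ) : ℂ :=
  (∫ x in a..b, f (x + c * I)) - (∫ x in a..b, f (x + d * I))
    + I * (∫ y in c..d, f (b + y * I)) - I * (∫ y in c..d, f (a + y * I))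

lemma log_rot (v : ℂ) (h1 : 0 < v.re) (h2 : 0 < v.im) :
    Complex.log v - Complex.log (-I * v) = (Real.pi / 2 : ℝ) * I := by
  have hv : v ≠ 0 := by rintro rfl; simp at h1
  have h3 : Complex.log v = Complex.log (I * (-I * v)) := by
    congr 1; rw [← mul_assoc]; simp
  have hre : 0 < (-I * v).re := by simpa using h2
  have harg := Complex.abs_arg_lt_pi_div_two_iff.2 (Or.inl hre)
  have him : (-I * v).im < 0 := by simpa using h1
  have hneg := Complex.arg_neg_iff.2 him
  have h4 : Complex.log (I * (-I * v)) = Complex.log I + Complex.log (-I * v) := by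
    apply Complex.log_mul I_ne_zero (by simpa using hv)
    rw [abs_lt] at harg
    rw [Complex.arg_I]
    constructor <;> linarith [Real.pi_pos]
  rw [h3, h4, Complex.log_I]; push_cast; ring

lemma int_inv_line (k p q : ℂ) (hk : k ≠ 0) (a b : ℝ) (hab : a ≤ b)
    (h : ∀ x ∈ Icc a b, 0 < (k * (q * x + p)).re) :
    ∫ x in a..b, q * (q * x + p)⁻¹ = Complex.log (k * (q * b + p)) - Complex.log (k * (q * a + p)) := by
  have hs : ∀ x ∈ Icc a b, k * (q * x + p) ∈ slitPlane := fun x hx => Or.inl (h x hx)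
  have hne : ∀ x ∈ Icc a b, q * x + p ≠ 0 := fun x hx h0 => by
    have := h x hx; rw [h0] at this; simp at this
  rw [intervalIntegral.integral_eq_sub_of_hasDerivAt (f := fun x : ℝ => Complex.log (k * (q * x + p)))]
  · intro x hx
    rw [uIcc_of_le hab] at hx
    have h1 : HasDerivAt (fun x : ℝ => k * (q * x + p)) (k * q) x := by
      have := ((((hasDerivAt_id (x : ℂ)).const_mul q).add_const p).const_mul k).comp_ofReal
      simpa using this
    have := h1.clog_real (hs x hx)
    rw [mul_div_mul_left _ _ hk, div_eq_mul_inv] at this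
    exact this
  · apply ContinuousOn.intervalIntegrable
    rw [uIcc_of_le hab]
    apply ContinuousOn.mul continuousOn_const
    apply ContinuousOn.inv₀
    · fun_prop
    · exact hne

lemma rI_inv (w : ℂ) (a b c d : ℝ) (ha : a < w.re) (hb : w.re < b) (hc : c < w.im) (hd : w.im < d) :
    rI (fun s => (s - w)⁻¹) a b c d = 2 * Real.pi * I := by
  have e1 : ∫ x in a..b, ((x : ℂ) + c * I - w)⁻¹
      = Complex.log (I * (b + c * I - w)) - Complex.log (I * (a + c * I - w)) := by
    have := int_inv_line I (c * I - w) 1 I_ne_zero a b (by linarith) (by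
      intro x hx; simp; linarith)
    simpa [add_sub_assoc] using this
  have e2 : ∫ x in a..b, ((x : ℂ) + d * I - w)⁻¹
      = Complex.log (-I * (b + d * I - w)) - Complex.log (-I * (a + d * I - w)) := by
    have := int_inv_line (-I) (d * I - w) 1 (by simp) a b (by linarith) (by
      intro x hx; simp; linarith)
    simpa [add_sub_assoc] using this
  have e3 : I * ∫ y in c..d, ((b : ℂ) + y * I - w)⁻¹
      = Complex.log ((b + d * I - w)) - Complex.log ((b + c * I - w)) := by
    have := int_inv_line 1 (b - w) I one_ne_zero c d (by linarith) (by
      intro x hx; simp; linarith)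
    rw [intervalIntegral.integral_const_mul] at this
    have h2 : ∀ y : ℂ, (b : ℂ) + y * I - w = I * y + (b - w) := fun y => by ring
    simp only [h2]
    simpa using this
  have e4 : I * ∫ y in c..d, ((a : ℂ) + y * I - w)⁻¹
      = Complex.log (-(a + d * I - w)) - Complex.log (-(a + c * I - w)) := by
    have := int_inv_line (-1) (a - w) I (by simp) c d (by linarith) (by
      intro x hx; simp; linarith)
    rw [intervalIntegral.integral_const_mul] at this
    have h2 : ∀ y : ℂ, (a : ℂ) + y * I - w = I * y + (a - w) := fun y => by ring
    simp only [h2]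
    simpa using this
  have l1 := log_rot (I * (b + c * I - w)) (by simp; linarith) (by simp; linarith)
  have l2 := log_rot (b + d * I - w) (by simp; linarith) (by simp; linarith)
  have l3 := log_rot (-I * (a + d * I - w)) (by simp; linarith) (by simp; linarith)
  have l4 := log_rot (-(a + c * I - w)) (by simp; linarith) (by simp; linarith)
  have i1 : ∀ v : ℂ, -I * (I * v) = v := fun v => by rw [← mul_assoc]; simp
  have i2 : ∀ v : ℂ, -I * (-I * v) = -v := fun v => by rw [← mul_assoc]; simp
  have i3 : ∀ v : ℂ, -I * (-v) = I * v := fun v => by ring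
  rw [i1] at l1
  rw [i2] at l3
  rw [i3] at l4
  unfold rI
  rw [e1, e2, e3, e4]
  push_cast at *
  linear_combination l1 + l2 + l3 + l4

lemma rI_zero (f : ℂ → ℂ) (U : Set ℂ) (a b c d : ℝ) (hab : a ≤ b) (hcd : c ≤ d)
    (hU : Icc a b ×ℂ Icc c d ⊆ U) (hf : DifferentiableOn ℂ f U) : rI f a b c d = 0 := by
  have := Complex.integral_boundary_rect_eq_zero_of_differentiableOn f (a + c * I) (b + d * I)
    (by simpa [uIcc_of_le, hab, hcd] using hf.mono hU)
  simpa [rI] using this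

/-- edges of a rectangle -/
def rE (a b c d : ℝ) : Set ℂ :=
  {s | s ∈ Icc a b ×ℂ Icc c d ∧ (s.re = a ∨ s.re = b ∨ s.im = c ∨ s.im = d)}

lemma rE_int (f : ℂ → ℂ) (a b c d : ℝ) (hab : a ≤ b) (hcd : c ≤ d) (hf : ContinuousOn f (rE a b c d)) :
    IntervalIntegrable (fun x : ℝ => f (x + c * I)) volume a b ∧
    IntervalIntegrable (fun x : ℝ => f (x + d * I)) volume a b ∧
    IntervalIntegrable (fun y : ℝ => f (b + y * I)) volume c d ∧
    IntervalIntegrable (fun y : ℝ => f (a + y * I)) volume c d := by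
  refine ⟨?_, ?_, ?_, ?_⟩
  all_goals
    apply ContinuousOn.intervalIntegrable
    rw [uIcc_of_le (by assumption)]
    refine hf.comp (by fun_prop) ?_
    intro x hx
    simp [rE, mem_reProdIm, hab, hcd, hx.1, hx.2]

lemma rI_add (f g : ℂ → ℂ) (a b c d : ℝ) (hab : a ≤ b) (hcd : c ≤ d)
    (hf : ContinuousOn f (rE a b c d)) (hg : ContinuousOn g (rE a b c d)) :
    rI (fun s => f s + g s) a b c d = rI f a b c d + rI g a b c d := by
  obtain ⟨f1, f2, f3, f4⟩ := rE_int f a b c d hab hcd hf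
  obtain ⟨g1, g2, g3, g4⟩ := rE_int g a b c d hab hcd hg
  unfold rI
  rw [intervalIntegral.integral_add f1 g1, intervalIntegral.integral_add f2 g2,
    intervalIntegral.integral_add f3 g3, intervalIntegral.integral_add f4 g4]
  ring

lemma rI_const_mul (f : ℂ → ℂ) (k : ℂ) (a b c d : ℝ) :
    rI (fun s => k * f s) a b c d = k * rI f a b c d := by
  unfold rI
  simp only [intervalIntegral.integral_const_mul]
  ring

lemma rI_congr (f g : ℂ → ℂ) (a b c d : ℝ) (hab : a ≤ b) (hcd : c ≤ d)
    (h : EqOn f g (rE a b c d)) : rI f a b c d = rI g a b c d := by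
  unfold rI
  congr 1; congr 1; congr 1
  · apply intervalIntegral.integral_congr; intro x hx; rw [uIcc_of_le hab] at hx
    apply h; simp [rE, mem_reProdIm, hab, hcd, hx.1, hx.2]
  · apply intervalIntegral.integral_congr; intro x hx; rw [uIcc_of_le hab] at hx
    apply h; simp [rE, mem_reProdIm, hab, hcd, hx.1, hx.2]
  · congr 1
    apply intervalIntegral.integral_congr; intro x hx; rw [uIcc_of_le hcd] at hx
    apply h; simp [rE, mem_reProdIm, hab, hcd, hx.1, hx.2]
  · congr 1
    apply intervalIntegral.integral_congr; intro x hx; rw [uIcc_of_le hcd] at hx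
    apply h; simp [rE, mem_reProdIm, hab, hcd, hx.1, hx.2]

lemma rI_cauchy (G : ℂ → ℂ) (U : Set ℂ) (hUo : IsOpen U) (w : ℂ) (a b c d : ℝ)
    (ha : a < w.re) (hb : w.re < b) (hc : c < w.im) (hd : w.im < d)
    (hU : Icc a b ×ℂ Icc c d ⊆ U) (hf : DifferentiableOn ℂ G U) :
    rI (fun s => G s * (s - w)⁻¹) a b c d = 2 * Real.pi * I * G w := by
  have hw : w ∈ U := hU (by rw [mem_reProdIm]; exact ⟨⟨ha.le, hb.le⟩, ⟨hc.le, hd.le⟩⟩)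
  have hds : DifferentiableOn ℂ (dslope G w) U :=
    (Complex.differentiableOn_dslope (hUo.mem_nhds hw)).2 hf
  have hne : ∀ s ∈ rE a b c d, s - w ≠ 0 := by
    rintro s ⟨_, h⟩ h0
    rw [sub_eq_zero] at h0
    subst h0
    rcases h with h | h | h | h <;> linarith
  have hEU : rE a b c d ⊆ U := fun s hs => hU hs.1
  have h1 : rI (fun s => G s * (s - w)⁻¹) a b c d
      = rI (fun s => dslope G w s + G w * (s - w)⁻¹) a b c d := by
    apply rI_congr _ _ _ _ _ _ (by linarith) (by linarith)
    intro s hs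
    have := hne s hs
    simp only
    rw [dslope_of_ne _ (sub_ne_zero.1 this), slope_def_field]
    field_simp
    ring
  rw [h1, rI_add _ _ _ _ _ _ (by linarith) (by linarith), rI_const_mul, rI_inv w a b c d ha hb hc hd,
    rI_zero _ U _ _ _ _ (by linarith) (by linarith) hU hds]
  · ring
  · exact (hds.continuousOn).mono hEU
  · apply ContinuousOn.mul continuousOn_const
    exact ContinuousOn.inv₀ (by fun_prop) hne

/-- Factor out finitely many zeros. -/
lemma factor_zeros (f : ℂ → ℂ) (U : Set ℂ) (hU : IsOpen U) (hf : DifferentiableOn ℂ f U)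
    (m : ℂ → ℕ) (Z : Finset ℂ) (hZ : ∀ z ∈ Z, z ∈ U ∧ analyticOrderAt f z = m z) :
    ∃ F : ℂ → ℂ, DifferentiableOn ℂ F U ∧ (∀ z ∈ Z, F z ≠ 0) ∧
      ∀ s ∈ U, f s = (∏ z ∈ Z, (s - z) ^ m z) * F s := by
  classical
  induction Z using Finset.induction_on with
  | empty => exact ⟨f, hf, by simp, by simp⟩
  | insert w Z hw ih =>
    obtain ⟨F, hF, hFZ, hfac⟩ := ih (fun z hz => hZ z (Finset.mem_insert_of_mem hz))
    obtain ⟨hwU, hwm⟩ := hZ w (Finset.mem_insert_self _ _)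
    have hFa : AnalyticAt ℂ F w := hF.analyticAt (hU.mem_nhds hwU)
    set p : ℂ → ℂ := fun s => ∏ z ∈ Z, (s - z) ^ m z with hp
    have hpa : AnalyticAt ℂ p w := by
      have : Differentiable ℂ p := by fun_prop
      exact this.analyticAt w
    have hpw : p w ≠ 0 := by
      rw [hp]; simp only
      rw [Finset.prod_ne_zero_iff]
      intro z hz
      apply pow_ne_zero
      rw [sub_ne_zero]; rintro rfl; exact hw hz
    have hord : analyticOrderAt F w = m w := by
      have h1 : f =ᶠ[𝓝 w] p * F := by
        filter_upwards [hU.mem_nhds hwU] with s hs using hfac s hs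
      rw [analyticOrderAt_congr h1, analyticOrderAt_mul hpa hFa,
        hpa.analyticOrderAt_eq_zero.2 hpw, zero_add] at hwm
      exact hwm
    obtain ⟨g, hg, hgw, hFg⟩ := (hFa.analyticOrderAt_eq_natCast).1 hord
    refine ⟨Function.update (fun s => F s / (s - w) ^ m w) w (g w), ?_, ?_, ?_⟩
    · intro s hs
      by_cases hsw : s = w
      · subst hsw
        apply DifferentiableAt.differentiableWithinAt
        refine hg.differentiableAt.congr_of_eventuallyEq ?_
        filter_upwards [hFg] with z hz
        by_cases hzs : z = s
        · subst hzs; simp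
        · have : z - s ≠ 0 := sub_ne_zero.2 hzs
          rw [Function.update_of_ne hzs, hz, smul_eq_mul]
          field_simp
      · apply DifferentiableAt.differentiableWithinAt
        have : DifferentiableAt ℂ (fun s => F s / (s - w) ^ m w) s := by
          apply DifferentiableAt.div
          · exact hF.differentiableAt (hU.mem_nhds hs)
          · fun_prop
          · exact pow_ne_zero _ (sub_ne_zero.2 hsw)
        refine this.congr_of_eventuallyEq ?_
        filter_upwards [isOpen_ne.mem_nhds hsw] with z hz
        rw [Function.update_of_ne hz]
    · intro z hz
      rcases Finset.mem_insert.1 hz with rfl | hz'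
      · simpa using hgw
      · have hzw : z ≠ w := by rintro rfl; exact hw hz'
        rw [Function.update_of_ne hzw]
        exact div_ne_zero (hFZ z hz') (pow_ne_zero _ (sub_ne_zero.2 hzw))
    · intro s hs
      rw [Finset.prod_insert hw, hfac s hs]
      by_cases hsw : s = w
      · subst hsw
        have hFs := hFg.self_of_nhds
        simp only [Function.update_self]
        rw [hFs]
        simp only [smul_eq_mul]
        ring
      · rw [Function.update_of_ne hsw]
        have := pow_ne_zero (m w) (sub_ne_zero.2 hsw)
        field_simp

lemma logDeriv_factor (f F : ℂ → ℂ) (U : Set ℂ) (hU : IsOpen U) (m : ℂ → ℕ) (Z : Finset ℂ)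
    (hF : DifferentiableOn ℂ F U)
    (hfac : ∀ s ∈ U, f s = (∏ z ∈ Z, (s - z) ^ m z) * F s) (s : ℂ) (hs : s ∈ U) (h0 : f s ≠ 0) :
    logDeriv f s = ∑ z ∈ Z, m z * (s - z)⁻¹ + logDeriv F s := by
  have h1 : f =ᶠ[𝓝 s] fun s => (∏ z ∈ Z, (s - z) ^ m z) * F s := by
    filter_upwards [hU.mem_nhds hs] with s hs using hfac s hs
  rw [hfac s hs] at h0
  have hz : ∀ z ∈ Z, (s - z) ^ m z ≠ 0 := by
    have := left_ne_zero_of_mul h0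
    rwa [Finset.prod_ne_zero_iff] at this
  rw [logDeriv_apply, h1.deriv_eq, h1.self_of_nhds, ← logDeriv_apply,
    logDeriv_mul s (left_ne_zero_of_mul h0) (right_ne_zero_of_mul h0) (by fun_prop)
    (hF.differentiableAt (hU.mem_nhds hs)), logDeriv_prod (s := Z) (f := fun z s => (s - z) ^ m z) hz
    (by intro i hi; fun_prop)]
  congr 1
  apply Finset.sum_congr rfl
  intro z hz'
  rw [logDeriv_fun_pow (by fun_prop)]
  simp [logDeriv_apply]

/-- residue theorem for `f'/f * G` -/
lemma rI_residue (f G : ℂ → ℂ) (U : Set ℂ) (hU : IsOpen U) (hf : DifferentiableOn ℂ f U)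
    (hG : DifferentiableOn ℂ G U) (m : ℂ → ℕ) (Z : Finset ℂ)
    (a b c d : ℝ) (hab : a < b) (hcd : c < d) (hR : Icc a b ×ℂ Icc c d ⊆ U)
    (hZ : ∀ z ∈ Z, (a < z.re ∧ z.re < b ∧ c < z.im ∧ z.im < d) ∧ analyticOrderAt f z = m z)
    (hne : ∀ s ∈ Icc a b ×ℂ Icc c d, s ∉ Z → f s ≠ 0) :
    rI (fun s => logDeriv f s * G s) a b c d = 2 * Real.pi * I * ∑ z ∈ Z, m z * G z := by
  classical
  have hmem : ∀ z ∈ Z, z ∈ Icc a b ×ℂ Icc c d := fun z hz => by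
    obtain ⟨⟨h1, h2, h3, h4⟩, _⟩ := hZ z hz
    rw [mem_reProdIm]; exact ⟨⟨h1.le, h2.le⟩, ⟨h3.le, h4.le⟩⟩
  obtain ⟨F, hF, hFZ, hfac⟩ := factor_zeros f U hU hf m Z
    (fun z hz => ⟨hR (hmem z hz), (hZ z hz).2⟩)
  have hFne : ∀ s ∈ Icc a b ×ℂ Icc c d, F s ≠ 0 := by
    intro s hs
    by_cases hsZ : s ∈ Z
    · exact hFZ s hsZ
    · have := hne s hs hsZ
      rw [hfac s (hR hs)] at this
      exact right_ne_zero_of_mul this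
  have hEZ : ∀ s ∈ rE a b c d, s ∉ Z := by
    rintro s ⟨_, h⟩ hs
    obtain ⟨⟨h1, h2, h3, h4⟩, _⟩ := hZ s hs
    rcases h with h | h | h | h <;> linarith
  have hEU : rE a b c d ⊆ U := fun s hs => hR hs.1
  have h1 : rI (fun s => logDeriv f s * G s) a b c d
      = rI (fun s => (∑ z ∈ Z, m z * (G s * (s - z)⁻¹)) + logDeriv F s * G s) a b c d := by
    apply rI_congr _ _ _ _ _ _ hab.le hcd.le
    intro s hs
    simp only
    rw [logDeriv_factor f F U hU m Z hF hfac s (hEU hs) (hne s hs.1 (hEZ s hs)), add_mul,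
      Finset.sum_mul]
    congr 1
    apply Finset.sum_congr rfl; intros; ring
  set V : Set ℂ := {s ∈ U | F s ≠ 0} with hV
  have hVo : IsOpen V := hF.continuousOn.isOpen_inter_preimage hU isOpen_ne
  have hFd : DifferentiableOn ℂ (fun s => logDeriv F s * G s) V := by
    apply DifferentiableOn.mul _ (hG.mono (fun s hs => hs.1))
    have : DifferentiableOn ℂ (deriv F) V := (hF.deriv hU).mono (fun s hs => hs.1)
    exact this.div (hF.mono (fun s hs => hs.1)) (fun s hs => hs.2)
  have hRV : Icc a b ×ℂ Icc c d ⊆ V := fun s hs => ⟨hR hs, hFne s hs⟩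
  have hcont : ∀ z ∈ Z, ContinuousOn (fun s => (m z : ℂ) * (G s * (s - z)⁻¹)) (rE a b c d) := by
    intro z hz
    apply ContinuousOn.mul continuousOn_const
    apply ContinuousOn.mul (hG.continuousOn.mono hEU)
    apply ContinuousOn.inv₀ (by fun_prop)
    intro s hs h0
    rw [sub_eq_zero] at h0; subst h0; exact hEZ s hs hz
  have key : ∀ W ⊆ Z, rI (fun s => ∑ z ∈ W, m z * (G s * (s - z)⁻¹)) a b c d
      = 2 * Real.pi * I * ∑ z ∈ W, m z * G z := by
    intro W
    induction W using Finset.induction_on with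
    | empty => intro _; simp [rI]
    | insert w W hw ih =>
      intro hWZ
      have hwZ := hWZ (Finset.mem_insert_self _ _)
      have hWZ' : W ⊆ Z := fun z hz => hWZ (Finset.mem_insert_of_mem hz)
      obtain ⟨⟨h1, h2, h3, h4⟩, _⟩ := hZ w hwZ
      simp only [Finset.sum_insert hw]
      rw [rI_add _ _ _ _ _ _ hab.le hcd.le (hcont w hwZ)
        (continuousOn_finsetSum _ (fun z hz => hcont z (hWZ' hz))), ih hWZ', rI_const_mul,
        rI_cauchy G U hU w a b c d h1 h2 h3 h4 hR hG]
      ring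
  rw [h1, rI_add _ _ _ _ _ _ hab.le hcd.le (continuousOn_finsetSum _ hcont)
    (hFd.continuousOn.mono (fun s hs => hRV hs.1)), key Z subset_rfl,
    rI_zero _ V _ _ _ _ hab.le hcd.le hRV hFd, add_zero]

end TT

namespace TT
open Complex

local notation "Xi" => completedRiemannZeta

lemma im_ne {s : ℂ} (h : s.im ≠ 0) : s ≠ 0 ∧ s ≠ 1 := by
  constructor <;> · rintro rfl; simp at h

lemma Xi_diff {s : ℂ} (h : s.im ≠ 0) : DifferentiableAt ℂ Xi s :=
  differentiableAt_completedZeta (im_ne h).1 (im_ne h).2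

lemma Gr_ne {s : ℂ} (h : s.im ≠ 0) : Gammaℝ s ≠ 0 := by
  rw [Ne, Gammaℝ_eq_zero_iff]
  rintro ⟨n, rfl⟩
  simp at h

lemma Xi_eq {s : ℂ} (h : s.im ≠ 0) : Xi s = Gammaℝ s * riemannZeta s := by
  rw [riemannZeta_def_of_ne_zero (im_ne h).1, mul_div_cancel₀ _ (Gr_ne h)]

lemma Xi_zero_iff {s : ℂ} (h : s.im ≠ 0) : Xi s = 0 ↔ riemannZeta s = 0 := by
  rw [Xi_eq h, mul_eq_zero, or_iff_right (Gr_ne h)]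

lemma Xi_zero_re {s : ℂ} (h : s.im ≠ 0) (h0 : Xi s = 0) : 0 < s.re ∧ s.re < 1 := by
  constructor
  · by_contra hc
    have h1 : Xi (1 - s) = 0 := by rw [completedRiemannZeta_one_sub, h0]
    rw [Xi_zero_iff (by simpa using h)] at h1
    exact riemannZeta_ne_zero_of_one_le_re (by simp; linarith) h1
  · by_contra hc
    rw [Xi_zero_iff h] at h0
    exact riemannZeta_ne_zero_of_one_le_re (by linarith) h0

lemma ntz_iff {s : ℂ} (h : s.im ≠ 0) : IsNontrivialZero s ↔ Xi s = 0 := by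
  rw [Xi_zero_iff h]
  constructor
  · exact fun h => h.1
  · intro h0
    exact ⟨h0, Xi_zero_re h ((Xi_zero_iff h).2 h0)⟩

lemma Gr_diff {s : ℂ} (h : s.im ≠ 0) : DifferentiableAt ℂ Gammaℝ s := by
  have h1 : DifferentiableAt ℂ (fun s => (Gammaℝ s)⁻¹) s := differentiable_Gammaℝ_inv s
  have := h1.inv (inv_ne_zero (Gr_ne h))
  simpa [Pi.inv_def] using this

lemma zeta_order_ne_top {s : ℂ} (h : s ≠ 1) : analyticOrderAt riemannZeta s ≠ ⊤ := by
  have hd : DifferentiableOn ℂ riemannZeta ({1}ᶜ : Set ℂ) := fun z hz =>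
    (differentiableAt_riemannZeta hz).differentiableWithinAt
  have ha : AnalyticOnNhd ℂ riemannZeta ({1}ᶜ : Set ℂ) := hd.analyticOnNhd isOpen_compl_singleton
  have hc : IsPreconnected ({1}ᶜ : Set ℂ) :=
    (isConnected_compl_singleton_of_one_lt_rank (by simp) 1).isPreconnected
  apply AnalyticOnNhd.analyticOrderAt_ne_top_of_isPreconnected ha hc (x := 2) (by simp) h
  rw [(ha 2 (by simp)).analyticOrderAt_eq_zero.2]
  · simp
  · exact riemannZeta_ne_zero_of_one_le_re (by simp)

lemma zeta_order {s : ℂ} (h : s ≠ 1) : analyticOrderAt riemannZeta s = zetaMult s := by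
  have hd : AnalyticAt ℂ riemannZeta s := by
    have : DifferentiableOn ℂ riemannZeta ({1}ᶜ : Set ℂ) := fun z hz =>
      (differentiableAt_riemannZeta hz).differentiableWithinAt
    exact this.analyticAt (isOpen_compl_singleton.mem_nhds h)
  obtain ⟨n, hn⟩ := ENat.ne_top_iff_exists.1 (zeta_order_ne_top h)
  rw [← hn]
  have h2 := (analyticOrderAt_eq_nat_iff_iteratedDeriv_eq_zero hd).1 hn.symm
  congr 1
  apply le_antisymm
  · apply le_csInf ⟨n, h2.2⟩
    intro k hk
    by_contra hlt
    exact hk (h2.1 k (by omega))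
  · exact csInf_le' h2.2

lemma Xi_order {s : ℂ} (h : s.im ≠ 0) : analyticOrderAt Xi s = zetaMult s := by
  rw [← zeta_order (im_ne h).2]
  have ho : IsOpen {s : ℂ | s.im ≠ 0} := isOpen_ne_fun continuous_im continuous_const
  have e : Xi =ᶠ[𝓝 s] Gammaℝ * riemannZeta := by
    filter_upwards [ho.mem_nhds h] with z hz using Xi_eq hz
  have a1 : AnalyticAt ℂ Gammaℝ s := by
    have : DifferentiableOn ℂ Gammaℝ {s : ℂ | s.im ≠ 0} := fun z hz =>
      (Gr_diff hz).differentiableWithinAt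
    exact this.analyticAt (ho.mem_nhds h)
  have a2 : AnalyticAt ℂ riemannZeta s := by
    have : DifferentiableOn ℂ riemannZeta {s : ℂ | s.im ≠ 0} := fun z hz =>
      (differentiableAt_riemannZeta (im_ne hz).2).differentiableWithinAt
    exact this.analyticAt (ho.mem_nhds h)
  rw [analyticOrderAt_congr e, analyticOrderAt_mul a1 a2, a1.analyticOrderAt_eq_zero.2 (Gr_ne h),
    zero_add]

lemma mult_pos {s : ℂ} (h : s.im ≠ 0) (h0 : Xi s = 0) : 1 ≤ zetaMult s := by
  by_contra hc
  have h1 : zetaMult s = 0 := by omega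
  have h2 := Xi_order h
  have ha : AnalyticAt ℂ Xi s := by
    have ho : IsOpen {s : ℂ | s.im ≠ 0} := isOpen_ne_fun continuous_im continuous_const
    have : DifferentiableOn ℂ Xi {s : ℂ | s.im ≠ 0} := fun z hz =>
      (Xi_diff hz).differentiableWithinAt
    exact this.analyticAt (ho.mem_nhds h)
  rw [h1, Nat.cast_zero, ha.analyticOrderAt_eq_zero] at h2
  exact h2 h0

lemma Xi_zeros_finite (K : Set ℂ) (hK : Bornology.IsBounded K) (h : ∀ s ∈ K, s.im ≠ 0) :
    {s ∈ K | Xi s = 0}.Finite := by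
  obtain ⟨R, hR⟩ := hK.subset_closedBall 0
  refine ((isCompact_closedBall (0 : ℂ) R).inter_riemannZetaZeros_finite).subset ?_
  rintro s ⟨hs, h0⟩
  exact ⟨hR hs, (Xi_zero_iff (h s hs)).1 h0⟩

lemma logDeriv_Xi_symm (s : ℂ) (h : s.im ≠ 0) : logDeriv Xi s = - logDeriv Xi (1 - s) := by
  have h1 : (fun s => Xi (1 - s)) = Xi := by funext s; exact completedRiemannZeta_one_sub s
  have h2 : HasDerivAt (fun s => Xi (1 - s)) (- deriv Xi (1 - s)) s := by
    have hd : HasDerivAt Xi (deriv Xi (1 - s)) (1 - s) := (Xi_diff (by simpa using h)).hasDerivAt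
    have := hd.comp s ((hasDerivAt_id s).const_sub 1)
    simpa [Function.comp_def] using this
  rw [h1] at h2
  rw [logDeriv_apply, logDeriv_apply, h2.deriv, completedRiemannZeta_one_sub, neg_div]

noncomputable def LL (s : ℂ) : ℂ := LSeries (fun n => ((ArithmeticFunction.vonMangoldt n : ℝ) : ℂ)) s

lemma logDeriv_Xi_eq (s : ℂ) (h : s.im ≠ 0) (hs : 1 < s.re) :
    logDeriv Xi s = logDeriv Gammaℝ s - LL s := by
  have ho : IsOpen {s : ℂ | s.im ≠ 0} := isOpen_ne_fun continuous_im continuous_const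
  have e : Xi =ᶠ[𝓝 s] fun s => Gammaℝ s * riemannZeta s := by
    filter_upwards [ho.mem_nhds h] with z hz using Xi_eq hz
  have hz : riemannZeta s ≠ 0 := riemannZeta_ne_zero_of_one_le_re hs.le
  rw [logDeriv_congr_nhds e |>.eq_of_nhds, logDeriv_mul s (Gr_ne h) hz (Gr_diff h)
    (differentiableAt_riemannZeta (im_ne h).2)]
  have := ArithmeticFunction.LSeries_vonMangoldt_eq_deriv_riemannZeta_div hs
  unfold LL
  rw [this, logDeriv_apply riemannZeta]
  ring

end TT

namespace TT
open Complex Metric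

lemma logDeriv_bound (F : ℂ → ℂ) (s0 : ℂ) (M : ℝ) (hM : 0 < M) (hF : DifferentiableOn ℂ F (ball s0 3))
    (hne : ∀ s ∈ ball s0 3, F s ≠ 0) (hb : ∀ s ∈ ball s0 3, ‖F s‖ ≤ Real.exp M * ‖F s0‖)
    (s : ℂ) (hs : ‖s - s0‖ ≤ 12 / 5) : ‖logDeriv F s‖ ≤ 60 * M := by
  have hdF : DifferentiableOn ℂ (logDeriv F) (ball s0 3) := (hF.deriv isOpen_ball).div hF hne
  obtain ⟨g, hg0, hg⟩ := (hdF.isExactOn_ball).with_val_at s0 0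
  have h0 : s0 ∈ ball s0 3 := mem_ball_self (by norm_num)
  have hconst : ∀ z ∈ ball s0 3, F z * Complex.exp (-g z) = F s0 := by
    intro z hz
    have hd : ∀ w ∈ ball s0 3, HasDerivAt (fun w => F w * Complex.exp (-g w)) 0 w := by
      intro w hw
      have h1 := (hF.differentiableAt (isOpen_ball.mem_nhds hw)).hasDerivAt
      have := h1.mul ((hg w hw).neg.cexp)
      refine this.congr_deriv ?_
      have := hne w hw
      rw [logDeriv_apply]
      simp only [Pi.neg_apply]
      field_simp
      ring
    have := isOpen_ball.is_const_of_deriv_eq_zero (convex_ball s0 3).isPreconnected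
      (fun w hw => (hd w hw).differentiableAt.differentiableWithinAt)
      (fun w hw => (hd w hw).deriv) hz h0
    simpa [hg0] using this
  have hre : ∀ z ∈ ball s0 3, (g z).re ≤ M := by
    intro z hz
    have h1 := hconst z hz
    have h2 := hb z hz
    rw [← h1, norm_mul, Complex.norm_exp] at h2
    have h3 : 0 < ‖F z‖ := norm_pos_iff.2 (hne z hz)
    have h4 : 1 ≤ Real.exp M * Real.exp (-(g z).re) := by
      simp only [neg_re] at h2
      by_contra hc
      push Not at hc
      nlinarith
    rw [← Real.exp_add] at h4
    have := Real.one_le_exp_iff.1 h4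
    linarith
  have hBC : ∀ z, ‖z - s0‖ ≤ 27 / 10 → ‖g z‖ ≤ 18 * M := by
    intro z hz
    have hmem : ∀ w ∈ ball (0 : ℂ) 3, s0 + w ∈ ball s0 3 := by
      intro w hw; simpa using hw
    have := borelCaratheodory_zero (f := fun w => g (s0 + w)) (z := z - s0) (R := 3) hM
      (by
        intro w hw
        have h1 := (hg _ (hmem w hw)).differentiableAt
        exact (h1.comp w (by fun_prop)).differentiableWithinAt)
      (fun w hw => hre _ (hmem w hw)) (by norm_num) (by
        rw [mem_ball_zero_iff]; linarith) (by simpa using hg0)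
    simp only [add_sub_cancel] at this
    refine this.trans ?_
    rw [div_le_iff₀ (by linarith)]
    nlinarith
  have hd : deriv g s = logDeriv F s := (hg s (by rw [mem_ball_iff_norm]; linarith)).deriv
  rw [← hd]
  have hsub : closedBall s (3 / 10) ⊆ ball s0 3 := by
    intro z hz
    rw [mem_closedBall_iff_norm] at hz
    rw [mem_ball_iff_norm]
    have : z - s0 = (z - s) + (s - s0) := by ring
    rw [this]
    linarith [norm_add_le (z - s) (s - s0)]
  have := norm_deriv_le_of_forall_mem_sphere_norm_le (f := g) (c := s) (R := 3 / 10) (C := 18 * M) (by norm_num)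
    (by
      apply DifferentiableOn.diffContOnCl
      rw [closure_ball _ (by norm_num)]
      exact fun z hz => ((hg z (hsub hz)).differentiableAt).differentiableWithinAt)
    (by
      intro z hz
      rw [mem_sphere_iff_norm] at hz
      apply hBC
      have : z - s0 = (z - s) + (s - s0) := by ring
      rw [this]
      linarith [norm_add_le (z - s) (s - s0)])
  refine this.trans (le_of_eq ?_)
  ring

lemma local_zeros (f : ℂ → ℂ) (s0 : ℂ) (A M : ℝ) (hM : 1 ≤ M)
    (hf : DifferentiableOn ℂ f (ball s0 10)) (hA : ∀ s ∈ closedBall s0 9, ‖f s‖ ≤ A)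
    (h0 : A ≤ Real.exp M * ‖f s0‖) (hf0 : f s0 ≠ 0)
    (m : ℂ → ℕ) (Z : Finset ℂ) (hZ : ∀ z ∈ Z, z ∈ closedBall s0 3 ∧ analyticOrderAt f z = m z)
    (hZ' : ∀ s ∈ closedBall s0 3, s ∉ Z → f s ≠ 0) :
    (∑ z ∈ Z, (m z : ℝ)) ≤ 2 * M ∧ ∀ s, ‖s - s0‖ ≤ 12 / 5 → f s ≠ 0 →
      ‖logDeriv f s - ∑ z ∈ Z, m z * (s - z)⁻¹‖ ≤ 60 * M := by
  have hsub : closedBall s0 9 ⊆ ball s0 10 := closedBall_subset_ball (by norm_num)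
  have hsub3 : closedBall s0 3 ⊆ ball s0 10 := closedBall_subset_ball (by norm_num)
  have hs0 : s0 ∈ closedBall s0 9 := mem_closedBall_self (by norm_num)
  obtain ⟨F, hF, hFZ, hfac⟩ := factor_zeros f (ball s0 10) isOpen_ball hf m Z
    (fun z hz => ⟨hsub3 (hZ z hz).1, (hZ z hz).2⟩)
  have hApos : 0 ≤ A := (norm_nonneg _).trans (hA s0 hs0)
  set n := ∑ z ∈ Z, m z with hn
  have hFb : ∀ s ∈ closedBall s0 9, ‖F s‖ ≤ A / 6 ^ n := by
    intro s hs
    refine norm_le_of_forall_mem_frontier_norm_le (U := ball s0 9) isBounded_ball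
      ((hF.mono ?_).diffContOnCl) ?_ (by rwa [closure_ball _ (by norm_num)])
    · rwa [closure_ball _ (by norm_num)]
    · intro z hz
      rw [frontier_ball _ (by norm_num)] at hz
      have hzm := sphere_subset_closedBall hz
      have h1 := hA z hzm
      rw [hfac z (hsub hzm), norm_mul, norm_prod] at h1
      have h2 : (6 : ℝ) ^ n ≤ ∏ w ∈ Z, ‖(z - w) ^ m w‖ := by
        rw [hn, ← Finset.prod_pow_eq_pow_sum]
        apply Finset.prod_le_prod
        · intros; positivity
        · intro w hw
          rw [norm_pow]
          gcongr
          have h3 := (hZ w hw).1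
          rw [mem_closedBall_iff_norm] at h3
          rw [mem_sphere_iff_norm] at hz
          have : z - s0 = (z - w) + (w - s0) := by ring
          rw [this] at hz
          linarith [norm_add_le (z - w) (w - s0)]
      rw [le_div_iff₀ (by positivity)]
      calc ‖F z‖ * 6 ^ n ≤ ‖F z‖ * ∏ w ∈ Z, ‖(z - w) ^ m w‖ := by gcongr
        _ ≤ A := by rw [mul_comm]; exact h1
  have hF0 : ‖f s0‖ ≤ 3 ^ n * ‖F s0‖ := by
    rw [hfac s0 (hsub hs0), norm_mul, norm_prod]
    gcongr
    rw [hn, ← Finset.prod_pow_eq_pow_sum]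
    apply Finset.prod_le_prod
    · intros; positivity
    · intro w hw
      rw [norm_pow]
      gcongr
      have h3 := (hZ w hw).1
      rwa [mem_closedBall_iff_norm, norm_sub_rev] at h3
  have hf0p : 0 < ‖f s0‖ := norm_pos_iff.2 hf0
  have hF0p : 0 < ‖F s0‖ := by
    by_contra hc
    have : ‖F s0‖ = 0 := le_antisymm (not_lt.1 hc) (norm_nonneg _)
    rw [this, mul_zero] at hF0
    linarith
  have e6 : (6 : ℝ) ^ n = 2 ^ n * 3 ^ n := by rw [← mul_pow]; norm_num
  have hFb' : ∀ s ∈ closedBall s0 9, ‖F s‖ * 2 ^ n ≤ Real.exp M * ‖F s0‖ := by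
    intro s hs
    have h1 := hFb s hs
    rw [le_div_iff₀ (by positivity), e6] at h1
    have h2 : ‖F s‖ * (2 ^ n * 3 ^ n) ≤ Real.exp M * (3 ^ n * ‖F s0‖) := by
      refine h1.trans (h0.trans ?_)
      gcongr
    have h3 : (0 : ℝ) < 3 ^ n := by positivity
    nlinarith
  have hn2 : (n : ℝ) ≤ 2 * M := by
    have h1 := hFb' s0 hs0
    have h2 : (2 : ℝ) ^ n ≤ Real.exp M := by
      by_contra hc; push Not at hc; nlinarith
    have h3 := Real.log_le_log (by positivity) h2
    rw [Real.log_pow, Real.log_exp] at h3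
    have := Real.log_two_gt_d9
    have hn0 : (0 : ℝ) ≤ n := Nat.cast_nonneg n
    nlinarith
  refine ⟨by rw [hn] at hn2; push_cast at hn2; exact hn2, ?_⟩
  intro s hs hfs
  have hsm : s ∈ ball s0 10 := by rw [mem_ball_iff_norm]; linarith
  rw [logDeriv_factor f F _ isOpen_ball m Z hF hfac s hsm hfs, add_sub_cancel_left]
  have hb3 : ball s0 3 ⊆ ball s0 10 := ball_subset_ball (by norm_num)
  refine logDeriv_bound F s0 M (by linarith) (hF.mono hb3) ?_ ?_ s hs
  · intro z hz
    by_cases hzZ : z ∈ Z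
    · exact hFZ z hzZ
    · have := hZ' z (ball_subset_closedBall hz) hzZ
      rw [hfac z (hb3 hz)] at this
      exact right_ne_zero_of_mul this
  · intro z hz
    have h1 := hFb' z (closedBall_subset_closedBall (by norm_num) (ball_subset_closedBall hz))
    have h2 : (1 : ℝ) ≤ 2 ^ n := one_le_pow₀ (by norm_num)
    nlinarith [norm_nonneg (F z)]

end TT

namespace TT
open Complex Metric
local notation "Xi" => completedRiemannZeta

lemma mellin_bound (f : ℝ → ℂ) (a b : ℝ) (ha : MellinConvergent f a) (hb : MellinConvergent f b) :
    ∃ A : ℝ, ∀ s : ℂ, a ≤ s.re → s.re ≤ b → ‖mellin f s‖ ≤ A := by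
  refine ⟨∫ t in Ioi (0 : ℝ), (‖(t : ℂ) ^ ((a : ℂ) - 1) • f t‖ + ‖(t : ℂ) ^ ((b : ℂ) - 1) • f t‖), ?_⟩
  intro s h1 h2
  unfold mellin
  apply norm_integral_le_of_norm_le
  · exact ha.norm.add hb.norm
  · filter_upwards [self_mem_ae_restrict measurableSet_Ioi] with t ht
    have ht' : (0 : ℝ) < t := ht
    simp only [norm_smul]
    rw [← add_mul]
    gcongr
    rw [norm_cpow_eq_rpow_re_of_pos ht', norm_cpow_eq_rpow_re_of_pos ht', norm_cpow_eq_rpow_re_of_pos ht']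
    simp only [sub_re, one_re, ofReal_re]
    rcases le_total 1 t with h | h
    · have := Real.rpow_le_rpow_of_exponent_le h (show s.re - 1 ≤ b - 1 by linarith)
      have := Real.rpow_nonneg ht'.le (a - 1)
      linarith
    · have := Real.rpow_le_rpow_of_exponent_ge ht' h (show a - 1 ≤ s.re - 1 by linarith)
      have := Real.rpow_nonneg ht'.le (b - 1)
      linarith

lemma Xi_bound : ∃ A : ℝ, 1 ≤ A ∧ ∀ s : ℂ, -8 ≤ s.re → s.re ≤ 12 → 1 ≤ |s.im| → ‖Xi s‖ ≤ A := by
  have hm : ∀ z : ℂ, MellinConvergent (HurwitzZeta.hurwitzEvenFEPair 0).f_modif z := fun z =>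
    ((HurwitzZeta.hurwitzEvenFEPair 0).isStrongFEPair_toStrongFEPair.hasMellin z).1
  obtain ⟨A, hA⟩ := mellin_bound (HurwitzZeta.hurwitzEvenFEPair 0).f_modif (-4 : ℝ) (6 : ℝ) (hm _) (hm _)
  refine ⟨|A| + 3, by linarith [abs_nonneg A], ?_⟩
  intro s h1 h2 h3
  rw [completedRiemannZeta_eq]
  have e : completedRiemannZeta₀ s = mellin (HurwitzZeta.hurwitzEvenFEPair 0).f_modif (s / 2) / 2 := rfl
  have h4 : ‖completedRiemannZeta₀ s‖ ≤ |A| := by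
    rw [e, norm_div]
    have := hA (s / 2) (by simp; linarith) (by simp; linarith)
    have h0 := norm_nonneg (mellin (HurwitzZeta.hurwitzEvenFEPair 0).f_modif (s / 2))
    simp only [Complex.norm_ofNat]
    linarith [le_abs_self A]
  have h5 : ∀ z : ℂ, 1 ≤ |z.im| → ‖1 / z‖ ≤ 1 := by
    intro z hz
    rw [norm_div, norm_one]
    exact div_le_one_of_le₀ (hz.trans (abs_im_le_norm z)) (norm_nonneg _)
  have h6 := h5 s h3
  have h7 := h5 (1 - s) (by simpa using h3)
  calc _ ≤ ‖completedRiemannZeta₀ s‖ + ‖1 / s‖ + ‖1 / (1 - s)‖ :=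
        (norm_sub_le _ _).trans (by gcongr; exact norm_sub_le _ _)
    _ ≤ _ := by linarith

lemma Gamma_lower (v : ℝ) (hv : 1 ≤ v) : Real.exp (-(4 * v)) ≤ ‖Gamma (1 + v * I)‖ ^ 2 := by
  have h1 := Complex.Gamma_mul_Gamma_one_sub (v * I)
  have hvI : (v : ℂ) * I ≠ 0 := by simp; linarith
  have h2 := Complex.Gamma_add_one (v * I) hvI
  have h3 : Gamma (1 - v * I) = (starRingEnd ℂ) (Gamma (1 + v * I)) := by
    rw [← Complex.Gamma_conj]; congr 1; simp [sub_eq_add_neg]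
  have h4 : ‖Gamma (1 - v * I)‖ = ‖Gamma (1 + v * I)‖ := by rw [h3, RCLike.norm_conj]
  have h5 : ‖Gamma (1 + v * I)‖ ^ 2 = v * (Real.pi / ‖Complex.sin (Real.pi * (v * I))‖) := by
    have : ‖Gamma (v * I)‖ * ‖Gamma (1 - v * I)‖ = Real.pi / ‖Complex.sin (Real.pi * (v * I))‖ := by
      rw [← norm_mul, h1, norm_div]; simp [abs_of_pos Real.pi_pos]
    rw [← this, h4, add_comm, h2, norm_mul, norm_mul, Complex.norm_I, Complex.norm_real, Real.norm_eq_abs, abs_of_pos (by linarith)]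
    ring
  rw [h5]
  have h6 : ‖Complex.sin (Real.pi * (v * I))‖ = Real.sinh (Real.pi * v) := by
    rw [← mul_assoc, Complex.sin_mul_I, norm_mul, Complex.norm_I, mul_one]
    norm_cast
    rw [Real.norm_eq_abs, abs_of_pos]
    exact Real.sinh_pos_iff.2 (by nlinarith [Real.pi_pos])
  have hpos : 0 < Real.sinh (Real.pi * v) := Real.sinh_pos_iff.2 (by nlinarith [Real.pi_pos])
  rw [h6]
  have h7 : Real.sinh (Real.pi * v) ≤ Real.exp (4 * v) := by
    rw [Real.sinh_eq]
    have h8 : Real.exp (Real.pi * v) ≤ Real.exp (4 * v) := by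
      apply Real.exp_le_exp.2; nlinarith [Real.pi_le_four]
    have := Real.exp_pos (-(Real.pi * v))
    have := Real.exp_pos ((Real.pi * v))
    linarith
  rw [Real.exp_neg]
  calc (Real.exp (4 * v))⁻¹ ≤ (Real.sinh (Real.pi * v))⁻¹ := by gcongr
    _ ≤ v * (Real.pi / Real.sinh (Real.pi * v)) := by
      rw [div_eq_mul_inv, ← mul_assoc]
      apply le_mul_of_one_le_left (by positivity)
      nlinarith [Real.pi_gt_three]

lemma zeta_lower (y : ℝ) : 1 / 4 ≤ ‖riemannZeta (2 + y * I)‖ := by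
  have hre : 1 < (2 + y * I : ℂ).re := by simp
  have h1 := zeta_eq_tsum_one_div_nat_add_one_cpow hre
  have hn : ∀ n : ℕ, ‖1 / ((n : ℂ) + 1) ^ (2 + y * I : ℂ)‖ = 1 / ((n : ℝ) + 1) ^ 2 := by
    intro n
    rw [norm_div, norm_one]
    have : ((n : ℂ) + 1) = (((n : ℝ) + 1 : ℝ) : ℂ) := by push_cast; rfl
    rw [this, norm_cpow_eq_rpow_re_of_pos (by positivity)]
    congr 1
    simp
  have hs : HasSum (fun n : ℕ => 1 / ((n : ℝ) + 1) ^ 2) (Real.pi ^ 2 / 6) := by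
    have := (hasSum_nat_add_iff' (f := fun n : ℕ => 1 / (n : ℝ) ^ 2) 1).2 hasSum_zeta_two
    simpa using this
  have hs1 : HasSum (fun n : ℕ => 1 / ((n : ℝ) + 1 + 1) ^ 2) (Real.pi ^ 2 / 6 - 1) := by
    have := (hasSum_nat_add_iff' (f := fun n : ℕ => 1 / ((n : ℝ) + 1) ^ 2) 1).2 hs
    simpa using this
  have hsum : Summable (fun n : ℕ => 1 / ((n : ℂ) + 1) ^ (2 + y * I : ℂ)) := by
    apply Summable.of_norm
    simp only [hn]; exact hs.summable
  rw [hsum.tsum_eq_zero_add] at h1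
  have h2 : ‖∑' n : ℕ, 1 / (((n + 1 : ℕ) : ℂ) + 1) ^ (2 + y * I : ℂ)‖ ≤ Real.pi ^ 2 / 6 - 1 := by
    apply tsum_of_norm_bounded hs1
    intro n
    rw [hn]; push_cast; rfl
  simp only [Nat.cast_zero, zero_add, one_cpow, div_one] at h1
  rw [h1]
  have h3 := norm_sub_norm_le (1 : ℂ) (-(∑' n : ℕ, 1 / (((n + 1 : ℕ) : ℂ) + 1) ^ (2 + y * I : ℂ)))
  rw [norm_one, norm_neg, sub_neg_eq_add] at h3
  have : Real.pi ^ 2 / 6 ≤ 1.75 := by nlinarith [Real.pi_lt_d2, Real.pi_pos]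
  linarith

lemma Xi_lower (y : ℝ) (hy : 2 ≤ y) : 1 / 16 * Real.exp (-y) ≤ ‖Xi (2 + y * I)‖ := by
  rw [Xi_eq (by simp; linarith), norm_mul, Complex.Gammaℝ_def, norm_mul]
  have h1 := zeta_lower y
  have h2 := Gamma_lower (y / 2) (by linarith)
  have e : (2 + y * I : ℂ) / 2 = 1 + (y / 2 : ℝ) * I := by push_cast; ring
  rw [e]
  have h3 : ‖(Real.pi : ℂ) ^ (-(2 + y * I : ℂ) / 2)‖ = Real.pi⁻¹ := by
    rw [norm_cpow_eq_rpow_re_of_pos Real.pi_pos]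
    simp [Real.rpow_neg_one]
  rw [h3]
  have h4 : Real.exp (-y) ≤ ‖Gamma (1 + (y / 2 : ℝ) * I)‖ := by
    have : Real.exp (-(4 * (y / 2))) = Real.exp (-y) ^ 2 := by rw [← Real.exp_nat_mul]; congr 1; push_cast; ring
    rw [this] at h2
    exact (pow_le_pow_iff_left₀ (Real.exp_pos _).le (norm_nonneg _) two_ne_zero).1 h2
  have h5 : 1 / 4 ≤ Real.pi⁻¹ := by
    rw [one_div]; gcongr; exact Real.pi_le_four
  calc _ = 1 / 4 * Real.exp (-y) * (1 / 4) := by ring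
    _ ≤ _ := by gcongr

end TT

namespace TT
open Complex Metric
local notation "Xi" => completedRiemannZeta

noncomputable def hq (x : ℝ) : ℝ := x ^ (-(1 / 2) : ℝ) + (-x) ^ (-(1 / 2) : ℝ)

lemma rpow_half_neg {x : ℝ} (hx : x < 0) : x ^ (-(1 / 2) : ℝ) = 0 := by
  rw [Real.rpow_def_of_neg hx]
  have : (-(1 / 2) : ℝ) * Real.pi = -(Real.pi / 2) := by ring
  rw [this, Real.cos_neg, Real.cos_pi_div_two, mul_zero]

lemma hq_eq (x : ℝ) (hx : x ≠ 0) : hq x = |x| ^ (-(1 / 2) : ℝ) := by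
  unfold hq
  rcases lt_or_gt_of_ne hx with h | h
  · rw [rpow_half_neg h, abs_of_neg h, zero_add]
  · rw [rpow_half_neg (show -x < 0 by linarith), abs_of_pos h, add_zero]

lemma hq_nonneg (x : ℝ) : 0 ≤ hq x := by
  by_cases h : x = 0
  · subst h; unfold hq; positivity
  · rw [hq_eq x h]; positivity

lemma hq_int (a b c : ℝ) (hab : a ≤ b) (hb : b - a ≤ 2) :
    IntervalIntegrable (fun x => hq (x - c)) volume a b ∧ ∫ x in a..b, hq (x - c) ≤ 6 := by
  have h1 : ∀ p q : ℝ, IntervalIntegrable (fun x : ℝ => x ^ (-(1 / 2) : ℝ)) volume p q := fun p q =>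
    intervalIntegral.intervalIntegrable_rpow' (by norm_num)
  have hi : ∀ p q : ℝ, p ≤ q → ∫ x in p..q, x ^ (-(1 / 2) : ℝ) ≤ 2 * √(q - p) := by
    intro p q hpq
    rw [integral_rpow (Or.inl (by norm_num))]
    have e : (-(1 / 2) + 1 : ℝ) = 1 / 2 := by norm_num
    rw [e, ← Real.sqrt_eq_rpow, ← Real.sqrt_eq_rpow]
    have : √q ≤ √p + √(q - p) := by
      rcases le_total 0 p with hp | hp
      · rw [Real.sqrt_le_left (by positivity)]
        nlinarith [Real.sq_sqrt hp, Real.sq_sqrt (sub_nonneg.2 hpq), Real.sqrt_nonneg p, Real.sqrt_nonneg (q - p),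
          mul_nonneg (Real.sqrt_nonneg p) (Real.sqrt_nonneg (q - p))]
      · rw [Real.sqrt_eq_zero_of_nonpos hp, zero_add]
        apply Real.sqrt_le_sqrt; linarith
    rw [div_le_iff₀ (by norm_num)]; linarith
  have h2 : ∀ p q : ℝ, IntervalIntegrable (fun x : ℝ => (-x) ^ (-(1 / 2) : ℝ)) volume p q := fun p q => by
    have := (IntervalIntegrable.iff_comp_neg (by simp)).1 (h1 (-p) (-q))
    simpa using this
  have h3 : ∀ p q : ℝ, IntervalIntegrable hq volume p q := fun p q => (h1 p q).add (h2 p q)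
  refine ⟨by simpa using (h3 (a - c) (b - c)).comp_sub_right c, ?_⟩
  rw [intervalIntegral.integral_comp_sub_right]
  unfold hq
  rw [intervalIntegral.integral_add (h1 _ _) (h2 _ _), intervalIntegral.integral_comp_neg (fun x => x ^ (-(1 / 2) : ℝ))]
  have h4 := hi (a - c) (b - c) (by linarith)
  have h5 := hi (-(b - c)) (-(a - c)) (by linarith)
  have h6 : √(b - a) ≤ 1.5 := by rw [Real.sqrt_le_left (by norm_num)]; linarith
  have e1 : b - c - (a - c) = b - a := by ring
  have e2 : -(a - c) - -(b - c) = b - a := by ring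
  rw [e1] at h4
  rw [e2] at h5
  linarith

lemma inv_le_hq (w : ℂ) (h1 : w.re ≠ 0) (h2 : w.im ≠ 0) : ‖w⁻¹‖ ≤ hq w.re * hq w.im := by
  rw [hq_eq _ h1, hq_eq _ h2, norm_inv]
  have hw : 0 < ‖w‖ := norm_pos_iff.2 (by rintro rfl; simp at h1)
  have h3 : ‖w‖⁻¹ = ‖w‖ ^ (-(1 / 2) : ℝ) * ‖w‖ ^ (-(1 / 2) : ℝ) := by
    rw [← Real.rpow_add hw, ← Real.rpow_neg_one]; norm_num
  rw [h3]
  exact mul_le_mul (Real.rpow_le_rpow_of_nonpos (abs_pos.2 h1) (abs_re_le_norm w) (by norm_num))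
    (Real.rpow_le_rpow_of_nonpos (abs_pos.2 h2) (abs_im_le_norm w) (by norm_num)) (by positivity) (by positivity)

lemma ii_sum {ι E : Type*} [NormedAddCommGroup E] (Z : Finset ι) (f : ι → ℝ → E) (a b : ℝ)
    (h : ∀ i ∈ Z, IntervalIntegrable (f i) volume a b) :
    IntervalIntegrable (fun x => ∑ i ∈ Z, f i x) volume a b := by
  have := IntervalIntegrable.sum Z h
  have e : (∑ i ∈ Z, f i) = fun x => ∑ i ∈ Z, f i x := by funext x; simp
  rw [e] at this
  exact this

lemma horiz : ∃ C Y0 : ℝ, 0 < C ∧ ∀ Y ≥ Y0, ∃ y ∈ Icc Y (Y + 1),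
    (∀ σ ∈ Icc (-1 / 4 : ℝ) (5 / 4), Xi (σ + y * I) ≠ 0) ∧
    ∫ σ in (-1 / 4 : ℝ)..(5 / 4), ‖logDeriv Xi (σ + y * I)‖ ≤ C * Y := by
  obtain ⟨A, hA1, hA⟩ := Xi_bound
  refine ⟨500, 20 + Real.log (16 * A), by norm_num, ?_⟩
  intro Y hY
  have hlogA : 0 ≤ Real.log (16 * A) := Real.log_nonneg (by linarith)
  set s0 : ℂ := 2 + (Y + 1 / 2 : ℝ) * I with hs0
  have hs0re : s0.re = 2 := by simp [hs0]
  have hs0im : s0.im = Y + 1 / 2 := by simp [hs0]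
  have hreim : ∀ s : ℂ, ∀ r : ℝ, ‖s - s0‖ ≤ r → |s.re - 2| ≤ r ∧ |s.im - (Y + 1 / 2)| ≤ r := by
    intro s r hs
    rw [← hs0im, show s.re - 2 = s.re - s0.re by rw [hs0re]]
    exact ⟨(abs_re_le_norm (s - s0)).trans hs, (abs_im_le_norm (s - s0)).trans hs⟩
  have himpos : ∀ s ∈ ball s0 10, 1 ≤ s.im := by
    intro s hs
    rw [mem_ball_iff_norm] at hs
    have := (hreim s 10 hs.le).2
    rw [abs_le] at this
    linarith
  have hsub3 : closedBall s0 3 ⊆ ball s0 10 := closedBall_subset_ball (by norm_num)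
  have hfin : {s ∈ closedBall s0 3 | Xi s = 0}.Finite := Xi_zeros_finite _ isBounded_closedBall
    (fun s hs => by linarith [himpos s (hsub3 hs)])
  have hfs0 := Xi_lower (Y + 1 / 2) (by linarith)
  have hL := local_zeros Xi s0 A (2 * Y) (by linarith)
    (fun s hs => (Xi_diff (by linarith [himpos s hs])).differentiableWithinAt)
    (by
      intro s hs
      have h1 := himpos s (closedBall_subset_ball (by norm_num) hs)
      rw [mem_closedBall_iff_norm] at hs
      have := (hreim s 9 hs).1
      rw [abs_le] at this
      exact hA s (by linarith) (by linarith) (h1.trans (le_abs_self _)))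
    (by
      calc A = 1 / 16 * (16 * A) := by ring
        _ = 1 / 16 * Real.exp (Real.log (16 * A)) := by rw [Real.exp_log (by linarith)]
        _ ≤ 1 / 16 * Real.exp (2 * Y - (Y + 1 / 2)) := by gcongr; linarith
        _ = Real.exp (2 * Y) * (1 / 16 * Real.exp (-(Y + 1 / 2))) := by
          rw [sub_eq_add_neg, Real.exp_add]; ring
        _ ≤ _ := by gcongr)
    (by
      rw [← norm_pos_iff]
      exact lt_of_lt_of_le (by positivity) hfs0)
    zetaMult hfin.toFinset
    (by
      intro z hz
      rw [Set.Finite.mem_toFinset] at hz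
      exact ⟨hz.1, Xi_order (by linarith [himpos z (hsub3 hz.1)])⟩)
    (by
      intro s hs hz h0
      exact hz (by rw [Set.Finite.mem_toFinset]; exact ⟨hs, h0⟩))
  obtain ⟨hn, hld⟩ := hL
  set Z := hfin.toFinset with hZ
  set W : ℝ → ℝ := fun y => ∑ z ∈ Z, (zetaMult z : ℝ) * hq (y - z.im) with hW
  have hWi : IntervalIntegrable W volume Y (Y + 1) := by
    apply ii_sum
    intro z hz
    exact (hq_int Y (Y + 1) z.im (by linarith) (by linarith)).1.const_mul _
  have hWint : ∫ y in Y..(Y + 1), W y ≤ 24 * Y := by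
    rw [hW]
    simp only
    rw [intervalIntegral.integral_finsetSum
      (fun z hz => (hq_int Y (Y + 1) z.im (by linarith) (by linarith)).1.const_mul _)]
    calc _ ≤ ∑ z ∈ Z, (zetaMult z : ℝ) * 6 := by
          apply Finset.sum_le_sum
          intro z hz
          rw [intervalIntegral.integral_const_mul]
          gcongr
          exact (hq_int Y (Y + 1) z.im (by linarith) (by linarith)).2
      _ ≤ _ := by rw [← Finset.sum_mul]; linarith
  have hex : ∃ y ∈ Icc Y (Y + 1), y ∉ (Z.image Complex.im : Finset ℝ) ∧ W y ≤ 24 * Y := by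
    have hnull : (volume.restrict (Ioc Y (Y + 1))) ((Z.image Complex.im : Finset ℝ) ∪ (Ioc Y (Y + 1))ᶜ : Set ℝ) = 0 := by
      apply measure_union_null
      · exact (Finset.finite_toSet _).measure_zero _
      · rw [Measure.restrict_apply measurableSet_Ioc.compl]; simp
    have hne : volume.restrict (Ioc Y (Y + 1)) ≠ 0 := by
      rw [Ne, Measure.restrict_eq_zero]; simp
    obtain ⟨y, hy, hy2⟩ := exists_notMem_null_le_average hne hWi.1 hnull
    simp only [mem_union, not_or, mem_compl_iff, not_not] at hy
    refine ⟨y, Ioc_subset_Icc_self hy.2, by simpa using hy.1, hy2.trans ?_⟩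
    rw [setAverage_eq]
    simp only [Real.volume_real_Ioc, add_sub_cancel_left, zero_le_one, sup_of_le_left, inv_one, one_smul]
    rw [← intervalIntegral.integral_of_le (by linarith)]
    exact hWint
  obtain ⟨y, hy, hyZ, hWy⟩ := hex
  have hmemb : ∀ σ ∈ Icc (-1 / 4 : ℝ) (5 / 4), ‖((σ : ℂ) + y * I) - s0‖ ≤ 12 / 5 := by
    intro σ hσ
    have e : ((σ : ℂ) + y * I) - s0 = ((σ - 2 : ℝ) : ℂ) + ((y - (Y + 1 / 2) : ℝ) : ℂ) * I := by
      rw [hs0]; push_cast; ring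
    rw [e, Complex.norm_add_mul_I, Real.sqrt_le_left (by norm_num)]
    nlinarith [hσ.1, hσ.2, hy.1, hy.2]
  have hnz : ∀ σ ∈ Icc (-1 / 4 : ℝ) (5 / 4), Xi (σ + y * I) ≠ 0 := by
    intro σ hσ h0
    apply hyZ
    rw [Finset.mem_image]
    refine ⟨(σ : ℂ) + y * I, ?_, by simp⟩
    rw [hZ, Set.Finite.mem_toFinset]
    refine ⟨?_, h0⟩
    rw [mem_closedBall_iff_norm]
    linarith [hmemb σ hσ]
  refine ⟨y, hy, hnz, ?_⟩
  have hle : (-1 / 4 : ℝ) ≤ 5 / 4 := by norm_num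
  set B : ℝ → ℝ := fun σ => 120 * Y + ∑ z ∈ Z, (zetaMult z : ℝ) * hq (y - z.im) * hq (σ - z.re) with hB
  have hBi : IntervalIntegrable B volume (-1 / 4) (5 / 4) := by
    apply IntervalIntegrable.add intervalIntegrable_const
    apply ii_sum
    intro z hz
    exact (hq_int _ _ z.re hle (by norm_num)).1.const_mul _
  have hBb : ∫ σ in (-1 / 4 : ℝ)..(5 / 4), B σ ≤ 500 * Y := by
    rw [hB]
    simp only
    rw [intervalIntegral.integral_add intervalIntegrable_const (by
        apply ii_sum
        intro z hz
        exact (hq_int _ _ z.re hle (by norm_num)).1.const_mul _),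
      intervalIntegral.integral_finsetSum
      (fun z hz => (hq_int _ _ z.re hle (by norm_num)).1.const_mul _), intervalIntegral.integral_const]
    have : ∑ z ∈ Z, ∫ σ in (-1 / 4 : ℝ)..(5 / 4), (zetaMult z : ℝ) * hq (y - z.im) * hq (σ - z.re)
        ≤ W y * 6 := by
      rw [hW]; simp only
      rw [Finset.sum_mul]
      apply Finset.sum_le_sum
      intro z hz
      rw [intervalIntegral.integral_const_mul]
      have := hq_nonneg (y - z.im)
      gcongr
      exact (hq_int _ _ z.re hle (by norm_num)).2
    rw [smul_eq_mul]
    linarith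
  refine le_trans ?_ hBb
  rw [intervalIntegral.integral_of_le hle, intervalIntegral.integral_of_le hle]
  apply integral_mono_of_nonneg
  · exact Eventually.of_forall (fun σ => norm_nonneg _)
  · exact hBi.1
  · have hnull : (volume.restrict (Ioc (-1 / 4 : ℝ) (5 / 4))) (Z.image Complex.re : Finset ℝ) = 0 :=
      (Finset.finite_toSet _).measure_zero _
    filter_upwards [self_mem_ae_restrict measurableSet_Ioc, measure_eq_zero_iff_ae_notMem.1 hnull] with σ hσ hσZ
    have hσ' := Ioc_subset_Icc_self hσ
    have h1 := hld _ (hmemb σ hσ') (hnz σ hσ')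
    have h2 : ‖∑ z ∈ Z, (zetaMult z : ℂ) * ((σ : ℂ) + y * I - z)⁻¹‖
        ≤ ∑ z ∈ Z, (zetaMult z : ℝ) * hq (y - z.im) * hq (σ - z.re) := by
      refine (norm_sum_le _ _).trans (Finset.sum_le_sum ?_)
      intro z hz
      rw [norm_mul, Complex.norm_natCast, mul_assoc]
      gcongr
      have e1 : ((σ : ℂ) + y * I - z).re = σ - z.re := by simp
      have e2 : ((σ : ℂ) + y * I - z).im = y - z.im := by simp
      have := inv_le_hq ((σ : ℂ) + y * I - z) (by
        rw [e1, sub_ne_zero]; rintro rfl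
        exact hσZ (by exact_mod_cast Finset.mem_image_of_mem Complex.re hz)) (by
        rw [e2, sub_ne_zero]; rintro rfl
        exact hyZ (Finset.mem_image_of_mem Complex.im hz))
      rw [e1, e2, mul_comm (hq _)] at this
      exact this
    have h3 := norm_sub_norm_le (logDeriv Xi ((σ : ℂ) + y * I)) (∑ z ∈ Z, (zetaMult z : ℂ) * ((σ : ℂ) + y * I - z)⁻¹)
    rw [hB]; simp only
    linarith

end TT

namespace TT
open Complex Metric

lemma deriv_tendsto (f : ℕ → ℂ → ℂ) (g : ℂ → ℂ) (U : Set ℂ) (s : ℂ) (r B : ℝ) (hr : 0 < r)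
    (hs : closedBall s r ⊆ U) (hf : ∀ᶠ n in atTop, DifferentiableOn ℂ (f n) U) (hg : DifferentiableOn ℂ g U)
    (hlim : ∀ z ∈ U, Tendsto (fun n => f n z) atTop (𝓝 (g z)))
    (hB : ∀ᶠ n in atTop, ∀ z ∈ sphere s r, ‖f n z‖ ≤ B) :
    Tendsto (fun n => deriv (f n) s) atTop (𝓝 (deriv g s)) := by
  have e : ∀ h : ℂ → ℂ, DifferentiableOn ℂ h U →
      deriv h s = (2 * Real.pi * I : ℂ)⁻¹ • ∮ z in C(s, r), (z - s) ^ (-2 : ℤ) • h z := by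
    intro h hh
    have h0 := DifferentiableOn.deriv_eq_smul_circleIntegral hr (hh.mono hs)
    have h1 : ∮ z in C(s, r), (z - s) ^ (-2 : ℤ) • h z = ∮ z in C(s, r), (1 / (z - s) ^ 2) • h z := by
      simp only [one_div, zpow_neg, zpow_ofNat]
    rw [h1, h0, smul_smul, inv_mul_cancel₀ Complex.two_pi_I_ne_zero, one_smul]
  rw [e g hg]
  have hc : ∀ᶠ n in atTop, (2 * Real.pi * I : ℂ)⁻¹ • ∮ z in C(s, r), (z - s) ^ (-2 : ℤ) • f n z
      = deriv (f n) s := by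
    filter_upwards [hf] with n hn using (e _ hn).symm
  refine Tendsto.congr' hc ?_
  apply Tendsto.const_smul
  unfold circleIntegral
  apply intervalIntegral.tendsto_integral_filter_of_dominated_convergence
    (fun _ => r * ((r ^ 2)⁻¹ * B))
  · filter_upwards [hf] with n hn
    apply Continuous.aestronglyMeasurable
    have : Continuous (fun θ => f n (circleMap s r θ)) := by
      have h1 := (hn.mono hs).continuousOn
      apply h1.comp_continuous (continuous_circleMap s r)
      intro x
      exact circleMap_mem_closedBall s hr.le x
    simp only [deriv_circleMap, circleMap_sub_center, smul_eq_mul]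
    refine Continuous.mul (by fun_prop) (Continuous.mul ?_ this)
    apply Continuous.zpow₀ (by fun_prop)
    intro a
    left
    exact circleMap_ne_center hr.ne'
  · filter_upwards [hB] with n hn
    apply Eventually.of_forall
    intro θ _
    rw [norm_smul, norm_smul, deriv_circleMap, circleMap_sub_center, norm_zpow]
    have h1 : ‖circleMap 0 r θ‖ = r := by simp [circleMap, abs_of_pos hr]
    rw [norm_mul, norm_I, mul_one, h1]
    have h2 : r ^ (-2 : ℤ) = (r ^ 2)⁻¹ := by rw [zpow_neg]; rfl
    rw [h2]
    gcongr
    exact hn _ (circleMap_mem_sphere s hr.le θ)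
  · exact intervalIntegrable_const
  · apply Eventually.of_forall
    intro θ _
    apply Tendsto.const_smul
    apply Tendsto.const_smul
    exact hlim _ (hs (circleMap_mem_closedBall s hr.le θ))

lemma GammaSeq_norm_le (z : ℂ) (a b : ℝ) (ha : 0 < a) (h1 : a ≤ z.re) (h2 : z.re ≤ b) (n : ℕ) (hn : n ≠ 0) :
    ‖GammaSeq z n‖ ≤ Real.Gamma a + Real.Gamma b := by
  have hb : 0 < b := by linarith
  rw [GammaSeq_eq_approx_Gamma_integral (by linarith) hn, Real.Gamma_eq_integral ha, Real.Gamma_eq_integral hb,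
    ← integral_add (Real.GammaIntegral_convergent ha) (Real.GammaIntegral_convergent hb),
    intervalIntegral.integral_of_le (by positivity)]
  have hi := (Real.GammaIntegral_convergent ha).add (Real.GammaIntegral_convergent hb)
  refine (norm_integral_le_of_norm_le (g := fun x => Real.exp (-x) * x ^ (a - 1) + Real.exp (-x) * x ^ (b - 1))
    (hi.mono_set Ioc_subset_Ioi_self) ?_).trans ?_
  · filter_upwards [self_mem_ae_restrict measurableSet_Ioc] with t ht
    have ht0 : 0 < t := ht.1
    rw [norm_mul, norm_cpow_eq_rpow_re_of_pos ht0, norm_real, ← mul_add]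
    have hn0 : (0 : ℝ) < n := by positivity
    have h3 : 0 ≤ 1 - t / n := by
      rw [sub_nonneg, div_le_one hn0]; exact ht.2
    gcongr
    · rw [Real.norm_of_nonneg (by positivity)]
      exact Real.one_sub_div_pow_le_exp_neg ht.2
    · simp only [sub_re, one_re]
      rcases le_total 1 t with h | h
      · have := Real.rpow_le_rpow_of_exponent_le h (show z.re - 1 ≤ b - 1 by linarith)
        have := Real.rpow_nonneg ht0.le (a - 1)
        linarith
      · have := Real.rpow_le_rpow_of_exponent_ge ht0 h (show a - 1 ≤ z.re - 1 by linarith)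
        have := Real.rpow_nonneg ht0.le (b - 1)
        linarith
  · apply setIntegral_mono_set hi _ (Eventually.of_forall Ioc_subset_Ioi_self)
    filter_upwards [self_mem_ae_restrict measurableSet_Ioi] with t ht
    have ht0 : (0 : ℝ) < t := ht
    simp only [Pi.add_apply, Pi.zero_apply]
    positivity

lemma logDeriv_GammaSeq (s : ℂ) (hs : 0 < s.re) (n : ℕ) (hn : n ≠ 0) :
    DifferentiableAt ℂ (fun z => GammaSeq z n) s ∧
    logDeriv (fun z => GammaSeq z n) s = Real.log n - ∑ j ∈ Finset.range (n + 1), (s + j)⁻¹ := by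
  have hne : ∀ j ∈ Finset.range (n + 1), s + (j : ℂ) ≠ 0 := by
    intro j _ h
    have := congrArg Complex.re h
    simp at this
    have : (0 : ℝ) ≤ j := Nat.cast_nonneg j
    linarith
  have hn0 : (n : ℂ) ≠ 0 := by exact_mod_cast hn
  have hp : ∏ j ∈ Finset.range (n + 1), (s + (j : ℂ)) ≠ 0 := Finset.prod_ne_zero_iff.2 hne
  have hfac : (n.factorial : ℂ) ≠ 0 := by exact_mod_cast n.factorial_ne_zero
  have hnum : HasDerivAt (fun z : ℂ => (n : ℂ) ^ z * (n.factorial : ℂ)) ((n : ℂ) ^ s * Complex.log n * n.factorial) s := by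
    have := ((hasDerivAt_id s).const_cpow (Or.inl hn0)).mul_const (n.factorial : ℂ)
    simpa using this
  have hden : DifferentiableAt ℂ (fun z : ℂ => ∏ j ∈ Finset.range (n + 1), (z + (j : ℂ))) s := by fun_prop
  unfold GammaSeq
  refine ⟨hnum.differentiableAt.div hden hp, ?_⟩
  have hps : (n : ℂ) ^ s ≠ 0 := by simp [cpow_eq_zero_iff, hn0]
  rw [logDeriv_div (f := fun z : ℂ => (n : ℂ) ^ z * (n.factorial : ℂ))
    (g := fun z : ℂ => ∏ j ∈ Finset.range (n + 1), (z + (j : ℂ))) s (mul_ne_zero hps hfac) hp hnum.differentiableAt hden,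
    logDeriv_prod (f := fun (j : ℕ) (z : ℂ) => z + (j : ℂ)) hne (by intros; fun_prop), logDeriv_apply, hnum.deriv]
  have : (n : ℂ) ^ s * Complex.log n * n.factorial / ((n : ℂ) ^ s * n.factorial) = Real.log n := by
    rw [← Complex.natCast_log]
    field_simp
  rw [this]
  congr 1
  apply Finset.sum_congr rfl
  intro j _
  simp [logDeriv_apply]

lemma digamma_tendsto (s : ℂ) (hs : 0 < s.re) :
    Tendsto (fun n : ℕ => (Real.log n : ℂ) - ∑ j ∈ Finset.range (n + 1), (s + j)⁻¹) atTop (𝓝 (digamma s)) := by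
  have hball : ∀ z ∈ closedBall s (s.re / 2), s.re / 2 ≤ z.re ∧ z.re ≤ 2 * s.re := by
    intro z hz
    rw [mem_closedBall_iff_norm] at hz
    have := (abs_re_le_norm (z - s)).trans hz
    rw [sub_re, abs_le] at this
    constructor <;> linarith
  have h1 : Tendsto (fun n => deriv (fun z => GammaSeq z n) s) atTop (𝓝 (deriv Gamma s)) := by
    apply deriv_tendsto (fun n z => GammaSeq z n) Gamma {z : ℂ | 0 < z.re} s (s.re / 2)
      (Real.Gamma (s.re / 2) + Real.Gamma (2 * s.re)) (by linarith)
    · intro z hz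
      have := (hball z hz).1
      simp only [mem_ofPred_eq]; linarith
    · filter_upwards [eventually_ne_atTop 0] with n hn
      exact fun z hz => (logDeriv_GammaSeq z hz n hn).1.differentiableWithinAt
    · intro z hz
      apply (differentiableAt_Gamma z _).differentiableWithinAt
      intro m hm
      have : (0 : ℝ) < z.re := hz
      rw [hm] at this
      simp at this
      have : (0 : ℝ) ≤ m := Nat.cast_nonneg m
      linarith
    · intro z _
      exact GammaSeq_tendsto_Gamma z
    · filter_upwards [eventually_ne_atTop 0] with n hn
      intro z hz
      have := hball z (sphere_subset_closedBall hz)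
      exact GammaSeq_norm_le z _ _ (by linarith) this.1 this.2 n hn
  have h2 := h1.div (GammaSeq_tendsto_Gamma s) (Gamma_ne_zero_of_re_pos hs)
  refine h2.congr' ?_
  filter_upwards [eventually_ne_atTop 0] with n hn
  rw [← (logDeriv_GammaSeq s hs n hn).2, logDeriv_apply]
  rfl

lemma log_step (w : ℂ) (hw : 0 < w.re) (h2 : 2 ≤ ‖w‖) :
    ‖log (w + 1) - log w - w⁻¹‖ ≤ (‖w‖ ^ 2)⁻¹ := by
  have hw0 : w ≠ 0 := by rintro rfl; simp at hw
  have hre : 0 < (w⁻¹).re := by rw [inv_re]; exact div_pos hw (normSq_pos.2 hw0)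
  have hre1 : 0 < (1 + w⁻¹).re := by simp only [add_re, one_re]; linarith
  have h1 : log (w + 1) = log w + log (1 + w⁻¹) := by
    rw [← Complex.log_mul hw0 (by intro h; rw [h] at hre1; simp at hre1)]
    · congr 1; field_simp
    · have a1 := abs_lt.1 (Complex.abs_arg_lt_pi_div_two_iff.2 (Or.inl hw))
      have a2 := abs_lt.1 (Complex.abs_arg_lt_pi_div_two_iff.2 (Or.inl hre1))
      constructor <;> linarith [a1.1, a1.2, a2.1, a2.2]
  rw [h1, add_sub_cancel_left]
  have hn : ‖w⁻¹‖ ≤ 1 / 2 := by rw [norm_inv, one_div]; gcongr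
  have := norm_log_one_add_sub_self_le (z := w⁻¹) (by linarith)
  refine this.trans ?_
  have h3 : (1 - ‖w⁻¹‖)⁻¹ ≤ 2 := by
    rw [inv_le_comm₀ (by linarith) (by norm_num)]; linarith
  rw [norm_inv] at *
  rw [inv_pow]
  have : 0 ≤ (‖w‖ ^ 2)⁻¹ := by positivity
  nlinarith

lemma digamma_asymp (w : ℂ) (hw : 0 < w.re) (h2 : 2 ≤ |w.im|) :
    ‖digamma w - log w‖ ≤ 4 / |w.im| := by
  set V := |w.im| with hV
  have hpos : ∀ j : ℕ, 0 < (w + j).re := by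
    intro j; simp only [add_re, natCast_re]
    have : (0 : ℝ) ≤ j := Nat.cast_nonneg j
    linarith
  have himj : ∀ j : ℕ, (w + j).im = w.im := by intro j; simp
  have hsq : ∀ j : ℕ, (‖w + j‖ ^ 2)⁻¹ ≤ 2 * (1 / (j + V - 1) - 1 / ((j + 1 : ℕ) + V - 1)) := by
    intro j
    have hj : (0 : ℝ) ≤ j := Nat.cast_nonneg j
    have e : ‖w + j‖ ^ 2 = (w.re + j) ^ 2 + V ^ 2 := by
      rw [Complex.sq_norm, normSq_apply, hV, sq_abs]; simp; ring
    rw [e]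
    have h4 : (j + V) ^ 2 / 2 ≤ (w.re + j) ^ 2 + V ^ 2 := by nlinarith [sq_nonneg (j - V)]
    calc _ ≤ ((j + V) ^ 2 / 2)⁻¹ := by gcongr
      _ = 2 * (1 / (j + V) ^ 2) := by field_simp
      _ ≤ _ := by
        gcongr
        push_cast
        rw [div_sub_div _ _ (by linarith) (by linarith)]
        rw [div_le_div_iff₀ (by positivity) (by apply mul_pos <;> linarith)]
        nlinarith
  have hfin : ∀ n : ℕ, ‖∑ j ∈ Finset.range (n + 1), (log (w + (j + 1 : ℕ)) - log (w + j) - (w + j)⁻¹)‖ ≤ 4 / V := by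
    intro n
    calc _ ≤ ∑ j ∈ Finset.range (n + 1), 2 * (1 / (j + V - 1) - 1 / ((j + 1 : ℕ) + V - 1)) := by
          refine (norm_sum_le _ _).trans (Finset.sum_le_sum ?_)
          intro j _
          refine le_trans ?_ (hsq j)
          have := log_step (w + j) (hpos j) (by
            refine h2.trans ?_
            rw [hV, ← himj j]; exact abs_im_le_norm _)
          push_cast
          rw [← add_assoc]
          exact this
      _ = 2 * (1 / (V - 1) - 1 / ((n + 1 : ℕ) + V - 1)) := by
          rw [← Finset.mul_sum, Finset.sum_range_sub' (fun j : ℕ => 1 / ((j : ℝ) + V - 1))]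
          simp
      _ ≤ 2 * (1 / (V - 1)) := by
          gcongr
          have : (0 : ℝ) ≤ (n + 1 : ℕ) := Nat.cast_nonneg _
          have : 0 ≤ 1 / (((n + 1 : ℕ) : ℝ) + V - 1) := by apply div_nonneg <;> linarith
          linarith
      _ ≤ 4 / V := by
          rw [← mul_div_assoc, div_le_div_iff₀ (by linarith) (by linarith)]; linarith
  have hsum : ∀ n : ℕ, ∑ j ∈ Finset.range (n + 1), (log (w + (j + 1 : ℕ)) - log (w + j) - (w + j)⁻¹)
      = log (w + (n + 1 : ℕ)) - log w - ∑ j ∈ Finset.range (n + 1), (w + j)⁻¹ := by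
    intro n
    rw [Finset.sum_sub_distrib, Finset.sum_range_sub (fun j : ℕ => log (w + j))]
    simp
  have hlim0 : Tendsto (fun n : ℕ => (Real.log n : ℂ) - log (w + (n + 1 : ℕ))) atTop (𝓝 0) := by
    have h5 : Tendsto (fun n : ℕ => -log (1 + (w + 1) * ((n : ℝ)⁻¹ : ℝ))) atTop (𝓝 (-log (1 + (w + 1) * ((0 : ℝ) : ℂ)))) := by
      apply Tendsto.neg
      apply Tendsto.clog
      · apply Tendsto.const_add
        apply Tendsto.const_mul
        exact (continuous_ofReal.tendsto 0).comp tendsto_inv_atTop_nhds_zero_nat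
      · simp
    simp only [ofReal_zero, mul_zero, add_zero, log_one, neg_zero] at h5
    refine h5.congr' ?_
    filter_upwards [eventually_gt_atTop 0] with n hn
    have hn0 : (0 : ℝ) < n := by exact_mod_cast hn
    have hnc : (n : ℂ) ≠ 0 := by exact_mod_cast hn.ne'
    have hne : (1 + (w + 1) * ((n : ℝ)⁻¹ : ℝ) : ℂ) ≠ 0 := by
      intro h
      have := congrArg Complex.re h
      simp at this
      have : 0 < (w.re + 1) * (n : ℝ)⁻¹ := by positivity
      linarith
    have : (w + (n + 1 : ℕ) : ℂ) = ((n : ℝ) : ℂ) * (1 + (w + 1) * ((n : ℝ)⁻¹ : ℝ)) := by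
      push_cast; field_simp; ring
    rw [this, log_ofReal_mul hn0 hne]
    ring
  have hlim := ((digamma_tendsto w hw).sub hlim0).sub_const (log w)
  rw [sub_zero] at hlim
  refine le_of_tendsto hlim.norm (Eventually.of_forall fun n => ?_)
  refine le_trans (le_of_eq ?_) (hfin n)
  rw [hsum n]
  congr 1
  ring


noncomputable def arch (y : ℝ) : ℂ := logDeriv Gammaℝ (5 / 4 + y * I)

lemma arch_eq (y : ℝ) : arch y = -(Real.log Real.pi) / 2 + digamma (5 / 8 + (y / 2 : ℝ) * I) / 2 := by
  have hpi : (Real.pi : ℂ) ≠ 0 := by exact_mod_cast Real.pi_ne_zero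
  set s : ℂ := 5 / 4 + y * I with hs
  have hs2 : s / 2 = 5 / 8 + (y / 2 : ℝ) * I := by rw [hs]; push_cast; ring
  have hre : 0 < (s / 2).re := by rw [hs2]; simp
  have h1 : HasDerivAt (fun s : ℂ => (Real.pi : ℂ) ^ (-s / 2)) ((Real.pi : ℂ) ^ (-s / 2) * Complex.log Real.pi * (-1 / 2)) s := by
    have := (((hasDerivAt_id s).neg).div_const 2).const_cpow (c := (Real.pi : ℂ)) (Or.inl hpi)
    simpa using this
  have hg : DifferentiableAt ℂ Gamma (s / 2) := by
    apply differentiableAt_Gamma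
    intro m hm
    rw [hm] at hre
    simp at hre
    have : (0 : ℝ) ≤ m := Nat.cast_nonneg m
    linarith
  have h2 : HasDerivAt (fun s : ℂ => Gamma (s / 2)) (deriv Gamma (s / 2) * (1 / 2)) s := by
    have := HasDerivAt.comp s (h₂ := Gamma) hg.hasDerivAt ((hasDerivAt_id s).div_const 2)
    exact this
  have h3 := h1.mul h2
  have e : Gammaℝ = (fun s : ℂ => (Real.pi : ℂ) ^ (-s / 2)) * (fun s : ℂ => Gamma (s / 2)) := by
    funext s; exact Gammaℝ_def s
  have hne := Gamma_ne_zero_of_re_pos hre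
  have hp : (Real.pi : ℂ) ^ (-s / 2) ≠ 0 := by simp [cpow_eq_zero_iff, hpi]
  unfold arch
  rw [← hs, ← hs2, logDeriv_apply, e, h3.deriv, digamma_def, logDeriv_apply, Complex.ofReal_log Real.pi_pos.le]
  simp only [Pi.mul_apply]
  field_simp

lemma log_diff (w1 w2 : ℂ) (σ V : ℝ) (hσ : |σ| = 1) (hV : 0 < V) (h1 : 0 < w1.re) (h2 : 0 < w2.re)
    (h3 : V ≤ σ * w1.im) (h4 : V ≤ σ * w2.im) : ‖log w1 - log w2‖ ≤ V⁻¹ * ‖w1 - w2‖ := by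
  have hc : Convex ℝ {w : ℂ | 0 < w.re ∧ V ≤ σ * w.im} := by
    intro x hx y hy a b ha hb hab
    simp only [mem_ofPred_eq, add_re, add_im, real_smul, mul_re, mul_im, ofReal_re, ofReal_im, zero_mul, sub_zero, add_zero] at *
    constructor
    · rcases ha.eq_or_lt with h | h
      · rw [← h] at hab ⊢
        have : b = 1 := by linarith
        rw [this]; linarith
      · have := mul_pos h hx.1
        have := mul_nonneg hb hy.1.le
        linarith
    · have := mul_le_mul_of_nonneg_left hx.2 ha
      have := mul_le_mul_of_nonneg_left hy.2 hb
      have e : V = a * V + b * V := by rw [← add_mul, hab, one_mul]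
      rw [e]; nlinarith
  apply hc.norm_image_sub_le_of_norm_hasDerivWithin_le (f := log) (f' := fun w => w⁻¹) (x := w2) (y := w1) _ _ ⟨h2, h4⟩ ⟨h1, h3⟩
  · intro x hx
    exact (hasDerivAt_log (Or.inl hx.1)).hasDerivWithinAt
  · intro x hx
    rw [norm_inv]
    gcongr
    calc V ≤ |σ * x.im| := hx.2.trans (le_abs_self _)
      _ ≤ ‖x‖ := by rw [abs_mul, hσ, one_mul]; exact abs_im_le_norm x

lemma arch_log (y : ℝ) (hy : 4 ≤ |y|) :
    ‖arch y - (-(Real.log Real.pi) / 2 + log (5 / 8 + (y / 2 : ℝ) * I) / 2)‖ ≤ 4 / |y| := by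
  rw [arch_eq]
  have := digamma_asymp (5 / 8 + (y / 2 : ℝ) * I) (by simp) (by simp [abs_div]; linarith)
  have e : (5 / 8 + (y / 2 : ℝ) * I : ℂ).im = y / 2 := by simp
  rw [e, abs_div, abs_two] at this
  rw [add_sub_add_left_eq_sub, ← sub_div, norm_div]
  have h2 : ‖(2 : ℂ)‖ = 2 := by simp
  rw [h2]
  have e2 : 4 / (|y| / 2) = 2 * (4 / |y|) := by field_simp
  rw [e2] at this
  linarith

lemma arch_diff (σ V y t : ℝ) (hσ : |σ| = 1) (hV : 4 ≤ V) (h1 : V ≤ σ * y) (h2 : V ≤ σ * t) :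
    ‖arch y - arch t‖ ≤ (8 + |y - t|) / V := by
  have hy : V ≤ |y| := by
    calc V ≤ |σ * y| := h1.trans (le_abs_self _)
      _ = |y| := by rw [abs_mul, hσ, one_mul]
  have ht : V ≤ |t| := by
    calc V ≤ |σ * t| := h2.trans (le_abs_self _)
      _ = |t| := by rw [abs_mul, hσ, one_mul]
  have a1 := arch_log y (by linarith)
  have a2 := arch_log t (by linarith)
  have a3 := log_diff (5 / 8 + (y / 2 : ℝ) * I) (5 / 8 + (t / 2 : ℝ) * I) σ (V / 2) hσ (by linarith)
    (by simp) (by simp) (by simp; linarith) (by simp; linarith)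
  have e : (5 / 8 + (y / 2 : ℝ) * I : ℂ) - (5 / 8 + (t / 2 : ℝ) * I) = ((y - t) / 2 : ℝ) * I := by push_cast; ring
  rw [e, norm_mul, norm_I, mul_one, norm_real, Real.norm_eq_abs, abs_div, abs_two] at a3
  have b1 : 4 / |y| ≤ 4 / V := by gcongr
  have b2 : 4 / |t| ≤ 4 / V := by gcongr
  set A := (-(Real.log Real.pi) / 2 : ℂ)
  set l1 := log (5 / 8 + (y / 2 : ℝ) * I)
  set l2 := log (5 / 8 + (t / 2 : ℝ) * I)
  have e2 : arch y - arch t = (arch y - (A + l1 / 2)) - (arch t - (A + l2 / 2)) + (l1 - l2) / 2 := by ring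
  rw [e2]
  refine (norm_add_le _ _).trans ?_
  have h3 := norm_sub_le (arch y - (A + l1 / 2)) (arch t - (A + l2 / 2))
  rw [norm_div]
  have h4 : ‖(2 : ℂ)‖ = 2 := by simp
  rw [h4]
  have e3 : (V / 2)⁻¹ * (|y - t| / 2) = |y - t| / V := by field_simp
  rw [e3] at a3
  have : 0 ≤ |y - t| / V := by positivity
  rw [add_div]
  have : 8 / V = 4 / V + 4 / V := by ring
  linarith [norm_nonneg (l1 - l2)]

lemma arch_sum (t : ℝ) (ht : 4 ≤ t) : ‖arch t + arch (-t) - Real.log t‖ ≤ 10 := by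
  have a1 := arch_log t (by rwa [abs_of_nonneg (by linarith)])
  have a2 := arch_log (-t) (by rwa [abs_neg, abs_of_nonneg (by linarith)])
  rw [abs_neg] at a2
  rw [abs_of_nonneg (by linarith : 0 ≤ t)] at a1 a2
  have b : 4 / t ≤ 1 := by rw [div_le_one (by linarith)]; exact ht
  set w : ℂ := 5 / 8 + (t / 2 : ℝ) * I with hw
  have hcw : (5 / 8 + (-t / 2 : ℝ) * I : ℂ) = (starRingEnd ℂ) w := by
    rw [hw]; apply Complex.ext
    · rw [conj_re]; simp
    · rw [conj_im]; simp; ring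
  have hre : 0 < w.re := by rw [hw]; simp
  have harg : w.arg ≠ Real.pi := by
    have := abs_lt.1 (Complex.abs_arg_lt_pi_div_two_iff.2 (Or.inl hre))
    linarith [this.2, Real.pi_pos]
  rw [hcw, log_conj w harg] at a2
  have e : log w + (starRingEnd ℂ) (log w) = ((2 * Real.log ‖w‖ : ℝ) : ℂ) := by
    rw [add_conj, log_re]
  have hn1 : t / 2 ≤ ‖w‖ := by
    have := (le_abs_self _).trans (abs_im_le_norm w)
    rw [hw] at this ⊢
    simpa using this
  have hn2 : ‖w‖ ≤ t := by
    have : ‖w‖ ≤ ‖(5 / 8 : ℂ)‖ + ‖((t / 2 : ℝ) : ℂ) * I‖ := norm_add_le _ _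
    rw [norm_mul, norm_I, mul_one, norm_real, Real.norm_of_nonneg (by linarith)] at this
    norm_num at this
    linarith
  have l1 : Real.log ‖w‖ ≤ Real.log t := Real.log_le_log (by linarith) hn2
  have l2 : Real.log t - Real.log 2 ≤ Real.log ‖w‖ := by
    rw [← Real.log_div (by linarith) (by norm_num)]
    exact Real.log_le_log (by linarith) hn1
  have l3 : Real.log 2 ≤ 1 := by linarith [Real.log_two_lt_d9]
  have l4 : Real.log Real.pi ≤ 4 := by
    have := Real.log_le_sub_one_of_pos Real.pi_pos
    linarith [Real.pi_le_four]
  have l5 : 0 ≤ Real.log Real.pi := Real.log_nonneg (by linarith [Real.pi_gt_three])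
  have key : arch t + arch (-t) - Real.log t = (arch t - (-(Real.log Real.pi) / 2 + log w / 2))
      + (arch (-t) - (-(Real.log Real.pi) / 2 + (starRingEnd ℂ) (log w) / 2))
      + ((Real.log ‖w‖ - Real.log t - Real.log Real.pi : ℝ) : ℂ) := by
    have e' : (starRingEnd ℂ) (log w) = ((2 * Real.log ‖w‖ : ℝ) : ℂ) - log w := by rw [← e]; ring
    rw [e']; push_cast; ring
  rw [key]
  refine (norm_add₃_le).trans ?_
  have : ‖((Real.log ‖w‖ - Real.log t - Real.log Real.pi : ℝ) : ℂ)‖ ≤ 5 := by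
    rw [norm_real, Real.norm_eq_abs, abs_le]; constructor <;> linarith
  linarith

end TT

namespace TT
open Complex Metric

lemma kd (z : ℂ) (h : |z.re| ≤ 3 / 4) : (1 + z.im ^ 2) / 16 ≤ ‖1 - z ^ 2‖ := by
  have h' := abs_le.1 h
  have e : ‖1 - z ^ 2‖ ^ 2 = ((1 - z.re) ^ 2 + z.im ^ 2) * ((1 + z.re) ^ 2 + z.im ^ 2) := by
    rw [Complex.sq_norm, normSq_apply]
    simp only [sub_re, sub_im, one_re, one_im, pow_two, mul_re, mul_im]
    ring
  have h1 : (1 + z.im ^ 2) / 16 ≤ (1 - z.re) ^ 2 + z.im ^ 2 := by nlinarith [sq_nonneg z.im]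
  have h2 : (1 + z.im ^ 2) / 16 ≤ (1 + z.re) ^ 2 + z.im ^ 2 := by nlinarith [sq_nonneg z.im]
  have h0 : 0 ≤ (1 + z.im ^ 2) / 16 := by positivity
  refine le_of_sq_le_sq ?_ (norm_nonneg _)
  rw [e, pow_two]
  exact mul_le_mul h1 h2 h0 (h0.trans h1)

lemma kd_ne (z : ℂ) (h : |z.re| ≤ 3 / 4) : 1 - z ^ 2 ≠ 0 := by
  have := kd z h
  intro h0
  rw [h0, norm_zero] at this
  nlinarith [sq_nonneg z.im]

lemma kd_inv (z : ℂ) (h : |z.re| ≤ 3 / 4) : ‖(1 - z ^ 2)⁻¹‖ ≤ 16 * (1 + z.im ^ 2)⁻¹ := by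
  rw [norm_inv]
  calc _ ≤ ((1 + z.im ^ 2) / 16)⁻¹ := by
        have := kd z h
        gcongr
    _ = _ := by field_simp

noncomputable def kf (x : ℝ) : ℂ := ((min x x⁻¹ : ℝ) : ℂ) / 2

lemma kf_mellin (s : ℂ) (h1 : -1 < s.re) (h2 : s.re < 1) :
    MellinConvergent kf s ∧ mellin kf s = (1 - s ^ 2)⁻¹ := by
  have c1 : IntegrableOn (fun t : ℝ => (t : ℂ) ^ s / 2) (Ioc 0 1) := by
    have := (intervalIntegral.intervalIntegrable_cpow' (a := 0) (b := 1) h1).1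
    exact this.div_const 2
  have c2 : IntegrableOn (fun t : ℝ => (t : ℂ) ^ (s - 2) / 2) (Ioi 1) := by
    exact ((integrableOn_Ioi_cpow_iff zero_lt_one).2 (by simp; linarith)).div_const 2
  have e1 : ∀ t ∈ Ioc (0 : ℝ) 1, (t : ℂ) ^ (s - 1) • kf t = (t : ℂ) ^ s / 2 := by
    intro t ht
    have ht0 : (t : ℂ) ≠ 0 := by exact_mod_cast ht.1.ne'
    have : min t t⁻¹ = t := min_eq_left (ht.2.trans ((one_le_inv₀ ht.1).2 ht.2))
    rw [kf, this, smul_eq_mul, cpow_sub _ _ ht0, cpow_one]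
    field_simp
  have e2 : ∀ t ∈ Ioi (1 : ℝ), (t : ℂ) ^ (s - 1) • kf t = (t : ℂ) ^ (s - 2) / 2 := by
    intro t ht
    have ht1 : 1 < t := ht
    have ht0 : (t : ℂ) ≠ 0 := by exact_mod_cast (zero_lt_one.trans ht1).ne'
    have : min t t⁻¹ = t⁻¹ := min_eq_right ((inv_le_one_of_one_le₀ ht1.le).trans ht1.le)
    have e : s - 2 = s - 1 - 1 := by ring
    rw [kf, this, smul_eq_mul, e, cpow_sub (s - 1) 1 ht0, cpow_one]
    push_cast
    field_simp
  have d1 := c1.congr_fun (fun t ht => (e1 t ht).symm) measurableSet_Ioc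
  have d2 := c2.congr_fun (fun t ht => (e2 t ht).symm) measurableSet_Ioi
  have hu : Ioc (0 : ℝ) 1 ∪ Ioi 1 = Ioi 0 := Ioc_union_Ioi_eq_Ioi zero_le_one
  refine ⟨?_, ?_⟩
  · rw [MellinConvergent, ← hu]; exact d1.union d2
  · rw [mellin, ← hu, setIntegral_union (Set.disjoint_left.2 fun x hx (hx' : x ∈ Ioi (1 : ℝ)) => not_lt.2 hx.2 (mem_Ioi.1 hx') : Disjoint (Ioc (0 : ℝ) 1) (Ioi 1)) measurableSet_Ioi d1 d2,
      setIntegral_congr_fun measurableSet_Ioc e1, setIntegral_congr_fun measurableSet_Ioi e2,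
      ← intervalIntegral.integral_of_le zero_le_one, intervalIntegral.integral_div, integral_div,
      integral_cpow (Or.inl h1), integral_Ioi_cpow_of_lt (by simp; linarith) zero_lt_one]
    have n1 : s + 1 ≠ 0 := by
      intro h; have := congrArg re h; simp at this; linarith
    have n2 : s - 1 ≠ 0 := by
      intro h; have := congrArg re h; simp at this; linarith
    have e : s - 2 + 1 = s - 1 := by ring
    have n3 : 1 - s ^ 2 ≠ 0 := by
      intro h
      have : (s + 1) * (s - 1) = 0 := by linear_combination -h
      rcases mul_eq_zero.1 this with h | h
      · exact n1 h
      · exact n2 h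
    rw [e]
    simp only [ofReal_one, one_cpow, ofReal_zero, zero_cpow n1, sub_zero]
    field_simp
    ring

lemma k_int (κ w : ℝ) (hk : |κ| ≤ 3 / 4) :
    Integrable (fun v : ℝ => exp (w * (κ + v * I)) * (1 - (κ + v * I) ^ 2)⁻¹) := by
  have hi : Integrable (fun v : ℝ => Real.exp (w * κ) * (16 * (1 + v ^ 2)⁻¹)) :=
    (integrable_inv_one_add_sq.const_mul 16).const_mul _
  refine hi.mono' ?_ (Eventually.of_forall fun v => ?_)
  · apply Continuous.aestronglyMeasurable
    apply Continuous.mul (by fun_prop)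
    apply Continuous.inv₀ (by fun_prop)
    intro v
    exact kd_ne _ (by simpa using hk)
  · rw [norm_mul, norm_exp]
    have := kd_inv (κ + v * I) (by simpa using hk)
    simp at this
    gcongr
    · simp
    · simpa using this

lemma kernel (κ w : ℝ) (hk : |κ| ≤ 3 / 4) :
    ∫ v : ℝ, exp (w * (κ + v * I)) * (1 - (κ + v * I) ^ 2)⁻¹ = Real.pi * Real.exp (-|w|) := by
  have hk' := abs_le.1 hk
  have hpos := Real.exp_pos (-w)
  have hm : ∀ y : ℝ, mellin kf (κ + y * I) = (1 - (κ + y * I) ^ 2)⁻¹ :=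
    fun y => (kf_mellin _ (by simp; linarith) (by simp; linarith)).2
  have := mellinInv_mellin_eq κ kf hpos (kf_mellin κ (by simp; linarith) (by simp; linarith)).1 (by
    have := k_int κ 0 hk
    simp only [ofReal_zero, zero_mul, exp_zero, one_mul] at this
    unfold VerticalIntegrable
    simp only [hm]; exact this) (by
    unfold kf
    have h2 : ContinuousAt (fun x : ℝ => x⁻¹) (Real.exp (-w)) := continuousAt_inv₀ hpos.ne'
    have h3 : ContinuousAt (fun x : ℝ => min x x⁻¹) (Real.exp (-w)) := continuousAt_id.min h2
    exact (continuous_ofReal.continuousAt.comp h3).div_const 2)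
  rw [mellinInv] at this
  simp only [hm, smul_eq_mul] at this
  have e : ∀ y : ℝ, ((Real.exp (-w) : ℝ) : ℂ) ^ (-(κ + y * I) : ℂ) = exp (w * (κ + y * I)) := by
    intro y
    rw [cpow_def_of_ne_zero (by exact_mod_cast hpos.ne'), ← ofReal_log hpos.le, Real.log_exp]
    congr 1; push_cast; ring
  simp only [e] at this
  have hk : kf (Real.exp (-w)) = (Real.exp (-|w|) : ℂ) / 2 := by
    rw [kf, ← Real.exp_neg, neg_neg]
    congr 1
    norm_cast
    rcases le_total 0 w with h | h
    · rw [abs_of_nonneg h, min_eq_left (Real.exp_le_exp.2 (by linarith))]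
    · rw [abs_of_nonpos h, neg_neg, min_eq_right (Real.exp_le_exp.2 (by linarith))]
  rw [hk] at this
  have hpi : (Real.pi : ℂ) ≠ 0 := by exact_mod_cast Real.pi_ne_zero
  rw [Complex.real_smul] at this
  push_cast at this ⊢
  field_simp at this
  simp only [div_eq_mul_inv] at this
  rw [this]

end TT

namespace TT
open Complex Metric

noncomputable def Gk (κ t u y : ℝ) : ℂ := exp (u * (κ + (y - t : ℝ) * I)) * (1 - (κ + (y - t : ℝ) * I) ^ 2)⁻¹

noncomputable def ww (v : ℝ) : ℝ := (1 + |v|) ^ (-(9 / 8) : ℝ)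

lemma ww_int (t : ℝ) : Integrable (fun y => ww (y - t)) := by
  have : Integrable ww := by
    have := integrable_one_add_norm (E := ℝ) (μ := volume) (r := 9 / 8) (by simp; norm_num)
    exact this
  exact this.comp_sub_right t

noncomputable def JJ : ℝ := ∫ v, ww v

lemma ww_nonneg (v : ℝ) : 0 ≤ ww v := by unfold ww; positivity

lemma JJ_nonneg : 0 ≤ JJ := integral_nonneg ww_nonneg

lemma ww_integral (t : ℝ) : ∫ y, ww (y - t) = JJ := integral_sub_right_eq_self ww t

lemma Gk_le1 (κ t u y : ℝ) (hk : |κ| ≤ 3 / 4) :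
    ‖Gk κ t u y‖ ≤ Real.exp (u * κ) * (16 * (1 + (y - t) ^ 2)⁻¹) := by
  unfold Gk
  rw [norm_mul, norm_exp]
  have := kd_inv (κ + (y - t : ℝ) * I) (by simpa using hk)
  have e : (κ + (y - t : ℝ) * I : ℂ).im = y - t := by simp
  rw [e] at this
  gcongr
  simp

lemma exp_le_T {u κ T : ℝ} (hT : 1 ≤ T) (hk : κ ≤ 3 / 4) (hu : 0 ≤ u) (hu2 : u ≤ Real.log T) :
    Real.exp (u * κ) ≤ T ^ (3 / 4 : ℝ) := by
  rw [Real.rpow_def_of_pos (by linarith)]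
  apply Real.exp_le_exp.2
  nlinarith

lemma Gk_le (κ t u y T : ℝ) (hk : |κ| ≤ 3 / 4) (hT : 1 ≤ T) (hu : 0 ≤ u) (hu2 : u ≤ Real.log T) :
    ‖Gk κ t u y‖ ≤ 32 * T ^ (3 / 4 : ℝ) * (1 + |y - t|) ^ (-2 : ℝ) := by
  have h1 := Gk_le1 κ t u y hk
  have h2 := exp_le_T hT (abs_le.1 hk).2 hu hu2
  have h3 : (1 + (y - t) ^ 2)⁻¹ ≤ 2 * (1 + |y - t|) ^ (-2 : ℝ) := by
    rw [Real.rpow_neg (by positivity)]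
    norm_cast
    rw [← sq_abs (y - t)]
    set a := |y - t|
    have ha : 0 ≤ a := abs_nonneg _
    rw [← div_eq_mul_inv, inv_eq_one_div, div_le_div_iff₀ (by positivity) (by positivity)]
    nlinarith [sq_nonneg (a - 1)]
  calc _ ≤ _ := h1
    _ ≤ T ^ (3 / 4 : ℝ) * (16 * (2 * (1 + |y - t|) ^ (-2 : ℝ))) := by gcongr
    _ = _ := by ring

lemma Gk_near (κ t u y T : ℝ) (hk : |κ| ≤ 3 / 4) (hT : 1 ≤ T) (hu : 0 ≤ u) (hu2 : u ≤ Real.log T)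
    (hy : |y - t| ≤ 7 * T) : (1 + |y - t|) / T * ‖Gk κ t u y‖ ≤ 64 * ww (y - t) := by
  have h1 := Gk_le κ t u y T hk hT hu hu2
  unfold ww
  set a := 1 + |y - t| with ha
  have ha1 : 1 ≤ a := by have := abs_nonneg (y - t); linarith
  have ha8 : a ≤ 8 * T := by linarith
  have ha0 : 0 < a := by linarith
  have hT0 : 0 < T := by linarith
  have h3 : a ^ (1 / 8 : ℝ) ≤ 2 * T ^ (1 / 8 : ℝ) := by
    calc a ^ (1 / 8 : ℝ) ≤ (8 * T) ^ (1 / 8 : ℝ) := by gcongr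
      _ = 8 ^ (1 / 8 : ℝ) * T ^ (1 / 8 : ℝ) := Real.mul_rpow (by norm_num) hT0.le
      _ ≤ 2 * T ^ (1 / 8 : ℝ) := by
        gcongr
        calc (8 : ℝ) ^ (1 / 8 : ℝ) ≤ (2 ^ (8 : ℝ)) ^ (1 / 8 : ℝ) := by gcongr; norm_num
          _ = 2 := by rw [← Real.rpow_mul (by norm_num)]; norm_num
  calc a / T * ‖Gk κ t u y‖ ≤ a / T * (32 * T ^ (3 / 4 : ℝ) * a ^ (-2 : ℝ)) := by gcongr
    _ = 32 * (T ^ (-1 : ℝ) * T ^ (3 / 4 : ℝ)) * (a ^ (1 : ℝ) * a ^ (-2 : ℝ)) := by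
        rw [Real.rpow_neg_one, Real.rpow_one]; ring
    _ = 32 * T ^ (-(1 / 4) : ℝ) * (a ^ (1 / 8 : ℝ) * a ^ (-(9 / 8) : ℝ)) := by
        rw [← Real.rpow_add hT0, ← Real.rpow_add ha0, ← Real.rpow_add ha0]; norm_num
    _ ≤ 32 * T ^ (-(1 / 4) : ℝ) * (2 * T ^ (1 / 8 : ℝ) * a ^ (-(9 / 8) : ℝ)) := by gcongr
    _ = 64 * (T ^ (-(1 / 4) : ℝ) * T ^ (1 / 8 : ℝ)) * a ^ (-(9 / 8) : ℝ) := by ring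
    _ ≤ 64 * 1 * a ^ (-(9 / 8) : ℝ) := by
        gcongr
        rw [← Real.rpow_add hT0]
        exact Real.rpow_le_one_of_one_le_of_nonpos hT (by norm_num)
    _ = _ := by ring

lemma Gk_far (κ t u y T : ℝ) (hk : |κ| ≤ 3 / 4) (hT : 1 ≤ T) (hu : 0 ≤ u) (hu2 : u ≤ Real.log T)
    (hy : T / 8 ≤ |y - t|) : (1 + Real.log T) * ‖Gk κ t u y‖ ≤ 2304 * ww (y - t) := by
  have h1 := Gk_le κ t u y T hk hT hu hu2
  unfold ww
  have hT0 : 0 < T := by linarith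
  set a := 1 + |y - t| with ha
  have ha1 : 1 ≤ a := by have := abs_nonneg (y - t); linarith
  have ha8 : T / 8 ≤ a := by linarith
  have ha0 : 0 < a := by linarith
  have hl0 : 0 ≤ Real.log T := Real.log_nonneg hT
  have hl : 1 + Real.log T ≤ 9 * T ^ (1 / 8 : ℝ) := by
    have := Real.log_le_rpow_div hT0.le (show (0 : ℝ) < 1 / 8 by norm_num)
    have h2 : 1 ≤ T ^ (1 / 8 : ℝ) := Real.one_le_rpow hT (by norm_num)
    have e : T ^ (1 / 8 : ℝ) / (1 / 8) = 8 * T ^ (1 / 8 : ℝ) := by ring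
    rw [e] at this
    linarith
  have h3 : a ^ (-(7 / 8) : ℝ) ≤ 8 * T ^ (-(7 / 8) : ℝ) := by
    calc a ^ (-(7 / 8) : ℝ) ≤ (T / 8) ^ (-(7 / 8) : ℝ) :=
          Real.rpow_le_rpow_of_nonpos (by linarith) ha8 (by norm_num)
      _ = T ^ (-(7 / 8) : ℝ) * 8 ^ (7 / 8 : ℝ) := by
          rw [Real.div_rpow hT0.le (by norm_num), Real.rpow_neg (by norm_num : (0 : ℝ) ≤ 8), div_inv_eq_mul]
      _ ≤ T ^ (-(7 / 8) : ℝ) * 8 ^ (1 : ℝ) := by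
          gcongr <;> norm_num
      _ = _ := by rw [Real.rpow_one]; ring
  calc (1 + Real.log T) * ‖Gk κ t u y‖ ≤ 9 * T ^ (1 / 8 : ℝ) * (32 * T ^ (3 / 4 : ℝ) * a ^ (-2 : ℝ)) := by
        gcongr
    _ = 9 * T ^ (1 / 8 : ℝ) * (32 * T ^ (3 / 4 : ℝ) * (a ^ (-(7 / 8) : ℝ) * a ^ (-(9 / 8) : ℝ))) := by
        rw [← Real.rpow_add ha0]; norm_num
    _ ≤ 9 * T ^ (1 / 8 : ℝ) * (32 * T ^ (3 / 4 : ℝ) * (8 * T ^ (-(7 / 8) : ℝ) * a ^ (-(9 / 8) : ℝ))) := by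
        gcongr
    _ = 2304 * (T ^ (1 / 8 : ℝ) * T ^ (3 / 4 : ℝ) * T ^ (-(7 / 8) : ℝ)) * a ^ (-(9 / 8) : ℝ) := by ring
    _ = _ := by
        rw [← Real.rpow_add hT0, ← Real.rpow_add hT0]; norm_num

lemma Gk_cont (κ t u : ℝ) (hk : |κ| ≤ 3 / 4) : Continuous (Gk κ t u) := by
  unfold Gk
  apply Continuous.mul (by fun_prop)
  apply Continuous.inv₀ (by fun_prop)
  intro v
  exact kd_ne _ (by simpa using hk)

lemma Gk_int (κ t u : ℝ) (hk : |κ| ≤ 3 / 4) : Integrable (Gk κ t u) := by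
  have := (k_int κ u hk).comp_sub_right t
  exact this

lemma Gk_integral (κ t u : ℝ) (hk : |κ| ≤ 3 / 4) : ∫ y, Gk κ t u y = Real.pi * Real.exp (-|u|) := by
  rw [← kernel κ u hk]
  exact integral_sub_right_eq_self (fun v : ℝ => exp (u * (κ + v * I)) * (1 - (κ + v * I) ^ 2)⁻¹) t

lemma tail_bound (ψ : ℝ → ℂ) (κ t u T B c d : ℝ) (hk : |κ| ≤ 3 / 4) (hT : 1 ≤ T) (hu : 0 ≤ u)
    (hu2 : u ≤ Real.log T) (hB : 0 ≤ B) (hψ : ∀ y, ‖ψ y‖ ≤ B * (1 + Real.log T)) (hψc : Continuous ψ)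
    (hc : c ≤ t - T / 8) (hd : t + T / 8 ≤ d) :
    ‖(∫ y in c..d, ψ y * Gk κ t u y) - ∫ y, ψ y * Gk κ t u y‖ ≤ 2304 * B * JJ := by
  have hi : Integrable (fun y => ψ y * Gk κ t u y) :=
    (Gk_int κ t u hk).bdd_mul hψc.aestronglyMeasurable (Eventually.of_forall hψ)
  have hcd : c ≤ d := by linarith
  rw [intervalIntegral.integral_of_le hcd, ← integral_add_compl (measurableSet_Ioc (a := c) (b := d)) hi, sub_add_cancel_left, norm_neg]
  have hg : Integrable (fun y => 2304 * B * ww (y - t)) := (ww_int t).const_mul _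
  refine (norm_integral_le_of_norm_le hg.integrableOn (g := fun y => 2304 * B * ww (y - t)) ?_).trans ?_
  · filter_upwards [self_mem_ae_restrict measurableSet_Ioc.compl] with y hy
    have h8 : T / 8 ≤ |y - t| := by
      rw [mem_compl_iff, mem_Ioc, not_and_or, not_lt, not_le] at hy
      rcases hy with h | h
      · rw [abs_of_nonpos (by linarith)]; linarith
      · rw [abs_of_nonneg (by linarith)]; linarith
    have := Gk_far κ t u y T hk hT hu hu2 h8
    rw [norm_mul]
    calc _ ≤ B * (1 + Real.log T) * ‖Gk κ t u y‖ := by gcongr; exact hψ y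
      _ = B * ((1 + Real.log T) * ‖Gk κ t u y‖) := by ring
      _ ≤ B * (2304 * ww (y - t)) := by gcongr
      _ = _ := by ring
  · calc _ ≤ ∫ y, 2304 * B * ww (y - t) := by
          apply setIntegral_le_integral hg
          exact Eventually.of_forall fun y => mul_nonneg (by positivity) (ww_nonneg _)
      _ = _ := by rw [integral_const_mul, ww_integral]

lemma near_bound (φ : ℝ → ℂ) (κ t u T D c d : ℝ) (hk : |κ| ≤ 3 / 4) (hT : 1 ≤ T) (hu : 0 ≤ u)
    (hu2 : u ≤ Real.log T) (hD : 0 ≤ D) (hcd : c ≤ d)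
    (hφ : ∀ y ∈ Icc c d, |y - t| ≤ 7 * T ∧ ‖φ y‖ ≤ D * ((1 + |y - t|) / T)) :
    ‖∫ y in c..d, φ y * Gk κ t u y‖ ≤ 64 * D * JJ := by
  rw [intervalIntegral.integral_of_le hcd]
  have hg : Integrable (fun y => 64 * D * ww (y - t)) := (ww_int t).const_mul _
  refine (norm_integral_le_of_norm_le hg.integrableOn (g := fun y => 64 * D * ww (y - t)) ?_).trans ?_
  · filter_upwards [self_mem_ae_restrict measurableSet_Ioc] with y hy
    obtain ⟨h7, h8⟩ := hφ y ⟨hy.1.le, hy.2⟩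
    have := Gk_near κ t u y T hk hT hu hu2 h7
    rw [norm_mul]
    calc _ ≤ D * ((1 + |y - t|) / T) * ‖Gk κ t u y‖ := by gcongr
      _ = D * ((1 + |y - t|) / T * ‖Gk κ t u y‖) := by ring
      _ ≤ D * (64 * ww (y - t)) := by gcongr
      _ = _ := by ring
  · calc _ ≤ ∫ y, 64 * D * ww (y - t) := by
          apply setIntegral_le_integral hg
          exact Eventually.of_forall fun y => mul_nonneg (by positivity) (ww_nonneg _)
      _ = _ := by rw [integral_const_mul, ww_integral]

lemma arch_bound (t T : ℝ) (hT : 1 ≤ T) (h4 : 4 ≤ |t|) (ht : |t| ≤ 4 * T) : ‖arch t‖ ≤ 10 * (1 + Real.log T) := by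
  have h1 := arch_log t h4
  have b : 4 / |t| ≤ 1 := by rw [div_le_one (by linarith)]; exact h4
  set w : ℂ := 5 / 8 + (t / 2 : ℝ) * I with hw
  have hn1 : |t| / 2 ≤ ‖w‖ := by
    have := abs_im_le_norm w
    rw [hw] at this ⊢
    simpa [abs_div] using this
  have hn2 : ‖w‖ ≤ |t| := by
    have : ‖w‖ ≤ ‖(5 / 8 : ℂ)‖ + ‖((t / 2 : ℝ) : ℂ) * I‖ := norm_add_le _ _
    rw [norm_mul, norm_I, mul_one, norm_real, Real.norm_eq_abs, abs_div, abs_two] at this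
    norm_num at this
    linarith
  have l0 : 0 ≤ Real.log ‖w‖ := Real.log_nonneg (by linarith)
  have l1 : Real.log ‖w‖ ≤ 3 + Real.log T := by
    calc Real.log ‖w‖ ≤ Real.log (4 * T) := Real.log_le_log (by linarith) (by linarith)
      _ = Real.log 4 + Real.log T := Real.log_mul (by norm_num) (by linarith)
      _ ≤ _ := by
        have := Real.log_le_sub_one_of_pos (show (0 : ℝ) < 4 by norm_num)
        linarith
  have l4 : Real.log Real.pi ≤ 4 := by
    have := Real.log_le_sub_one_of_pos Real.pi_pos
    linarith [Real.pi_le_four]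
  have l5 : 0 ≤ Real.log Real.pi := Real.log_nonneg (by linarith [Real.pi_gt_three])
  have hl : ‖log w‖ ≤ 3 + Real.log T + 4 := by
    refine (norm_le_abs_re_add_abs_im _).trans ?_
    rw [log_re, log_im, abs_of_nonneg l0]
    have := abs_arg_le_pi w
    linarith [Real.pi_le_four]
  have hl0 := Real.log_nonneg hT
  have e : arch t = (arch t - (-(Real.log Real.pi) / 2 + log w / 2)) + -(Real.log Real.pi : ℂ) / 2 + log w / 2 := by ring
  rw [e]
  refine norm_add₃_le.trans ?_
  rw [norm_div, norm_div, norm_neg, norm_real, Real.norm_of_nonneg l5]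
  simp only [RCLike.norm_ofNat]
  linarith

lemma arch_cont : Continuous arch := by
  have ho : IsOpen {s : ℂ | 0 < s.re} := isOpen_lt continuous_const continuous_re
  have hd : DifferentiableOn ℂ Gammaℝ {s : ℂ | 0 < s.re} := by
    intro s hs
    have h : DifferentiableAt ℂ (fun s => (Gammaℝ s)⁻¹) s := differentiable_Gammaℝ_inv s
    have := h.inv (inv_ne_zero (Gammaℝ_ne_zero_of_re_pos hs))
    have e : (fun s => (Gammaℝ s)⁻¹)⁻¹ = Gammaℝ := by funext s; simp
    rw [e] at this
    exact this.differentiableWithinAt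
  have h1 : ContinuousOn (logDeriv Gammaℝ) {s : ℂ | 0 < s.re} :=
    ((hd.deriv ho).div hd (fun s hs => Gammaℝ_ne_zero_of_re_pos hs)).continuousOn
  exact h1.comp_continuous (by fun_prop) (fun y => by simp)

end TT

namespace TT
open Complex Metric
open scoped ArithmeticFunction.vonMangoldt

noncomputable def cc (u : ℝ) (n : ℕ) : ℝ := Λ n * (n : ℝ) ^ (-(1 / 2) : ℝ) * Real.exp (-|u - Real.log n|)

noncomputable def PP (u t : ℝ) : ℂ := ∑' n : ℕ, (cc u n : ℂ) * exp (-(t * Real.log n : ℝ) * I)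

noncomputable def pc (n : ℕ) : ℝ := Λ n * (n : ℝ) ^ (-(5 / 4) : ℝ)

lemma pc_nonneg (n : ℕ) : 0 ≤ pc n := mul_nonneg ArithmeticFunction.vonMangoldt_nonneg (by positivity)

lemma cc_nonneg (u : ℝ) (n : ℕ) : 0 ≤ cc u n :=
  mul_nonneg (mul_nonneg ArithmeticFunction.vonMangoldt_nonneg (by positivity)) (Real.exp_pos _).le

lemma term_eq (y : ℝ) (n : ℕ) : LSeries.term (fun n => ((Λ n : ℝ) : ℂ)) (5 / 4 + y * I) n
    = (pc n : ℂ) * exp (-(y * Real.log n : ℝ) * I) := by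
  rcases eq_or_ne n 0 with rfl | hn
  · simp [pc]
  · rw [LSeries.term_of_ne_zero hn, pc, div_eq_mul_inv]
    have hn0 : (0 : ℝ) < n := by positivity
    have hnc : (n : ℂ) ≠ 0 := by exact_mod_cast hn
    rw [← cpow_neg]
    push_cast
    rw [mul_assoc]
    congr 1
    have e1 : (((n : ℝ) ^ (-(5 / 4) : ℝ) : ℝ) : ℂ) = exp ((Real.log n * (-(5 / 4)) : ℝ)) := by
      rw [Real.rpow_def_of_pos hn0, ofReal_exp]
    rw [e1, cpow_def_of_ne_zero hnc, ← Complex.exp_add, ← Complex.natCast_log]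
    congr 1
    push_cast
    ring

lemma norm_exp_I (x : ℝ) : ‖exp (-(x : ℝ) * I)‖ = 1 := by
  have := norm_exp_ofReal_mul_I (-x)
  rwa [ofReal_neg] at this

lemma pc_summable : Summable pc := by
  have h := ArithmeticFunction.LSeriesSummable_vonMangoldt (s := 5 / 4 + (0 : ℝ) * I) (by simp; norm_num)
  have h2 := h.norm
  refine h2.congr ?_
  intro n
  rw [term_eq, norm_mul, norm_exp_I, mul_one, norm_real, Real.norm_of_nonneg (pc_nonneg n)]

noncomputable def PB : ℝ := ∑' n, pc n

lemma PB_nonneg : 0 ≤ PB := tsum_nonneg pc_nonneg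

lemma LL_eq (y : ℝ) : LL (5 / 4 + y * I) = ∑' n : ℕ, (pc n : ℂ) * exp (-(y * Real.log n : ℝ) * I) := by
  unfold LL LSeries
  exact tsum_congr fun n => term_eq y n

lemma LL_term_norm (y : ℝ) (n : ℕ) : ‖(pc n : ℂ) * exp (-(y * Real.log n : ℝ) * I)‖ = pc n := by
  rw [norm_mul, norm_exp_I, mul_one, norm_real, Real.norm_of_nonneg (pc_nonneg n)]

lemma LL_bound (y : ℝ) : ‖LL (5 / 4 + y * I)‖ ≤ PB := by
  rw [LL_eq]
  exact tsum_of_norm_bounded pc_summable.hasSum fun n => (LL_term_norm y n).le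

lemma LL_cont : Continuous (fun y : ℝ => LL (5 / 4 + y * I)) := by
  simp only [LL_eq]
  apply continuous_tsum (u := pc) _ pc_summable (fun n y => (LL_term_norm y n).le)
  intro n
  fun_prop

lemma cc_le (u : ℝ) (n : ℕ) : cc u n ≤ Real.exp (3 / 4 * u) * pc n := by
  rcases eq_or_ne n 0 with rfl | hn
  · simp [cc, pc]
  have hn0 : (0 : ℝ) < n := by positivity
  have h1 : Real.exp (-|u - Real.log n|) ≤ Real.exp (3 / 4 * u) * (n : ℝ) ^ (-(3 / 4) : ℝ) := by
    rw [Real.rpow_def_of_pos hn0, ← Real.exp_add, Real.exp_le_exp]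
    rcases le_total 0 (u - Real.log n) with h | h
    · rw [abs_of_nonneg h]; linarith
    · rw [abs_of_nonpos h]; linarith
  have h2 : (n : ℝ) ^ (-(5 / 4) : ℝ) = (n : ℝ) ^ (-(1 / 2) : ℝ) * (n : ℝ) ^ (-(3 / 4) : ℝ) := by
    rw [← Real.rpow_add hn0]; norm_num
  unfold cc pc
  rw [h2]
  have h3 : 0 ≤ Λ n * (n : ℝ) ^ (-(1 / 2) : ℝ) := mul_nonneg ArithmeticFunction.vonMangoldt_nonneg (by positivity)
  calc _ ≤ Λ n * (n : ℝ) ^ (-(1 / 2) : ℝ) * (Real.exp (3 / 4 * u) * (n : ℝ) ^ (-(3 / 4) : ℝ)) := by gcongr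
    _ = _ := by ring

lemma PP_term_norm (u t : ℝ) (n : ℕ) : ‖(cc u n : ℂ) * exp (-(t * Real.log n : ℝ) * I)‖ = cc u n := by
  rw [norm_mul, norm_exp_I, mul_one, norm_real, Real.norm_of_nonneg (cc_nonneg u n)]

lemma cc_summable (u : ℝ) : Summable (cc u) :=
  Summable.of_nonneg_of_le (cc_nonneg u) (cc_le u) (pc_summable.mul_left _)

lemma PP_summable (u t : ℝ) : Summable fun n : ℕ => (cc u n : ℂ) * exp (-(t * Real.log n : ℝ) * I) :=
  Summable.of_norm ((cc_summable u).congr fun n => (PP_term_norm u t n).symm)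

lemma PP_bound (u t : ℝ) : ‖PP u t‖ ≤ Real.exp (3 / 4 * u) * PB := by
  unfold PP
  refine tsum_of_norm_bounded (pc_summable.hasSum.mul_left _) fun n => ?_
  rw [PP_term_norm]
  exact cc_le u n

lemma LL_int (u t : ℝ) : ∫ y : ℝ, LL (5 / 4 + y * I) * Gk (3 / 4) t u y = Real.pi * PP u t := by
  have hk : |(3 / 4 : ℝ)| ≤ 3 / 4 := by rw [abs_of_nonneg (by norm_num)]
  have hI : ∀ n : ℕ, Integrable fun y : ℝ => (pc n : ℂ) * exp (-(y * Real.log n : ℝ) * I) * Gk (3 / 4) t u y := by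
    intro n
    apply (Gk_int _ t u hk).bdd_mul (c := pc n)
    · exact Continuous.aestronglyMeasurable (by fun_prop)
    · exact Eventually.of_forall fun y => (LL_term_norm y n).le
  have hs := hasSum_integral_of_summable_integral_norm hI (by
    have e : ∀ n : ℕ, ∫ y : ℝ, ‖(pc n : ℂ) * exp (-(y * Real.log n : ℝ) * I) * Gk (3 / 4) t u y‖
        = pc n * ∫ y : ℝ, ‖Gk (3 / 4) t u y‖ := by
      intro n
      rw [← integral_const_mul]
      congr 1
      funext y
      rw [norm_mul, LL_term_norm]
    simp only [e]
    exact pc_summable.mul_right _)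
  have e2 : ∀ y : ℝ, LL (5 / 4 + y * I) * Gk (3 / 4) t u y
      = ∑' n : ℕ, (pc n : ℂ) * exp (-(y * Real.log n : ℝ) * I) * Gk (3 / 4) t u y := by
    intro y
    rw [LL_eq, tsum_mul_right]
  simp only [e2]
  rw [← hs.tsum_eq, PP, ← tsum_mul_left]
  refine tsum_congr fun n => ?_
  rcases eq_or_ne n 0 with rfl | hn
  · simp [pc, cc]
  have hn0 : (0 : ℝ) < n := by positivity
  have e3 : ∀ y : ℝ, (pc n : ℂ) * exp (-(y * Real.log n : ℝ) * I) * Gk (3 / 4) t u y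
      = ((Λ n * (n : ℝ) ^ (-(1 / 2) : ℝ) : ℝ) : ℂ) * exp (-(t * Real.log n : ℝ) * I) * Gk (3 / 4) t (u - Real.log n) y := by
    intro y
    have e1 : (n : ℝ) ^ (-(5 / 4) : ℝ) = (n : ℝ) ^ (-(1 / 2) : ℝ) * Real.exp (-(3 / 4) * Real.log n) := by
      rw [Real.rpow_def_of_pos hn0, Real.rpow_def_of_pos hn0, ← Real.exp_add]; ring_nf
    rw [pc, e1, Gk, Gk]
    push_cast
    have e4 : exp (-(3 / 4) * log (n : ℂ)) * exp (-(y * log (n : ℂ)) * I) * exp (u * (3 / 4 + (y - t) * I))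
        = exp (-(t * log (n : ℂ)) * I) * exp ((u - log (n : ℂ)) * (3 / 4 + (y - t) * I)) := by
      rw [← Complex.exp_add, ← Complex.exp_add, ← Complex.exp_add]; congr 1; ring
    linear_combination (Λ n : ℂ) * ((n : ℝ) ^ (-(1 / 2) : ℝ) : ℝ) * (1 - (3 / 4 + (y - t) * I) ^ 2 : ℂ)⁻¹ * e4
  simp only [e3]
  rw [integral_const_mul, Gk_integral _ _ _ hk, cc]
  push_cast
  ring

end TT

namespace TT
open Complex Metric

local notation "Xi" => completedRiemannZeta

noncomputable def Gs (u t : ℝ) (s : ℂ) : ℂ := exp (u * (s - 1 / 2 - t * I)) * (1 - (s - 1 / 2 - t * I) ^ 2)⁻¹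

noncomputable def SS (Z : Finset ℂ) (u t : ℝ) : ℂ := ∑ ρ ∈ Z, (zetaMult ρ : ℂ) * Gs u t ρ

lemma Gs_Gk (u t x y : ℝ) : Gs u t (x + y * I) = Gk (x - 1 / 2) t u y := by
  have : (x + y * I - 1 / 2 - t * I : ℂ) = ((x - 1 / 2 : ℝ) : ℂ) + ((y - t : ℝ) : ℂ) * I := by push_cast; ring
  rw [Gs, Gk, this]

lemma arch_part (σ κ t u T c d : ℝ) (hσ : |σ| = 1) (hσ2 : σ * σ = 1) (hk : |κ| ≤ 3 / 4) (hT : 16 ≤ T) (hu : 0 ≤ u)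
    (hu2 : u ≤ Real.log T) (ht1 : T / 2 ≤ t) (ht2 : t ≤ 4 * T) (hc1 : T / 4 ≤ c) (hc2 : c ≤ T / 4 + 1)
    (hd1 : 5 * T ≤ d) (hd2 : d ≤ 5 * T + 1) :
    ‖(∫ y in c..d, arch (σ * y) * Gk κ t u y) - arch (σ * t) * (Real.pi * Real.exp (-u))‖ ≤ 26000 * JJ := by
  have hσa : Continuous fun y => arch (σ * y) := arch_cont.comp (by fun_prop)
  have hG := Gk_cont κ t u hk
  have e : (∫ y in c..d, arch (σ * y) * Gk κ t u y) = (∫ y in c..d, (arch (σ * y) - arch (σ * t)) * Gk κ t u y)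
      + ∫ y in c..d, arch (σ * t) * Gk κ t u y := by
    rw [← intervalIntegral.integral_add]
    · congr 1; funext y; ring
    · apply Continuous.intervalIntegrable; fun_prop
    · apply Continuous.intervalIntegrable; fun_prop
  have h1 := near_bound (fun y => arch (σ * y) - arch (σ * t)) κ t u T 32 c d hk (by linarith) hu hu2 (by norm_num)
    (by linarith) (by
      intro y hy
      constructor
      · rw [abs_le]; constructor <;> linarith [hy.1, hy.2]
      · have := arch_diff σ (T / 4) (σ * y) (σ * t) hσ (by linarith) (by rw [← mul_assoc, hσ2]; linarith [hy.1])
          (by rw [← mul_assoc, hσ2]; linarith)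
        rw [← mul_sub, abs_mul, hσ, one_mul] at this
        refine this.trans ?_
        have e : 32 * ((1 + |y - t|) / T) = (8 + 8 * |y - t|) / (T / 4) := by field_simp; ring
        rw [e]
        have := abs_nonneg (y - t)
        gcongr
        linarith)
  have h2 := tail_bound (fun _ => arch (σ * t)) κ t u T 10 c d hk (by linarith) hu hu2 (by norm_num)
    (fun _ => arch_bound _ T (by linarith) (by rw [abs_mul, hσ, one_mul, abs_of_nonneg] <;> linarith)
      (by rw [abs_mul, hσ, one_mul, abs_of_nonneg] <;> linarith)) continuous_const (by linarith) (by linarith)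
  rw [integral_const_mul, Gk_integral κ t u hk, abs_of_nonneg hu] at h2
  rw [e, add_sub_assoc]
  refine (norm_add_le _ _).trans ?_
  have := JJ_nonneg
  linarith

lemma explicit : ∃ C T0 : ℝ, 0 < C ∧ ∀ T ≥ T0, ∃ Z : Finset ℂ,
    (∀ ρ ∈ Z, IsNontrivialZero ρ ∧ T / 4 ≤ ρ.im ∧ ρ.im ≤ 6 * T) ∧
    (∀ ρ, IsNontrivialZero ρ → T / 2 ≤ ρ.im → ρ.im ≤ 5 * T → ρ ∈ Z) ∧
    ∀ t ∈ Icc (T / 2) (4 * T), ∀ u ∈ Icc 0 (Real.log T),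
      ‖2 * SS Z u t + PP u t - Real.log t * Real.exp (-u)‖ ≤ C := by
  obtain ⟨C, Y0, hC, hh⟩ := horiz
  refine ⟨26000 * JJ + 26000 * JJ + 2304 * PB * JJ + PB * 16 * Real.pi + 12288 * C + 10, max 16 (4 * Y0), by
    have := JJ_nonneg; have := PB_nonneg; positivity, ?_⟩
  intro T hT
  have hT16 : 16 ≤ T := (le_max_left _ _).trans hT
  have hTY : 4 * Y0 ≤ T := (le_max_right _ _).trans hT
  obtain ⟨c, hc, hcne, hcint⟩ := hh (T / 4) (by linarith)
  obtain ⟨d, hd, hdne, hdint⟩ := hh (5 * T) (by linarith)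
  have hc1 := hc.1
  have hc2 := hc.2
  have hd1 := hd.1
  have hd2 := hd.2
  have hfin := Xi_zeros_finite (Icc (-1 / 4 : ℝ) (5 / 4) ×ℂ Icc c d) (by
    exact (isBounded_Icc _ _).reProdIm (isBounded_Icc _ _)) (by
    intro s hs
    rw [mem_reProdIm] at hs
    have := hs.2.1
    intro h; linarith)
  have hmemZ : ∀ s, s ∈ hfin.toFinset ↔ s ∈ Icc (-1 / 4 : ℝ) (5 / 4) ×ℂ Icc c d ∧ Xi s = 0 := by
    intro s; rw [Set.Finite.mem_toFinset]; rfl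
  refine ⟨hfin.toFinset, ?_, ?_, ?_⟩
  · intro ρ hρ
    obtain ⟨h1, h2⟩ := (hmemZ ρ).1 hρ
    rw [mem_reProdIm] at h1
    refine ⟨(ntz_iff (by linarith [h1.2.1] : ρ.im ≠ 0) |>.2 h2), by linarith [h1.2.1], by linarith [h1.2.2]⟩
  · intro ρ hρ h1 h2
    rw [hmemZ, mem_reProdIm]
    exact ⟨⟨⟨by linarith [hρ.2.1], by linarith [hρ.2.2]⟩, ⟨by linarith, by linarith⟩⟩, (ntz_iff (by linarith)).1 hρ⟩
  intro t ht u hu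
  have hu0 := hu.1
  have hu2 := hu.2
  have ht1 := ht.1
  have ht2 := ht.2
  set Z := hfin.toFinset with hZdef
  have hres := rI_residue Xi (Gs u t) {s | 0 < s.im ∧ |s.re - 1 / 2| < 1} (by
      apply IsOpen.inter
      · exact isOpen_lt continuous_const continuous_im
      · exact isOpen_lt (f := fun s : ℂ => |s.re - 1 / 2|) (continuous_re.sub continuous_const).abs continuous_const)
    (fun s hs => (Xi_diff hs.1.ne').differentiableWithinAt) (by
      intro s hs
      apply DifferentiableAt.differentiableWithinAt
      unfold Gs
      apply DifferentiableAt.mul (by fun_prop)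
      apply DifferentiableAt.inv (by fun_prop)
      have hre : |(s - 1 / 2 - t * I).re| < 1 := by simpa using hs.2
      set z := s - 1 / 2 - t * I
      intro h
      have : (1 - z) * (1 + z) = 0 := by linear_combination h
      rw [abs_lt] at hre
      rcases mul_eq_zero.1 this with h | h
      · have := congrArg re h; simp only [sub_re, one_re, zero_re] at this; linarith
      · have := congrArg re h; simp only [add_re, one_re, zero_re] at this; linarith)
    zetaMult Z (-1 / 4) (5 / 4) c d (by norm_num) (by linarith) (by
      intro s hs
      rw [mem_reProdIm] at hs
      refine ⟨by linarith [hs.2.1], ?_⟩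
      rw [abs_lt]; constructor <;> linarith [hs.1.1, hs.1.2]) (by
      intro z hz
      obtain ⟨h1, h2⟩ := (hmemZ z).1 hz
      rw [mem_reProdIm] at h1
      have him : z.im ≠ 0 := by linarith [h1.2.1]
      have hre := Xi_zero_re him h2
      have hz' : (z.re : ℂ) + z.im * I = z := re_add_im z
      refine ⟨⟨by linarith, by linarith, lt_of_le_of_ne h1.2.1 ?_, lt_of_le_of_ne h1.2.2 ?_⟩, Xi_order him⟩
      · intro h
        apply hcne z.re h1.1
        rw [h, hz', h2]
      · intro h
        apply hdne z.re h1.1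
        rw [← h, hz', h2]) (by
      intro s hs hsZ h0
      exact hsZ ((hmemZ s).2 ⟨hs, h0⟩))
  have hhor : ∀ y, T / 8 ≤ |y - t| → 1 ≤ y → (∀ σ ∈ Icc (-1 / 4 : ℝ) (5 / 4), Xi (σ + y * I) ≠ 0) →
      ∫ σ in (-1 / 4 : ℝ)..(5 / 4), ‖logDeriv Xi (σ + y * I)‖ ≤ C * (5 * T) →
      ‖∫ x in (-1 / 4 : ℝ)..(5 / 4), logDeriv Xi (x + y * I) * Gs u t (x + y * I)‖ ≤ 6144 * C := by
    intro y hy hy1 hne hint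
    have hcont : ContinuousOn (fun σ : ℝ => ‖logDeriv Xi (σ + y * I)‖) (uIcc (-1 / 4) (5 / 4)) := by
      rw [uIcc_of_le (by norm_num)]
      have ho : IsOpen {s : ℂ | s.im ≠ 0} := isOpen_ne_fun continuous_im continuous_const
      have hdf : DifferentiableOn ℂ Xi {s : ℂ | s.im ≠ 0} := fun s hs => (Xi_diff hs).differentiableWithinAt
      apply ContinuousOn.norm
      have hmap : MapsTo (fun σ : ℝ => (σ + y * I : ℂ)) (Icc (-1 / 4) (5 / 4)) {s : ℂ | s.im ≠ 0} := by
        intro σ _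
        simp only [mem_ofPred_eq, add_im, ofReal_im, mul_im, ofReal_re, I_im, mul_one, I_re, mul_zero, add_zero, zero_add]
        linarith
      have hc0 : ContinuousOn (fun σ : ℝ => (σ + y * I : ℂ)) (Icc (-1 / 4) (5 / 4)) := by fun_prop
      exact ((hdf.deriv ho).continuousOn.comp hc0 hmap).div (hdf.continuousOn.comp hc0 hmap) hne
    have hTpos : 0 < T := by linarith
    refine (intervalIntegral.norm_integral_le_of_norm_le (by norm_num) (g := fun σ => 1024 / T * ‖logDeriv Xi (σ + y * I)‖) ?_ ?_).trans ?_
    · apply Eventually.of_forall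
      intro x hx
      rw [norm_mul, mul_comm]
      gcongr
      rw [Gs_Gk]
      have hk : |x - 1 / 2| ≤ 3 / 4 := by rw [abs_le]; constructor <;> linarith [hx.1, hx.2]
      have h1 := Gk_le1 (x - 1 / 2) t u y hk
      have h2 := exp_le_T (by linarith) (abs_le.1 hk).2 hu0 hu2
      have h3 : T ^ (3 / 4 : ℝ) ≤ T := by
        calc _ ≤ T ^ (1 : ℝ) := Real.rpow_le_rpow_of_exponent_le (by linarith) (by norm_num)
          _ = T := Real.rpow_one T
      have h4 : (1 + (y - t) ^ 2)⁻¹ ≤ 64 / T ^ 2 := by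
        have : T ^ 2 / 64 ≤ (y - t) ^ 2 := by rw [← sq_abs (y - t)]; nlinarith
        calc _ ≤ (T ^ 2 / 64)⁻¹ := by gcongr; linarith
          _ = _ := by field_simp
      calc _ ≤ _ := h1
        _ ≤ T * (16 * (64 / T ^ 2)) := by gcongr; linarith
        _ = 1024 / T := by field_simp; norm_num
    · exact (hcont.intervalIntegrable).const_mul _
    · rw [intervalIntegral.integral_const_mul]
      calc _ ≤ 1024 / T * (C * (5 * T)) := by gcongr
        _ = 5120 * C := by field_simp; norm_num
        _ ≤ _ := by linarith
  have hH1 := hhor c (by rw [abs_of_nonpos (by linarith)]; linarith) (by linarith) hcne (by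
    refine hcint.trans ?_
    gcongr; linarith)
  have hH2 := hhor d (by rw [abs_of_nonneg (by linarith)]; linarith) (by linarith) hdne hdint
  have hk1 : |(3 / 4 : ℝ)| ≤ 3 / 4 := by rw [abs_of_nonneg (by norm_num)]
  have hk2 : |(-(3 / 4) : ℝ)| ≤ 3 / 4 := by rw [abs_neg, abs_of_nonneg (by norm_num)]
  have hG1 := Gk_cont (3 / 4) t u hk1
  have hG2 := Gk_cont (-(3 / 4)) t u hk2
  have hL := LL_cont
  have hL2 : Continuous (fun y : ℝ => LL (5 / 4 + (-1 * y : ℝ) * I)) := LL_cont.comp (by fun_prop : Continuous fun y : ℝ => -1 * y)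
  have hA1 : Continuous fun y => arch (1 * y) := arch_cont.comp (by fun_prop)
  have hA2 : Continuous fun y => arch (-1 * y) := arch_cont.comp (by fun_prop)
  have hright : ∫ y in c..d, logDeriv Xi ((5 / 4 : ℝ) + y * I) * Gs u t ((5 / 4 : ℝ) + y * I)
      = (∫ y in c..d, arch (1 * y) * Gk (3 / 4) t u y) - ∫ y in c..d, LL (5 / 4 + y * I) * Gk (3 / 4) t u y := by
    rw [← intervalIntegral.integral_sub (by apply Continuous.intervalIntegrable; fun_prop) (by apply Continuous.intervalIntegrable; fun_prop)]
    apply intervalIntegral.integral_congr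
    intro y hy
    rw [uIcc_of_le (by linarith)] at hy
    simp only []
    rw [Gs_Gk, logDeriv_Xi_eq _ (by simp; linarith [hy.1]) (by simp; norm_num)]
    have e : (5 / 4 - 1 / 2 : ℝ) = 3 / 4 := by norm_num
    rw [e, arch, one_mul]
    push_cast
    ring
  have hleft : ∫ y in c..d, logDeriv Xi ((-1 / 4 : ℝ) + y * I) * Gs u t ((-1 / 4 : ℝ) + y * I)
      = (∫ y in c..d, LL (5 / 4 + (-1 * y : ℝ) * I) * Gk (-(3 / 4)) t u y) - ∫ y in c..d, arch (-1 * y) * Gk (-(3 / 4)) t u y := by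
    rw [← intervalIntegral.integral_sub (by apply Continuous.intervalIntegrable; fun_prop) (by apply Continuous.intervalIntegrable; fun_prop)]
    apply intervalIntegral.integral_congr
    intro y hy
    rw [uIcc_of_le (by linarith)] at hy
    simp only []
    have e1 : (1 - (((-1 / 4 : ℝ) : ℂ) + y * I)) = 5 / 4 + (-1 * y : ℝ) * I := by push_cast; ring
    rw [Gs_Gk, logDeriv_Xi_symm _ (by simp; linarith [hy.1]), e1,
      logDeriv_Xi_eq _ (by simp; linarith [hy.1]) (by simp; norm_num)]
    have e : (-1 / 4 - 1 / 2 : ℝ) = -(3 / 4) := by norm_num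
    rw [e, arch]
    ring
  have hr1 := arch_part 1 (3 / 4) t u T c d (by simp) (by norm_num) hk1 hT16 hu0 hu2 ht1 ht2 hc1 hc2 hd1 hd2
  have hr2 := arch_part (-1) (-(3 / 4)) t u T c d (by simp) (by norm_num) hk2 hT16 hu0 hu2 ht1 ht2 hc1 hc2 hd1 hd2
  have hr3 := tail_bound (fun y => LL (5 / 4 + y * I)) (3 / 4) t u T PB c d hk1 (by linarith) hu0 hu2 PB_nonneg
    (fun y => (LL_bound y).trans (by
      have := Real.log_nonneg (by linarith : (1 : ℝ) ≤ T)
      nlinarith [PB_nonneg])) hL (by linarith) (by linarith)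
  rw [LL_int] at hr3
  have hr4 : ‖∫ y in c..d, LL (5 / 4 + (-1 * y : ℝ) * I) * Gk (-(3 / 4)) t u y‖ ≤ PB * 16 * Real.pi := by
    rw [intervalIntegral.integral_of_le (by linarith)]
    have hg : Integrable (fun y => PB * 16 * (1 + (y - t) ^ 2)⁻¹) := (integrable_inv_one_add_sq.comp_sub_right t).const_mul _
    refine (norm_integral_le_of_norm_le hg.integrableOn (g := fun y => PB * 16 * (1 + (y - t) ^ 2)⁻¹) ?_).trans ?_
    · apply Eventually.of_forall
      intro y
      rw [norm_mul]
      have h1 := Gk_le1 (-(3 / 4)) t u y hk2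
      have h2 : Real.exp (u * -(3 / 4)) ≤ 1 := Real.exp_le_one_iff.2 (by nlinarith)
      have h3 := LL_bound (-1 * y)
      calc _ ≤ PB * (1 * (16 * (1 + (y - t) ^ 2)⁻¹)) := by
            have := PB_nonneg
            gcongr
            refine h1.trans ?_
            gcongr
        _ = _ := by ring
    · calc _ ≤ ∫ y, PB * 16 * (1 + (y - t) ^ 2)⁻¹ := by
            apply setIntegral_le_integral hg
            have := PB_nonneg
            exact Eventually.of_forall fun y => (by simp only [Pi.zero_apply]; positivity)
        _ = PB * 16 * ∫ y, (1 + (y - t) ^ 2)⁻¹ := integral_const_mul _ _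
        _ = _ := by
          rw [integral_sub_right_eq_self (fun y : ℝ => (1 + y ^ 2)⁻¹) t, integral_univ_inv_one_add_sq]
  rw [rI, hright, hleft] at hres
  have hr5 := arch_sum t (by linarith)
  rw [one_mul] at hr1
  have e6 : (-1 : ℝ) * t = -t := by ring
  rw [e6] at hr2
  change _ = 2 * Real.pi * I * SS Z u t at hres
  set H1 := ∫ x in (-1 / 4 : ℝ)..(5 / 4), logDeriv Xi (x + c * I) * Gs u t (x + c * I)
  set H2 := ∫ x in (-1 / 4 : ℝ)..(5 / 4), logDeriv Xi (x + d * I) * Gs u t (x + d * I)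
  set R1 := ∫ y in c..d, arch (1 * y) * Gk (3 / 4) t u y
  set R2 := ∫ y in c..d, LL (5 / 4 + y * I) * Gk (3 / 4) t u y
  set L1 := ∫ y in c..d, LL (5 / 4 + (-1 * y : ℝ) * I) * Gk (-(3 / 4)) t u y
  set L2 := ∫ y in c..d, arch (-1 * y) * Gk (-(3 / 4)) t u y
  have hpi : (Real.pi : ℂ) ≠ 0 := by exact_mod_cast Real.pi_ne_zero
  have key : 2 * SS Z u t + PP u t - Real.log t * Real.exp (-u)
      = (Real.pi : ℂ)⁻¹ * ((R1 - arch t * (Real.pi * Real.exp (-u))) + (L2 - arch (-t) * (Real.pi * Real.exp (-u)))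
        - (R2 - Real.pi * PP u t) - L1 - I * H1 + I * H2) + Real.exp (-u) * (arch t + arch (-t) - Real.log t) := by
    field_simp
    linear_combination I * hres + 2 * Real.pi * SS Z u t * I_sq - (R1 - R2 - L1 + L2) * I_sq
  rw [key]
  refine (norm_add_le _ _).trans ?_
  have hn : ∀ a b c d e f : ℂ, ‖a + b - c - d - e + f‖ ≤ ‖a‖ + ‖b‖ + ‖c‖ + ‖d‖ + ‖e‖ + ‖f‖ := by
    intro a b c d e f
    have h1 := norm_add_le (a + b - c - d - e) f
    have h2 := norm_sub_le (a + b - c - d) e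
    have h3 := norm_sub_le (a + b - c) d
    have h4 := norm_sub_le (a + b) c
    have h5 := norm_add_le a b
    linarith
  have hn1 := hn (R1 - arch t * (Real.pi * Real.exp (-u))) (L2 - arch (-t) * (Real.pi * Real.exp (-u)))
    (R2 - Real.pi * PP u t) L1 (I * H1) (I * H2)
  rw [norm_mul I H1, norm_mul I H2, norm_I, one_mul, one_mul] at hn1
  rw [norm_mul, norm_mul, norm_inv, norm_real, norm_real, Real.norm_of_nonneg Real.pi_pos.le,
    Real.norm_of_nonneg (Real.exp_pos _).le]
  have hpi1 : Real.pi⁻¹ ≤ 1 := inv_le_one_of_one_le₀ (by linarith [Real.pi_gt_three])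
  have hexp1 : Real.exp (-u) ≤ 1 := Real.exp_le_one_iff.2 (by linarith)
  have f1 : Real.pi⁻¹ * ‖(R1 - arch t * (Real.pi * Real.exp (-u))) + (L2 - arch (-t) * (Real.pi * Real.exp (-u)))
        - (R2 - Real.pi * PP u t) - L1 - I * H1 + I * H2‖ ≤ 1 * (26000 * JJ + 26000 * JJ + 2304 * PB * JJ + PB * 16 * Real.pi + 6144 * C + 6144 * C) := by
    gcongr
    linarith
  have f2 : Real.exp (-u) * ‖arch t + arch (-t) - Real.log t‖ ≤ 1 * 10 := by gcongr
  linarith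

end TT

namespace TT
open Complex Metric
open scoped ArithmeticFunction.vonMangoldt

lemma norm_sq_sum (c l : ℕ → ℝ) (N : ℕ) (t : ℝ) :
    ‖∑ n ∈ Finset.range N, (c n : ℂ) * exp (-(t * l n : ℝ) * I)‖ ^ 2
      = ∑ m ∈ Finset.range N, ∑ n ∈ Finset.range N, c m * c n * Real.cos (t * (l m - l n)) := by
  have e : ∑ n ∈ Finset.range N, (c n : ℂ) * exp (-(t * l n : ℝ) * I)
      = ((∑ n ∈ Finset.range N, c n * Real.cos (t * l n) : ℝ) : ℂ)
        + ((-∑ n ∈ Finset.range N, c n * Real.sin (t * l n) : ℝ) : ℂ) * I := by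
    rw [ofReal_neg, ofReal_sum, ofReal_sum, neg_mul, Finset.sum_mul, ← Finset.sum_neg_distrib,
      ← Finset.sum_add_distrib]
    refine Finset.sum_congr rfl fun n _ => ?_
    rw [← ofReal_neg, exp_mul_I, ← ofReal_cos, ← ofReal_sin, Real.cos_neg, Real.sin_neg]
    push_cast
    ring
  rw [e, ← normSq_eq_norm_sq, normSq_add_mul_I, neg_sq, pow_two, pow_two, Finset.sum_mul_sum, Finset.sum_mul_sum,
    ← Finset.sum_add_distrib]
  refine Finset.sum_congr rfl fun m _ => ?_
  rw [← Finset.sum_add_distrib]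
  refine Finset.sum_congr rfl fun n _ => ?_
  rw [mul_sub, Real.cos_sub]
  ring

lemma int_cos_le (a b l : ℝ) (hl : l ≠ 0) : ∫ t in a..b, Real.cos (t * l) ≤ 2 / |l| := by
  rw [intervalIntegral.integral_comp_mul_right _ hl, integral_cos, smul_eq_mul]
  refine (le_abs_self _).trans ?_
  rw [abs_mul, abs_inv, div_eq_inv_mul]
  refine mul_le_mul_of_nonneg_left ?_ (by positivity)
  refine (abs_sub _ _).trans ?_
  linarith [Real.abs_sin_le_one (b * l), Real.abs_sin_le_one (a * l)]

lemma mv_finite (c l h : ℕ → ℝ) (E H a b : ℝ) (N : ℕ) (hc : ∀ n, 0 ≤ c n) (hh : ∀ n, 0 ≤ h n) (h0 : h 0 = 0)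
    (hH : ∀ N, ∑ n ∈ Finset.range N, h n ≤ H)
    (hl : ∀ m n, m < n → 0 < c m → 0 < c n → l m < l n ∧ c m * c n ≤ E ^ 2 * (h m * h (n - m)) * (l n - l m)) :
    ∫ t in a..b, ‖∑ n ∈ Finset.range N, (c n : ℂ) * exp (-(t * l n : ℝ) * I)‖ ^ 2
      ≤ (b - a) * ∑ n ∈ Finset.range N, c n ^ 2 + 4 * E ^ 2 * H ^ 2 := by
  have hsh : ∀ m N, ∑ n ∈ Finset.range N, h (n - m) ≤ H := by
    intro m
    induction m with
    | zero => simpa using hH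
    | succ m ih =>
      intro N
      rcases N with _ | N
      · simpa using hH 0
      · rw [Finset.sum_range_succ']
        simp only [Nat.add_sub_add_right, Nat.zero_sub, h0, add_zero]
        exact ih N
  have H0 : 0 ≤ H := by simpa using hH 0
  simp only [norm_sq_sum]
  have key : ∀ m n, c m * c n * ∫ t in a..b, Real.cos (t * (l m - l n)) ≤
      (if m = n then (b - a) * c m ^ 2 else 0) + 2 * E ^ 2 * (h m * h (n - m) + h n * h (m - n)) := by
    have pos : ∀ m n, 0 ≤ 2 * E ^ 2 * (h m * h (n - m) + h n * h (m - n)) := fun m n =>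
      mul_nonneg (by positivity) (add_nonneg (mul_nonneg (hh _) (hh _)) (mul_nonneg (hh _) (hh _)))
    have aux : ∀ m n, m < n → c m * c n * (2 / |l m - l n|) ≤ 2 * E ^ 2 * (h m * h (n - m) + h n * h (m - n)) := by
      intro m n hmn
      rcases (hc m).eq_or_lt with hm | hm
      · rw [← hm]; simpa using pos m n
      rcases (hc n).eq_or_lt with hn | hn
      · rw [← hn]; simpa using pos m n
      obtain ⟨h1, h2⟩ := hl m n hmn hm hn
      rw [abs_sub_comm, abs_of_pos (sub_pos.2 h1), mul_div_assoc', div_le_iff₀ (sub_pos.2 h1),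
        Nat.sub_eq_zero_of_le hmn.le, h0]
      nlinarith
    intro m n
    rcases lt_trichotomy m n with hmn | rfl | hmn
    · obtain hne := hmn.ne
      rw [if_neg hne, zero_add]
      rcases eq_or_ne (c m * c n) 0 with hz | hz
      · rw [hz, zero_mul]; exact pos m n
      · have hm : 0 < c m := lt_of_le_of_ne (hc m) (fun h => hz (by rw [← h, zero_mul]))
        have hn : 0 < c n := lt_of_le_of_ne (hc n) (fun h => hz (by rw [← h, mul_zero]))
        refine (mul_le_mul_of_nonneg_left (int_cos_le a b _ ?_) (mul_pos hm hn).le).trans (aux m n hmn)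
        exact (sub_neg.2 (hl m n hmn hm hn).1).ne
    · simp [h0]; rw [mul_comm]; nlinarith
    · rw [if_neg hmn.ne', zero_add]
      rcases eq_or_ne (c m * c n) 0 with hz | hz
      · rw [hz, zero_mul]; exact pos m n
      · have hm : 0 < c m := lt_of_le_of_ne (hc m) (fun h => hz (by rw [← h, zero_mul]))
        have hn : 0 < c n := lt_of_le_of_ne (hc n) (fun h => hz (by rw [← h, mul_zero]))
        refine (mul_le_mul_of_nonneg_left (int_cos_le a b _ ?_) (mul_pos hm hn).le).trans ?_
        · exact (sub_pos.2 (hl n m hmn hn hm).1).ne'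
        · rw [abs_sub_comm, mul_comm (c m), add_comm]; exact aux n m hmn
  rw [intervalIntegral.integral_finsetSum
    (fun m _ => (by fun_prop : Continuous _).intervalIntegrable _ _)]
  calc _ ≤ ∑ m ∈ Finset.range N, ∑ n ∈ Finset.range N, ((if m = n then (b - a) * c m ^ 2 else 0) + 2 * E ^ 2 * (h m * h (n - m) + h n * h (m - n))) := by
        refine Finset.sum_le_sum fun m _ => ?_
        rw [intervalIntegral.integral_finsetSum
          (fun m _ => (by fun_prop : Continuous _).intervalIntegrable _ _)]
        refine Finset.sum_le_sum fun n _ => ?_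
        rw [intervalIntegral.integral_const_mul]
        exact key m n
    _ = (b - a) * ∑ n ∈ Finset.range N, c n ^ 2 + 2 * E ^ 2 * (∑ m ∈ Finset.range N, h m * ∑ n ∈ Finset.range N, h (n - m)
          + ∑ n ∈ Finset.range N, h n * ∑ m ∈ Finset.range N, h (m - n)) := by
        simp only [Finset.sum_add_distrib, mul_add, Finset.mul_sum, Finset.sum_ite_eq, ]
        congr 1
        · refine Finset.sum_congr rfl fun m hm => by rw [if_pos hm]
        · congr 1
          rw [Finset.sum_comm]
    _ ≤ _ := by
        have : ∑ m ∈ Finset.range N, h m * ∑ n ∈ Finset.range N, h (n - m) ≤ H * H := by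
          calc _ ≤ ∑ m ∈ Finset.range N, h m * H := Finset.sum_le_sum fun m _ => mul_le_mul_of_nonneg_left (hsh m N) (hh m)
            _ = (∑ m ∈ Finset.range N, h m) * H := by rw [Finset.sum_mul]
            _ ≤ H * H := mul_le_mul_of_nonneg_right (hH N) H0
        nlinarith [sq_nonneg E]

lemma cc_le' (e : ℝ) (he : 0 < e) (he' : e ≤ 1 / 2) (u : ℝ) (n : ℕ) :
    cc u n ≤ (2 / e * Real.exp ((1 / 2 + e) * u)) * (n : ℝ) ^ (-1 - e / 2) := by
  rcases eq_or_ne n 0 with rfl | hn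
  · simp [cc]; positivity
  have hn0 : (0 : ℝ) < n := by positivity
  have h1 : Real.exp (-|u - Real.log n|) ≤ Real.exp ((1 / 2 + e) * u) * (n : ℝ) ^ (-(1 / 2 + e) : ℝ) := by
    rw [Real.rpow_def_of_pos hn0, ← Real.exp_add, Real.exp_le_exp]
    rcases le_total 0 (u - Real.log n) with h | h
    · rw [abs_of_nonneg h]; nlinarith
    · rw [abs_of_nonpos h]; nlinarith
  have h2 : Λ n ≤ (n : ℝ) ^ (e / 2) / (e / 2) :=
    ArithmeticFunction.vonMangoldt_le_log.trans (Real.log_le_rpow_div hn0.le (by positivity))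
  have h3 : (n : ℝ) ^ (-1 - e / 2) = (n : ℝ) ^ (e / 2) * (n : ℝ) ^ (-(1 / 2) : ℝ) * (n : ℝ) ^ (-(1 / 2 + e) : ℝ) := by
    rw [← Real.rpow_add hn0, ← Real.rpow_add hn0]; ring_nf
  rw [cc]
  calc _ ≤ (n : ℝ) ^ (e / 2) / (e / 2) * (n : ℝ) ^ (-(1 / 2) : ℝ) * (Real.exp ((1 / 2 + e) * u) * (n : ℝ) ^ (-(1 / 2 + e) : ℝ)) := by
        gcongr
    _ = _ := by rw [h3]; field_simp

lemma cc_sq_le (u M : ℝ) (h : u ≤ M) (n : ℕ) : cc u n ^ 2 ≤ Real.exp (3 / 4 * M) ^ 2 * PB * pc n := by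
  have h1 : cc u n ≤ Real.exp (3 / 4 * M) * pc n := (cc_le u n).trans
    (mul_le_mul_of_nonneg_right (Real.exp_le_exp.2 (by linarith)) (pc_nonneg n))
  have h2 : pc n ≤ PB := pc_summable.le_tsum n (fun i _ => pc_nonneg i)
  calc _ ≤ (Real.exp (3 / 4 * M) * pc n) ^ 2 := pow_le_pow_left₀ (cc_nonneg u n) h1 2
    _ = Real.exp (3 / 4 * M) ^ 2 * pc n * pc n := by ring
    _ ≤ _ := by
      have := pc_nonneg n
      gcongr

lemma cc_sq_summable (u : ℝ) : Summable (fun n => cc u n ^ 2) :=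
  Summable.of_nonneg_of_le (fun n => sq_nonneg _) (cc_sq_le u u le_rfl) (pc_summable.mul_left _)

lemma PP_cont (u : ℝ) : Continuous (PP u) := by
  unfold PP
  apply continuous_tsum (u := fun n => Real.exp (3 / 4 * u) * pc n) _ (pc_summable.mul_left _)
  · intro n t
    rw [norm_mul, norm_exp_I, mul_one, norm_real, Real.norm_of_nonneg (cc_nonneg _ _)]
    exact cc_le u n
  · intro n; fun_prop

noncomputable def DD (u : ℝ) : ℝ := ∑' n, cc u n ^ 2

lemma mean_value (e : ℝ) (he : 0 < e) (he' : e ≤ 1 / 2) : ∃ C : ℝ, 0 ≤ C ∧ ∀ u a b : ℝ, a ≤ b →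
    ∫ t in a..b, ‖PP u t‖ ^ 2 ≤ (b - a) * DD u + C * Real.exp ((1 + 2 * e) * u) := by
  set h : ℕ → ℝ := fun n => (n : ℝ) ^ (-1 - e / 2) with hh
  have hs : Summable h := by
    refine (Real.summable_nat_rpow (p := -1 - e / 2)).2 (by linarith)
  have hnn : ∀ n, 0 ≤ h n := fun n => by positivity
  set H := ∑' n, h n
  refine ⟨4 * (2 / e) ^ 2 * H ^ 2, by positivity, ?_⟩
  intro u a b hab
  have hE : 4 * (2 / e * Real.exp ((1 / 2 + e) * u)) ^ 2 * H ^ 2 = 4 * (2 / e) ^ 2 * H ^ 2 * Real.exp ((1 + 2 * e) * u) := by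
    rw [mul_pow, ← Real.exp_nat_mul]; push_cast
    rw [show 2 * ((1 / 2 + e) * u) = (1 + 2 * e) * u by ring]; ring
  have hfin : ∀ N : ℕ, ∫ t in a..b, ‖∑ n ∈ Finset.range N, (cc u n : ℂ) * exp (-(t * Real.log n : ℝ) * I)‖ ^ 2
      ≤ (b - a) * DD u + 4 * (2 / e) ^ 2 * H ^ 2 * Real.exp ((1 + 2 * e) * u) := by
    intro N
    refine (mv_finite (cc u) (fun n => Real.log n) h (2 / e * Real.exp ((1 / 2 + e) * u)) H a b N (cc_nonneg u) hnn ?_ ?_ ?_).trans ?_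
    · simp only [hh, Nat.cast_zero]; exact Real.zero_rpow (by linarith)
    · intro N; exact hs.sum_le_tsum _ (fun i _ => hnn i)
    · intro m n hmn hm hn
      have hm0 : 0 < m := by
        rcases Nat.eq_zero_or_pos m with rfl | h
        · simp [cc] at hm
        · exact h
      have hmR : (0 : ℝ) < m := by exact_mod_cast hm0
      have hmnR : (m : ℝ) < n := by exact_mod_cast hmn
      have hnR : (0 : ℝ) < n := hmR.trans hmnR
      refine ⟨Real.log_lt_log hmR hmnR, ?_⟩
      have hlog : ((n : ℝ) - m) / n ≤ Real.log n - Real.log m := by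
        have := Real.one_sub_inv_le_log_of_pos (x := (n : ℝ) / m) (by positivity)
        rw [Real.log_div hnR.ne' hmR.ne', inv_div] at this
        refine le_trans (le_of_eq ?_) this
        field_simp
      have h3 : h n ≤ h (n - m) * (((n : ℝ) - m) / n) := by
        have hd : (0 : ℝ) < (n : ℝ) - m := sub_pos.2 hmnR
        simp only [hh]
        rw [Nat.cast_sub hmn.le]
        have e1 : ∀ x : ℝ, 0 < x → x ^ (-1 - e / 2) = x⁻¹ * x ^ (-(e / 2)) := fun x hx => by
          rw [← Real.rpow_neg_one, ← Real.rpow_add hx]; ring_nf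
        rw [e1 _ hnR, e1 _ hd]
        have : (n : ℝ) ^ (-(e / 2)) ≤ ((n : ℝ) - m) ^ (-(e / 2)) :=
          Real.rpow_le_rpow_of_nonpos hd (by linarith) (by linarith)
        calc _ ≤ (n : ℝ)⁻¹ * ((n : ℝ) - m) ^ (-(e / 2)) := by gcongr
          _ = _ := by field_simp
      have h4 : h n ≤ h (n - m) * (Real.log n - Real.log m) :=
        h3.trans (mul_le_mul_of_nonneg_left hlog (hnn _))
      set E := (2 / e * Real.exp ((1 / 2 + e) * u))
      have hE0 : 0 ≤ E := by positivity
      calc cc u m * cc u n ≤ (E * h m) * (E * h n) :=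
            mul_le_mul (cc_le' e he he' u m) (cc_le' e he he' u n) (cc_nonneg _ _) (mul_nonneg hE0 (hnn _))
        _ ≤ (E * h m) * (E * (h (n - m) * (Real.log n - Real.log m))) :=
            mul_le_mul_of_nonneg_left (mul_le_mul_of_nonneg_left h4 hE0) (mul_nonneg hE0 (hnn _))
        _ = _ := by ring
    · rw [hE]
      refine add_le_add_left (mul_le_mul_of_nonneg_left ?_ (by linarith)) _
      exact (cc_sq_summable u).sum_le_tsum _ (fun i _ => sq_nonneg _)
  refine le_of_tendsto' (f := fun N : ℕ => ∫ t in a..b, ‖∑ n ∈ Finset.range N, (cc u n : ℂ) * exp (-(t * Real.log n : ℝ) * I)‖ ^ 2) (x := atTop) ?_ hfin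
  refine intervalIntegral.tendsto_integral_filter_of_dominated_convergence (fun _ => (Real.exp (3 / 4 * u) * PB) ^ 2) ?_ ?_ ?_ ?_
  · exact Eventually.of_forall fun N => (by fun_prop : Continuous _).aestronglyMeasurable
  · refine Eventually.of_forall fun N => Eventually.of_forall fun t _ => ?_
    rw [Real.norm_of_nonneg (by positivity)]
    refine pow_le_pow_left₀ (norm_nonneg _) ?_ 2
    refine (norm_sum_le _ _).trans ?_
    rw [PB, ← tsum_mul_left]
    refine le_trans (Finset.sum_le_sum fun n _ => ?_) ((pc_summable.mul_left (Real.exp (3 / 4 * u))).sum_le_tsum _ fun i _ => mul_nonneg (Real.exp_pos _).le (pc_nonneg i))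
    rw [norm_mul, norm_exp_I, mul_one, norm_real, Real.norm_of_nonneg (cc_nonneg _ _)]
    exact cc_le u n
  · exact intervalIntegrable_const
  · refine Eventually.of_forall fun t _ => ?_
    exact ((PP_summable u t).hasSum.tendsto_sum_nat.norm).pow 2

end TT

namespace TT
open Complex Metric
open scoped ArithmeticFunction.vonMangoldt

noncomputable def lw (n : ℕ) : ℝ := Λ n / n

lemma lw_nonneg (n : ℕ) : 0 ≤ lw n := div_nonneg ArithmeticFunction.vonMangoldt_nonneg (Nat.cast_nonneg n)

lemma mertens0 (N : ℕ) (hN : N ≠ 0) :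
    Real.log N - 1 ≤ ∑ n ∈ Finset.Ioc 0 N, lw n ∧ ∑ n ∈ Finset.Ioc 0 N, lw n ≤ Real.log N + (Real.log 4 + 4) := by
  have hN0 : (0 : ℝ) < N := by positivity
  have h1 : ∑ n ∈ Finset.Ioc 0 N, Real.log n = ∑ n ∈ Finset.Ioc 0 N, Λ n * ((N / n : ℕ) : ℝ) := by
    rw [← ArithmeticFunction.sum_Ioc_mul_zeta_eq_sum, ArithmeticFunction.vonMangoldt_mul_zeta]
    rfl
  have h2 : ∑ n ∈ Finset.Ioc 0 N, Real.log n = Real.log (N.factorial) := by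
    clear h1 hN hN0
    induction N with
    | zero => simp
    | succ k ih =>
      rw [← Finset.insert_Ioc_right_eq_Ioc_add_one (Nat.zero_le k), Finset.sum_insert (by simp), ih, Nat.factorial_succ,
        Nat.cast_mul, Real.log_mul (by positivity) (by positivity)]
  have h3 := Stirling.le_log_factorial_stirling hN
  have hl : 0 ≤ Real.log N := Real.log_natCast_nonneg N
  have hpi : 0 ≤ Real.log (2 * Real.pi) := Real.log_nonneg (by linarith [Real.two_le_pi])
  have h4 : Real.log (N.factorial) ≤ N * Real.log N := by
    rw [← Real.log_pow]
    refine Real.log_le_log (by positivity) ?_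
    exact_mod_cast Nat.factorial_le_pow N
  have hpsi : ∑ n ∈ Finset.Ioc 0 N, Λ n ≤ (Real.log 4 + 4) * N := by
    have := Chebyshev.psi_le_const_mul_self hN0.le
    rwa [Chebyshev.psi, Nat.floor_natCast] at this
  have e : ∀ n ∈ Finset.Ioc 0 N, Λ n * ((N / n : ℕ) : ℝ) ≤ N * lw n ∧ N * lw n ≤ Λ n * ((N / n : ℕ) : ℝ) + Λ n := by
    intro n hn
    have hn0 : (0 : ℝ) < n := by exact_mod_cast (Finset.mem_Ioc.1 hn).1
    have hL : 0 ≤ Λ n := ArithmeticFunction.vonMangoldt_nonneg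
    have e1 : (N : ℝ) * lw n = Λ n * (N / n : ℝ) := by rw [lw]; ring
    have e2 : ((N / n : ℕ) : ℝ) ≤ N / n := Nat.cast_div_le
    have e3 : (N / n : ℝ) ≤ ((N / n : ℕ) : ℝ) + 1 := by
      rw [← Nat.floor_div_eq_div (K := ℝ)]; exact (Nat.lt_floor_add_one _).le
    rw [e1]
    constructor <;> nlinarith
  have e1 := Finset.sum_le_sum fun n hn => (e n hn).1
  have e2 := Finset.sum_le_sum fun n hn => (e n hn).2
  rw [Finset.sum_add_distrib, ← Finset.mul_sum, ← h1, h2] at e2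
  rw [← Finset.mul_sum, ← h1, h2] at e1
  constructor
  · refine le_of_mul_le_mul_left ?_ hN0
    linarith
  · refine le_of_mul_le_mul_left ?_ hN0
    linarith

noncomputable def BN (N : ℕ) (v : ℝ) : ℝ := ∑ n ∈ Finset.range N, if Real.log n ≤ v then lw n else 0

lemma mertens : ∃ K : ℝ, 2 ≤ K ∧ ∀ (N : ℕ) (v : ℝ), 0 ≤ v → BN N v ≤ v + K ∧ (Real.exp v < N → v - K ≤ BN N v) := by
  refine ⟨Real.log 4 + 4, by have := Real.log_nonneg (x := 4) (by norm_num); linarith, ?_⟩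
  intro N v hv
  set F := ⌊Real.exp v⌋₊ with hF
  have hF1 : 1 ≤ F := Nat.le_floor (by simpa using hv)
  obtain ⟨m1, m2⟩ := mertens0 F (by omega)
  have hFle : (F : ℝ) ≤ Real.exp v := Nat.floor_le (Real.exp_pos _).le
  have hFlog : Real.log F ≤ v := by
    rw [Real.log_le_iff_le_exp (by positivity)]; exact hFle
  have hFlog2 : v ≤ Real.log 2 + Real.log F := by
    rw [← Real.log_mul (by norm_num) (by positivity), Real.le_log_iff_exp_le (by positivity)]
    have := Nat.lt_floor_add_one (Real.exp v)
    have h1 : (1 : ℝ) ≤ F := by exact_mod_cast hF1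
    rw [← hF] at this
    linarith
  have hl2 : Real.log 2 ≤ Real.log 4 := Real.log_le_log (by norm_num) (by norm_num)
  have hsub : ∀ n : ℕ, 0 < n → Real.log n ≤ v → n ∈ Finset.Ioc 0 F := by
    intro n hn h
    rw [Finset.mem_Ioc]
    refine ⟨hn, Nat.le_floor ?_⟩
    rwa [← Real.log_le_iff_le_exp (by positivity)]
  constructor
  · refine le_trans ?_ (m2.trans (by linarith))
    rw [BN, ← Finset.sum_filter, ← Finset.sum_filter_ne_zero]
    refine Finset.sum_le_sum_of_subset_of_nonneg ?_ (fun n _ _ => lw_nonneg n)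
    intro n hn
    simp only [Finset.mem_filter] at hn
    refine hsub n (Nat.pos_of_ne_zero fun h => hn.2 (by simp [h, lw])) hn.1.2
  · intro hN
    refine le_trans (by linarith) (m1.trans ?_)
    rw [BN, ← Finset.sum_filter]
    refine Finset.sum_le_sum_of_subset_of_nonneg ?_ (fun n _ _ => lw_nonneg n)
    intro n hn
    rw [Finset.mem_Ioc] at hn
    have h0 : (0 : ℝ) < n := by exact_mod_cast hn.1
    have h1 : (n : ℝ) ≤ Real.exp v := le_trans (by exact_mod_cast hn.2) hFle
    rw [Finset.mem_filter, Finset.mem_range]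
    refine ⟨by exact_mod_cast h1.trans_lt hN, ?_⟩
    rwa [Real.log_le_iff_le_exp h0]

lemma W_bound (M x : ℝ) (hM : 0 ≤ M) (hx : 0 ≤ x) :
    ∫ u in (0 : ℝ)..M, (M - u) * Real.exp (-(2 * |u - x|)) ≤
      (if x ≤ M then M - x else 0) + 1 / 2 * min 1 (Real.exp (2 * (M - x))) := by
  have d1 : ∀ u, HasDerivAt (fun u => Real.exp (2 * (u - x)) * ((M - u) / 2 + 1 / 4)) ((M - u) * Real.exp (2 * (u - x))) u := by
    intro u
    have a := ((((hasDerivAt_id u).sub_const x).const_mul 2).exp).mul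
      (((((hasDerivAt_id u).const_sub M).div_const 2)).add_const (1 / 4))
    refine a.congr_deriv ?_
    simp only [id]; ring
  have d2 : ∀ u, HasDerivAt (fun u => Real.exp (2 * (x - u)) * (-((M - u) / 2) + 1 / 4)) ((M - u) * Real.exp (2 * (x - u))) u := by
    intro u
    have a := ((((hasDerivAt_id u).const_sub x).const_mul 2).exp).mul
      ((((((hasDerivAt_id u).const_sub M).div_const 2)).fun_neg).add_const (1 / 4))
    refine a.congr_deriv ?_
    simp only [id]; ring
  have i1 : ∀ a b : ℝ, b ≤ x → a ≤ b → ∫ u in a..b, (M - u) * Real.exp (-(2 * |u - x|)) =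
      Real.exp (2 * (b - x)) * ((M - b) / 2 + 1 / 4) - Real.exp (2 * (a - x)) * ((M - a) / 2 + 1 / 4) := by
    intro a b hb hab
    rw [← intervalIntegral.integral_eq_sub_of_hasDerivAt (fun u _ => d1 u)
      ((by fun_prop : Continuous _).intervalIntegrable _ _)]
    refine intervalIntegral.integral_congr fun u hu => ?_
    rw [uIcc_of_le hab] at hu
    beta_reduce
    rw [abs_of_nonpos (by linarith [hu.2])]; ring_nf
  have i2 : ∀ a b : ℝ, x ≤ a → a ≤ b → ∫ u in a..b, (M - u) * Real.exp (-(2 * |u - x|)) =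
      Real.exp (2 * (x - b)) * (-((M - b) / 2) + 1 / 4) - Real.exp (2 * (x - a)) * (-((M - a) / 2) + 1 / 4) := by
    intro a b hb hab
    rw [← intervalIntegral.integral_eq_sub_of_hasDerivAt (fun u _ => d2 u)
      ((by fun_prop : Continuous _).intervalIntegrable _ _)]
    refine intervalIntegral.integral_congr fun u hu => ?_
    rw [uIcc_of_le hab] at hu
    beta_reduce
    rw [abs_of_nonneg (by linarith [hu.1])]; ring_nf
  have hc : Continuous (fun u => (M - u) * Real.exp (-(2 * |u - x|))) := by fun_prop
  have p := Real.exp_pos (2 * (0 - x))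
  have p1 := mul_nonneg p.le (by linarith : 0 ≤ (M - 0) / 2 + 1 / 4)
  split_ifs with h
  · rw [← intervalIntegral.integral_add_adjacent_intervals (b := x) (hc.intervalIntegrable _ _) (hc.intervalIntegrable _ _),
      i1 0 x le_rfl hx, i2 x M le_rfl h, min_eq_left (by rw [Real.one_le_exp_iff]; linarith)]
    have p2 : Real.exp (2 * (x - M)) ≤ 1 := by rw [Real.exp_le_one_iff]; linarith
    simp only [sub_self, mul_zero, Real.exp_zero, zero_div, neg_zero, zero_add]
    linarith
  · push Not at h
    rw [i1 0 M h.le hM, min_eq_right (by rw [Real.exp_le_one_iff]; linarith), sub_self]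
    have p2 := Real.exp_pos (2 * (M - x))
    linarith

lemma diag_main (K : ℝ) (hK : 2 ≤ K)
    (hm : ∀ (N : ℕ) (v : ℝ), 0 ≤ v → BN N v ≤ v + K ∧ (Real.exp v < N → v - K ≤ BN N v))
    (N : ℕ) (M : ℝ) (hM : 0 ≤ M) (hN : Real.exp M < N) :
    ∑ n ∈ Finset.range N, lw n * (if Real.log n ≤ M then Real.log n * (M - Real.log n) else 0) ≤ M ^ 3 / 6 + K * M ^ 2 := by
  have ind : ∀ x w : ℝ, IntervalIntegrable (fun v => (2 * v - M) * (if x ≤ v then w else 0)) volume 0 M := by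
    intro x w
    have := ((by fun_prop : Continuous fun v : ℝ => (2 * v - M) * w).integrableOn_Icc (a := 0) (b := M) (μ := volume)).indicator (measurableSet_Ici (a := x))
    rw [intervalIntegrable_iff_integrableOn_Icc_of_le hM]
    refine this.congr ?_
    refine Eventually.of_forall fun v => ?_
    by_cases h : x ≤ v <;> simp [indicator, h]
  have one : ∀ x w : ℝ, 0 ≤ x → w * (if x ≤ M then x * (M - x) else 0) = ∫ v in (0 : ℝ)..M, (2 * v - M) * (if x ≤ v then w else 0) := by
    intro x w hx
    by_cases h : x ≤ M
    · rw [if_pos h, ← intervalIntegral.integral_add_adjacent_intervals (b := x)]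
      · have a1 : ∫ v in (0 : ℝ)..x, (2 * v - M) * (if x ≤ v then w else 0) = 0 := by
          rw [intervalIntegral.integral_of_le hx, integral_Ioc_eq_integral_Ioo]
          refine setIntegral_eq_zero_of_forall_eq_zero fun v hv => ?_
          rw [if_neg (by have := hv.2; linarith), mul_zero]
        have a2 : ∫ v in x..M, (2 * v - M) * (if x ≤ v then w else 0) = ∫ v in x..M, (2 * v - M) * w := by
          refine intervalIntegral.integral_congr fun v hv => ?_
          rw [uIcc_of_le h] at hv
          beta_reduce
          rw [if_pos hv.1]
        rw [a1, a2, intervalIntegral.integral_mul_const, intervalIntegral.integral_sub ((by fun_prop : Continuous _).intervalIntegrable _ _) intervalIntegrable_const, intervalIntegral.integral_const_mul,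
          integral_id, intervalIntegral.integral_const, smul_eq_mul]
        ring
      · exact (ind x w).mono_set (by rw [uIcc_of_le hx, uIcc_of_le hM]; exact Icc_subset_Icc_right h)
      · exact (ind x w).mono_set (by rw [uIcc_of_le h, uIcc_of_le hM]; exact Icc_subset_Icc_left hx)
    · rw [if_neg h, mul_zero]
      symm
      rw [intervalIntegral.integral_of_le hM]
      refine setIntegral_eq_zero_of_forall_eq_zero fun v hv => ?_
      rw [if_neg (by have := hv.2; linarith), mul_zero]
  calc _ = ∑ n ∈ Finset.range N, ∫ v in (0 : ℝ)..M, (2 * v - M) * (if Real.log n ≤ v then lw n else 0) :=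
        Finset.sum_congr rfl fun n _ => one _ _ (Real.log_natCast_nonneg n)
    _ = ∫ v in (0 : ℝ)..M, ∑ n ∈ Finset.range N, (2 * v - M) * (if Real.log n ≤ v then lw n else 0) := by
        rw [intervalIntegral.integral_finsetSum fun n _ => ind _ _]
    _ ≤ ∫ v in (0 : ℝ)..M, ((2 * v - M) * v + K * M) := by
        refine intervalIntegral.integral_mono_on hM (ii_sum _ _ _ _ (fun n _ => ind _ _)) ((by fun_prop : Continuous _).intervalIntegrable _ _) fun v hv => ?_
        rw [← Finset.mul_sum]
        change (2 * v - M) * BN N v ≤ _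
        obtain ⟨b1, b2⟩ := hm N v hv.1
        have b3 := b2 ((Real.exp_le_exp.2 hv.2).trans_lt hN)
        have b4 : (2 * v - M) * (BN N v - v) ≤ |2 * v - M| * |BN N v - v| := by rw [← abs_mul]; exact le_abs_self _
        have b5 : |2 * v - M| ≤ M := abs_le.2 ⟨by linarith [hv.1], by linarith [hv.2]⟩
        have b6 : |BN N v - v| ≤ K := abs_le.2 ⟨by linarith, by linarith⟩
        have b7 := mul_le_mul b5 b6 (abs_nonneg _) hM
        linarith
    _ = _ := by
        have e : (fun v : ℝ => (2 * v - M) * v + K * M) = fun v => (2 * v ^ 2 - M * v) + K * M := by ext; ring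
        rw [e, intervalIntegral.integral_add ((by fun_prop : Continuous _).intervalIntegrable _ _) (by simp),
          intervalIntegral.integral_sub ((by fun_prop : Continuous _).intervalIntegrable _ _) ((by fun_prop : Continuous _).intervalIntegrable _ _),
          intervalIntegral.integral_const_mul, intervalIntegral.integral_const_mul, integral_id, integral_pow,
          intervalIntegral.integral_const, smul_eq_mul]
        push_cast
        ring

lemma diag_tail (K : ℝ) (hK : 2 ≤ K)
    (hm : ∀ (N : ℕ) (v : ℝ), 0 ≤ v → BN N v ≤ v + K ∧ (Real.exp v < N → v - K ≤ BN N v))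
    (N : ℕ) (M : ℝ) (hM : 0 ≤ M) :
    ∑ n ∈ Finset.range N, lw n * min 1 (Real.exp (M - Real.log n)) ≤ 2 * (M + K) := by
  have hexp : IntegrableOn (fun v => Real.exp (M - v)) (Ioi M) := by
    have := (integrableOn_exp_mul_Ioi (a := -1) (by norm_num) M).const_mul (Real.exp M)
    refine this.congr (Eventually.of_forall fun v => ?_)
    simp only; rw [← Real.exp_add]; ring_nf
  have hval : ∀ y, ∫ v in Ioi y, Real.exp (M - v) = Real.exp (M - y) := by
    intro y
    have : ∀ v, Real.exp (M - v) = Real.exp M * Real.exp (-v) := fun v => by rw [← Real.exp_add]; ring_nf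
    simp only [this]
    rw [integral_const_mul, integral_exp_neg_Ioi]
  have ei : ∀ x w : ℝ, (fun v => Real.exp (M - v) * (if x ≤ v then w else 0)) = (Ici x).indicator (fun v => Real.exp (M - v) * w) := by
    intro x w
    ext v
    by_cases h : x ≤ v <;> simp [indicator, h]
  have ind : ∀ x w : ℝ, IntegrableOn (fun v => Real.exp (M - v) * (if x ≤ v then w else 0)) (Ioi M) := by
    intro x w
    rw [ei]
    exact (hexp.mul_const w).indicator measurableSet_Ici
  have one : ∀ x w : ℝ, w * min 1 (Real.exp (M - x)) = ∫ v in Ioi M, Real.exp (M - v) * (if x ≤ v then w else 0) := by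
    intro x w
    rw [ei, setIntegral_indicator measurableSet_Ici]
    rcases le_or_gt x M with h | h
    · rw [(inter_eq_left.2 fun v hv => h.trans (le_of_lt hv) : Ioi M ∩ Ici x = Ioi M), integral_mul_const, hval, sub_self, Real.exp_zero,
        min_eq_left (by rw [Real.one_le_exp_iff]; linarith)]; ring
    · rw [(inter_eq_right.2 fun v (hv : x ≤ v) => h.trans_le hv : Ioi M ∩ Ici x = Ici x), integral_mul_const, integral_Ici_eq_integral_Ioi, hval,
        min_eq_right (by rw [Real.exp_le_one_iff]; linarith)]; ring
  have hexp2 : IntegrableOn (fun v => (M + K) * Real.exp ((M - v) / 2)) (Ioi M) := by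
    have := (integrableOn_exp_mul_Ioi (a := -(1 / 2)) (by norm_num) M).const_mul ((M + K) * Real.exp (M / 2))
    refine this.congr (Eventually.of_forall fun v => ?_)
    simp only; rw [mul_assoc, ← Real.exp_add]; ring_nf
  calc _ = ∑ n ∈ Finset.range N, ∫ v in Ioi M, Real.exp (M - v) * (if Real.log n ≤ v then lw n else 0) :=
        Finset.sum_congr rfl fun n _ => one _ _
    _ = ∫ v in Ioi M, ∑ n ∈ Finset.range N, Real.exp (M - v) * (if Real.log n ≤ v then lw n else 0) := by
        rw [integral_finsetSum _ fun n _ => ind _ _]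
    _ ≤ ∫ v in Ioi M, (M + K) * Real.exp ((M - v) / 2) := by
        refine setIntegral_mono_on (integrable_finsetSum _ fun n _ => ind _ _) hexp2 measurableSet_Ioi fun v hv => ?_
        rw [← Finset.mul_sum]
        change _ * BN N v ≤ _
        have hv' : M < v := hv
        have h1 := (hm N v (hM.trans hv'.le)).1
        have h2 : Real.exp (M - v) = Real.exp ((M - v) / 2) * Real.exp ((M - v) / 2) := by rw [← Real.exp_add]; ring_nf
        have h3 : v + K ≤ (M + K) * Real.exp ((v - M) / 2) := by
          have := Real.add_one_le_exp ((v - M) / 2)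
          nlinarith
        have h4 : Real.exp ((M - v) / 2) * Real.exp ((v - M) / 2) = 1 := by rw [← Real.exp_add]; ring_nf; simp
        have h5 := Real.exp_pos ((M - v) / 2)
        calc _ ≤ Real.exp (M - v) * ((M + K) * Real.exp ((v - M) / 2)) := mul_le_mul_of_nonneg_left (h1.trans h3) (Real.exp_pos _).le
          _ = (M + K) * Real.exp ((M - v) / 2) * (Real.exp ((M - v) / 2) * Real.exp ((v - M) / 2)) := by rw [h2]; ring
          _ = _ := by rw [h4]; ring
    _ = _ := by
        have : ∀ v, Real.exp ((M - v) / 2) = Real.exp (M / 2) * Real.exp (-(1 / 2) * v) := fun v => by rw [← Real.exp_add]; ring_nf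
        simp only [this]
        rw [integral_const_mul, integral_const_mul, integral_exp_mul_Ioi (by norm_num)]
        have : Real.exp (M / 2) * Real.exp (-(1 / 2) * M) = 1 := by rw [← Real.exp_add]; ring_nf; simp
        linear_combination 2 * (M + K) * this

lemma DD_cont (M : ℝ) : ContinuousOn DD (Icc 0 M) := by
  unfold DD
  refine continuousOn_tsum (u := fun n => Real.exp (3 / 4 * M) ^ 2 * PB * pc n) ?_ (pc_summable.mul_left _) ?_
  · intro n; unfold cc; fun_prop
  · intro n u hu
    rw [Real.norm_of_nonneg (sq_nonneg _)]
    exact cc_sq_le u M hu.2 n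

lemma cc_sq (u : ℝ) (n : ℕ) : cc u n ^ 2 = lw n * Λ n * Real.exp (-(2 * |u - Real.log n|)) := by
  rcases eq_or_ne n 0 with rfl | hn
  · simp [cc, lw]
  have hn0 : (0 : ℝ) < n := by positivity
  rw [cc, lw, mul_pow, mul_pow, ← Real.exp_nat_mul, ← Real.rpow_natCast, ← Real.rpow_natCast ((n : ℝ) ^ _), ← Real.rpow_mul hn0.le]
  norm_num
  rw [Real.rpow_neg_one]; ring_nf

lemma diagonal : ∃ K : ℝ, 0 ≤ K ∧ ∀ M : ℝ, 1 ≤ M → ∫ u in (0 : ℝ)..M, (M - u) * DD u ≤ M ^ 3 / 6 + K * M ^ 2 := by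
  obtain ⟨K, hK, hm⟩ := mertens
  refine ⟨K + (1 + K), by linarith, ?_⟩
  intro M hM
  have hM0 : 0 ≤ M := by linarith
  have hs : HasSum (fun n => ∫ u in (0 : ℝ)..M, (M - u) * cc u n ^ 2) (∫ u in (0 : ℝ)..M, (M - u) * DD u) := by
    refine intervalIntegral.hasSum_integral_of_dominated_convergence (fun n u => M * (Real.exp (3 / 4 * M) ^ 2 * PB * pc n)) ?_ ?_ ?_ ?_ ?_
    · intro n
      refine (by unfold cc; fun_prop : Continuous _).aestronglyMeasurable
    · intro n
      refine Eventually.of_forall fun u hu => ?_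
      rw [uIoc_of_le hM0] at hu
      rw [norm_mul, Real.norm_of_nonneg (sq_nonneg _), Real.norm_of_nonneg (by linarith [hu.2])]
      exact mul_le_mul (by linarith [hu.1]) (cc_sq_le u M hu.2 n) (sq_nonneg _) hM0
    · exact Eventually.of_forall fun u _ => (pc_summable.mul_left _).mul_left _
    · exact intervalIntegrable_const
    · exact Eventually.of_forall fun u _ => (cc_sq_summable u).hasSum.mul_left _
  have term : ∀ n : ℕ, ∫ u in (0 : ℝ)..M, (M - u) * cc u n ^ 2 ≤
      lw n * (if Real.log n ≤ M then Real.log n * (M - Real.log n) else 0) + M / 2 * (lw n * min 1 (Real.exp (M - Real.log n))) := by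
    intro n
    have hx := Real.log_natCast_nonneg n
    set x := Real.log n with hxd
    have e : ∀ u, (M - u) * cc u n ^ 2 = lw n * Λ n * ((M - u) * Real.exp (-(2 * |u - x|))) := fun u => by rw [cc_sq]; ring
    simp only [e]
    rw [intervalIntegral.integral_const_mul]
    have hL : Λ n ≤ x := ArithmeticFunction.vonMangoldt_le_log
    have hw := lw_nonneg n
    have hW := W_bound M x hM0 hx
    have hW0 : 0 ≤ (if x ≤ M then M - x else 0) + 1 / 2 * min 1 (Real.exp (2 * (M - x))) := by
      have : 0 ≤ min 1 (Real.exp (2 * (M - x))) := le_min zero_le_one (Real.exp_pos _).le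
      split_ifs <;> linarith
    have h5 : x * min 1 (Real.exp (2 * (M - x))) ≤ M * min 1 (Real.exp (M - x)) := by
      rcases le_or_gt x M with h | h
      · rw [min_eq_left (by rw [Real.one_le_exp_iff]; linarith), min_eq_left (by rw [Real.one_le_exp_iff]; linarith)]; linarith
      · rw [min_eq_right (by rw [Real.exp_le_one_iff]; linarith), min_eq_right (by rw [Real.exp_le_one_iff]; linarith)]
        have h1 : x ≤ M * Real.exp (x - M) := by nlinarith [Real.add_one_le_exp (x - M)]
        calc _ ≤ M * Real.exp (x - M) * Real.exp (2 * (M - x)) := mul_le_mul_of_nonneg_right h1 (Real.exp_pos _).le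
          _ = _ := by rw [mul_assoc, ← Real.exp_add]; ring_nf
    calc _ ≤ lw n * x * ((if x ≤ M then M - x else 0) + 1 / 2 * min 1 (Real.exp (2 * (M - x)))) := by
          refine (mul_le_mul_of_nonneg_left hW (mul_nonneg hw ArithmeticFunction.vonMangoldt_nonneg)).trans ?_
          exact mul_le_mul_of_nonneg_right (mul_le_mul_of_nonneg_left hL hw) hW0
      _ = lw n * (if x ≤ M then x * (M - x) else 0) + lw n * (1 / 2 * (x * min 1 (Real.exp (2 * (M - x))))) := by
          split_ifs <;> ring
      _ ≤ lw n * (if x ≤ M then x * (M - x) else 0) + lw n * (1 / 2 * (M * min 1 (Real.exp (M - x)))) := by gcongr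
      _ = _ := by ring
  refine le_of_tendsto hs.tendsto_sum_nat ?_
  have hev : ∀ᶠ N : ℕ in atTop, Real.exp M < N := tendsto_natCast_atTop_atTop.eventually_gt_atTop _
  filter_upwards [hev] with N hN
  refine (Finset.sum_le_sum fun n _ => term n).trans ?_
  rw [Finset.sum_add_distrib, ← Finset.mul_sum]
  have a1 := diag_main K hK hm N M hM0 hN
  have a2 := mul_le_mul_of_nonneg_left (diag_tail K hK hm N M hM0) (by linarith : 0 ≤ M / 2)
  have a3 : M / 2 * (2 * (M + K)) ≤ (1 + K) * M ^ 2 := by nlinarith [mul_nonneg (by linarith : 0 ≤ K) (mul_nonneg hM0 (sub_nonneg.2 hM))]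
  linarith

end TT

namespace TT
open Complex Metric

lemma SS_cont (Z : Finset ℂ) (hZ : ∀ ρ ∈ Z, IsNontrivialZero ρ) : Continuous (fun p : ℝ × ℝ => SS Z p.1 p.2) := by
  unfold SS Gs
  refine continuous_finsetSum _ fun ρ hρ => ?_
  refine continuous_const.mul (Continuous.mul (by fun_prop) (Continuous.inv₀ (by fun_prop) fun p => ?_))
  refine kd_ne _ ?_
  obtain ⟨-, h1, h2⟩ := hZ ρ hρ
  simp
  rw [abs_le]
  constructor <;> linarith

lemma int_exp_neg (c M : ℝ) (hc : 0 < c) : ∫ u in (0 : ℝ)..M, Real.exp (-(c * u)) ≤ 1 / c := by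
  have : ∀ u : ℝ, Real.exp (-(c * u)) = Real.exp ((-c) * u) := fun u => by ring_nf
  simp only [this]
  rw [intervalIntegral.integral_comp_mul_left _ (by linarith : -c ≠ 0), integral_exp, smul_eq_mul, inv_neg, mul_zero, Real.exp_zero]
  have := mul_pos (inv_pos.2 hc) (Real.exp_pos (-c * M))
  rw [one_div]; nlinarith

lemma sq_split (x y η : ℝ) (h : 0 < η) : (x + y) ^ 2 ≤ (1 + η) * x ^ 2 + (1 + 1 / η) * y ^ 2 := by
  have : (1 + η) * x ^ 2 + (1 + 1 / η) * y ^ 2 - (x + y) ^ 2 = (η * x - y) ^ 2 / η := by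
    field_simp; ring
  have h2 : 0 ≤ (η * x - y) ^ 2 / η := by positivity
  linarith

set_option maxHeartbeats 1000000 in
lemma upper (θ η C : ℝ) (h0 : 0 < θ) (h1 : θ < 1) (hη : 0 < η) (hC : 0 ≤ C) : ∃ C' T0 : ℝ, 0 ≤ C' ∧ ∀ T ≥ T0, ∀ (Z : Finset ℂ) (a b : ℝ),
    (∀ ρ ∈ Z, IsNontrivialZero ρ) →
    (∀ t ∈ Icc (T / 2) (4 * T), ∀ u ∈ Icc 0 (Real.log T), ‖2 * SS Z u t + PP u t - Real.log t * Real.exp (-u)‖ ≤ C) →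
    T / 2 ≤ a → a ≤ b → b ≤ 4 * T →
    ∫ u in (0 : ℝ)..(θ * Real.log T), (θ * Real.log T - u) * ∫ t in a..b, ‖2 * SS Z u t‖ ^ 2 ≤
      (1 + η) * (b - a) * ((θ * Real.log T) ^ 3 / 6 + Real.log T ^ 2 * (θ * Real.log T) / 2) + C' * T * Real.log T ^ 2 := by
  obtain ⟨K, hK, hdiag⟩ := diagonal
  obtain ⟨C1, hC1, hmv⟩ := mean_value ((1 - θ) / 2) (by linarith) (by linarith)
  refine ⟨(1 + η) * (4 * K + C1 + 64 * PB + 12) + 4 * (1 + 1 / η) * C ^ 2, max (Real.exp 2) (Real.exp (1 / θ)), by have := PB_nonneg; positivity, ?_⟩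
  intro T hT Z a b hZ hex ha hab hb
  have hTpos : 0 < T := (Real.exp_pos 2).trans_le ((le_max_left _ _).trans hT)
  have hL2 : 2 ≤ Real.log T := (Real.le_log_iff_exp_le hTpos).2 ((le_max_left _ _).trans hT)
  have hLθ : 1 / θ ≤ Real.log T := (Real.le_log_iff_exp_le hTpos).2 ((le_max_right _ _).trans hT)
  have hexpL : Real.exp (Real.log T) = T := Real.exp_log hTpos
  set L := Real.log T with hL
  set M := θ * L with hM
  have hM1 : 1 ≤ M := by rw [div_le_iff₀ h0] at hLθ; rw [hM]; linarith
  have hML : M ≤ L := by rw [hM]; nlinarith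
  have hM0 : 0 ≤ M := by linarith
  set L1 := L + 2 with hL1
  have hPB := PB_nonneg
  have hba : 0 ≤ b - a := by linarith
  have hba4 : b - a ≤ 4 * T := by linarith
  have hc := SS_cont Z hZ
  have hc2 : Continuous (fun p : ℝ × ℝ => ‖2 * SS Z p.1 p.2‖ ^ 2) := by fun_prop
  have pt : ∀ u ∈ Icc 0 M, ∀ t ∈ Icc a b, ‖2 * SS Z u t‖ ^ 2 ≤ (1 + η) * ‖PP u t‖ ^ 2 +
      ((1 + η) * (2 * L1 * PB * Real.exp (-(1 / 4 * u)) + L1 ^ 2 * Real.exp (-(2 * u))) + (1 + 1 / η) * C ^ 2) := by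
    intro u hu t ht
    have h := hex t ⟨by linarith [ht.1], by linarith [ht.2]⟩ u ⟨hu.1, hu.2.trans hML⟩
    have htpos : 1 ≤ t := by
      have : (2 : ℝ) ≤ T := by rw [← hexpL]; linarith [Real.add_one_le_exp L]
      linarith [ht.1]
    have hlt0 : 0 ≤ Real.log t := Real.log_nonneg htpos
    have hlt : Real.log t ≤ L1 := by
      have e4 : Real.log 4 ≤ 2 := by
        rw [Real.log_le_iff_le_exp (by norm_num)]
        have e1 := Real.add_one_le_exp 1
        have : Real.exp 2 = Real.exp 1 * Real.exp 1 := by rw [← Real.exp_add]; norm_num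
        rw [this]; nlinarith
      have : Real.log t ≤ Real.log (4 * T) := Real.log_le_log (by linarith) (by linarith [ht.2])
      rw [Real.log_mul (by norm_num) hTpos.ne'] at this
      linarith
    set r := Real.log t * Real.exp (-u) with hr
    have hr0 : 0 ≤ r := mul_nonneg hlt0 (Real.exp_pos _).le
    have hr1 : r ≤ L1 * Real.exp (-u) := mul_le_mul_of_nonneg_right hlt (Real.exp_pos _).le
    have hPu := PP_bound u t
    have hn : ‖2 * SS Z u t‖ ≤ (‖PP u t‖ + r) + C := by
      have e : 2 * SS Z u t = (2 * SS Z u t + PP u t - Real.log t * Real.exp (-u)) - PP u t + (r : ℂ) := by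
        rw [hr]; push_cast; ring
      rw [e]
      refine (norm_add_le _ _).trans ?_
      rw [norm_real, Real.norm_of_nonneg hr0]
      linarith [norm_sub_le (2 * SS Z u t + PP u t - Real.log t * Real.exp (-u)) (PP u t)]
    have s1 := (pow_le_pow_left₀ (norm_nonneg _) hn 2).trans (sq_split _ _ η hη)
    have s2 : (‖PP u t‖ + r) ^ 2 ≤ ‖PP u t‖ ^ 2 + (2 * L1 * PB * Real.exp (-(1 / 4 * u)) + L1 ^ 2 * Real.exp (-(2 * u))) := by
      have a1 : r * ‖PP u t‖ ≤ (L1 * Real.exp (-u)) * (Real.exp (3 / 4 * u) * PB) := mul_le_mul hr1 hPu (norm_nonneg _) (by positivity)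
      have a2 : (L1 * Real.exp (-u)) * (Real.exp (3 / 4 * u) * PB) = L1 * PB * Real.exp (-(1 / 4 * u)) := by
        have : Real.exp (-(1 / 4 * u)) = Real.exp (-u) * Real.exp (3 / 4 * u) := by rw [← Real.exp_add]; ring_nf
        rw [this]; ring
      have a3 : r ^ 2 ≤ (L1 * Real.exp (-u)) ^ 2 := pow_le_pow_left₀ hr0 hr1 2
      have a4 : (L1 * Real.exp (-u)) ^ 2 = L1 ^ 2 * Real.exp (-(2 * u)) := by
        rw [mul_pow, ← Real.exp_nat_mul]; push_cast; ring_nf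
      linarith [add_sq ‖PP u t‖ r, a2 ▸ a1, a4 ▸ a3]
    have s3 := mul_le_mul_of_nonneg_left s2 (by positivity : 0 ≤ 1 + η)
    linarith
  have inner : ∀ u ∈ Icc 0 M, ∫ t in a..b, ‖2 * SS Z u t‖ ^ 2 ≤ (1 + η) * ((b - a) * DD u + C1 * T) + (b - a) *
      ((1 + η) * (2 * L1 * PB * Real.exp (-(1 / 4 * u)) + L1 ^ 2 * Real.exp (-(2 * u))) + (1 + 1 / η) * C ^ 2) := by
    intro u hu
    have hPc : IntervalIntegrable (fun t => (1 + η) * ‖PP u t‖ ^ 2) volume a b := by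
      have := PP_cont u
      exact (by fun_prop : Continuous _).intervalIntegrable _ _
    refine (intervalIntegral.integral_mono_on hab ?_ (hPc.add intervalIntegrable_const) (pt u hu)).trans ?_
    · exact (hc2.comp (by fun_prop : Continuous fun t : ℝ => (u, t))).intervalIntegrable _ _
    rw [intervalIntegral.integral_add hPc intervalIntegrable_const, intervalIntegral.integral_const, smul_eq_mul, intervalIntegral.integral_const_mul]
    have := hmv u a b hab
    have e : Real.exp ((1 + 2 * ((1 - θ) / 2)) * u) ≤ T := by
      rw [← hexpL, Real.exp_le_exp]
      have : (1 + 2 * ((1 - θ) / 2)) * u ≤ (2 - θ) * M := by nlinarith [hu.2]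
      rw [hM] at this
      nlinarith [sq_nonneg (1 - θ)]
    have e2 := mul_le_mul_of_nonneg_left e hC1
    have e3 := mul_le_mul_of_nonneg_left (this.trans (add_le_add_right e2 _)) (by positivity : 0 ≤ 1 + η)
    linarith
  have hci : Continuous (fun u => ∫ t in a..b, ‖2 * SS Z u t‖ ^ 2) :=
    intervalIntegral.continuous_parametric_intervalIntegral_of_continuous' (f := fun u t => ‖2 * SS Z u t‖ ^ 2) hc2 a b
  have hDi : IntervalIntegrable (fun u => (M - u) * DD u) volume 0 M := by
    refine ContinuousOn.intervalIntegrable ?_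
    rw [uIcc_of_le hM0]
    exact ContinuousOn.mul (by fun_prop) (DD_cont M)
  set A0 := M * ((1 + η) * C1 * T + (1 + 1 / η) * C ^ 2 * (b - a)) with hA0
  set A1 := M * ((1 + η) * (b - a) * (2 * L1 * PB)) with hA1
  set A2 := M * ((1 + η) * (b - a) * L1 ^ 2) with hA2
  have hA1' : 0 ≤ A1 := by positivity
  have hA2' : 0 ≤ A2 := by positivity
  have i1 : IntervalIntegrable (fun u => (1 + η) * (b - a) * ((M - u) * DD u)) volume 0 M := hDi.const_mul _
  have i2 : IntervalIntegrable (fun u => A1 * Real.exp (-(1 / 4 * u))) volume 0 M := (by fun_prop : Continuous _).intervalIntegrable _ _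
  have i3 : IntervalIntegrable (fun u => A2 * Real.exp (-(2 * u))) volume 0 M := (by fun_prop : Continuous _).intervalIntegrable _ _
  have i4 : IntervalIntegrable (fun _ : ℝ => A0) volume 0 M := intervalIntegrable_const
  have outer : ∫ u in (0 : ℝ)..M, (M - u) * ∫ t in a..b, ‖2 * SS Z u t‖ ^ 2 ≤
      ∫ u in (0 : ℝ)..M, ((1 + η) * (b - a) * ((M - u) * DD u) + A1 * Real.exp (-(1 / 4 * u)) + A2 * Real.exp (-(2 * u)) + A0) := by
    refine intervalIntegral.integral_mono_on hM0 ?_ (((i1.add i2).add i3).add i4) ?_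
    · exact (by fun_prop : Continuous _).intervalIntegrable _ _
    intro u hu
    have hw : 0 ≤ M - u := by linarith [hu.2]
    have hw2 : M - u ≤ M := by linarith [hu.1]
    refine (mul_le_mul_of_nonneg_left (inner u hu) hw).trans ?_
    set X := Real.exp (-(1 / 4 * u))
    set Y := Real.exp (-(2 * u))
    have hX : 0 < X := Real.exp_pos _
    have hY : 0 < Y := Real.exp_pos _
    have g : 0 ≤ (1 + η) * C1 * T + (b - a) * ((1 + η) * (2 * L1 * PB * X + L1 ^ 2 * Y) + (1 + 1 / η) * C ^ 2) := by positivity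
    have := mul_le_mul_of_nonneg_right hw2 g
    rw [hA0, hA1, hA2]
    linarith
  refine outer.trans ?_
  rw [intervalIntegral.integral_add ((i1.add i2).add i3) i4, intervalIntegral.integral_add (i1.add i2) i3, intervalIntegral.integral_add i1 i2,
    intervalIntegral.integral_const, intervalIntegral.integral_const_mul, intervalIntegral.integral_const_mul, intervalIntegral.integral_const_mul, smul_eq_mul]
  have f1 := mul_le_mul_of_nonneg_left (hdiag M hM1) (by positivity : 0 ≤ (1 + η) * (b - a))
  have f2 := mul_le_mul_of_nonneg_left (int_exp_neg (1 / 4) M (by norm_num)) hA1'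
  have f3 := mul_le_mul_of_nonneg_left (int_exp_neg 2 M (by norm_num)) hA2'
  have hMM : M * M ≤ L * L := mul_le_mul hML hML hM0 (by linarith)
  have g1 : (b - a) * (M * M) ≤ (4 * T) * (L * L) := mul_le_mul hba4 hMM (by positivity) (by positivity)
  have g2 : M * (b - a) * L1 ≤ L * (4 * T) * (2 * L) := mul_le_mul (mul_le_mul hML hba4 hba (by linarith)) (by linarith) (by linarith) (by positivity)
  have g3 : M * (b - a) * L1 ^ 2 ≤ M * (b - a) * L ^ 2 + L * (4 * T) * (6 * L) := by
    have q1 : L1 ^ 2 ≤ L ^ 2 + 6 * L := by rw [hL1]; nlinarith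
    have q2 : M * (b - a) * (6 * L) ≤ L * (4 * T) * (6 * L) := mul_le_mul_of_nonneg_right (mul_le_mul hML hba4 hba (by linarith)) (by linarith)
    have q3 := mul_le_mul_of_nonneg_left q1 (by positivity : 0 ≤ M * (b - a))
    linarith
  have g4 : T * (M * M) ≤ T * (L * L) := mul_le_mul_of_nonneg_left hMM hTpos.le
  have k1 := mul_le_mul_of_nonneg_left g1 (by positivity : 0 ≤ (1 + η) * K)
  have k2 := mul_le_mul_of_nonneg_left g4 (by positivity : 0 ≤ (1 + η) * C1)
  have k3 := mul_le_mul_of_nonneg_left g1 (by positivity : 0 ≤ (1 + 1 / η) * C ^ 2)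
  have k4 := mul_le_mul_of_nonneg_left g2 (by positivity : 0 ≤ (1 + η) * (8 * PB))
  have k5 := mul_le_mul_of_nonneg_left g3 (by positivity : 0 ≤ (1 + η) * (1 / 2))
  rw [hA0]
  rw [hA1, show (1 : ℝ) / (1 / 4) = 4 by norm_num] at f2
  rw [hA2] at f3
  rw [hA1, hA2]
  linarith

end TT

namespace TT
open Complex Metric

lemma swap_cont (f : ℝ → ℝ → ℝ) (hf : Continuous (Function.uncurry f)) (a b c d : ℝ) (hab : a ≤ b) (hcd : c ≤ d) :
    ∫ x in a..b, ∫ y in c..d, f x y = ∫ y in c..d, ∫ x in a..b, f x y := by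
  simp only [intervalIntegral.integral_of_le hab, intervalIntegral.integral_of_le hcd]
  refine integral_integral_swap ?_
  rw [Measure.prod_restrict]
  have : IntegrableOn (Function.uncurry f) (Icc a b ×ˢ Icc c d) (volume.prod volume) :=
    hf.continuousOn.integrableOn_compact (isCompact_Icc.prod isCompact_Icc)
  exact this.mono_set (prod_mono Ioc_subset_Icc_self Ioc_subset_Icc_self)

lemma cs_int (f : ℝ → ℝ) (hf : Continuous f) (u : ℝ) (hu : 0 ≤ u) :
    (∫ v in (0 : ℝ)..u, f v) ^ 2 ≤ u * ∫ v in (0 : ℝ)..u, f v ^ 2 := by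
  rcases hu.eq_or_lt with rfl | hu'
  · simp
  set X := ∫ v in (0 : ℝ)..u, f v
  have h : ∫ v in (0 : ℝ)..u, (2 * (X / u) * f v - (X / u) ^ 2) ≤ ∫ v in (0 : ℝ)..u, f v ^ 2 := by
    refine intervalIntegral.integral_mono_on hu ((by fun_prop : Continuous _).intervalIntegrable _ _) ((by fun_prop : Continuous _).intervalIntegrable _ _) ?_
    intro v _
    nlinarith [sq_nonneg (f v - X / u)]
  rw [intervalIntegral.integral_sub ((by fun_prop : Continuous _).intervalIntegrable _ _) intervalIntegrable_const,
    intervalIntegral.integral_const_mul, intervalIntegral.integral_const, smul_eq_mul] at h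
  have h2 := mul_le_mul_of_nonneg_left h hu
  have e : u * (2 * (X / u) * X - (u - 0) * (X / u) ^ 2) = X ^ 2 := by field_simp; ring
  rw [← e]; exact h2

noncomputable def kap (M y : ℝ) : ℝ := ∫ u in (0 : ℝ)..M, (M - u) * Real.cos (u * y)

lemma kap_zero (M : ℝ) : kap M 0 = M ^ 2 / 2 := by
  simp only [kap, mul_zero, Real.cos_zero, mul_one]
  rw [intervalIntegral.integral_sub intervalIntegrable_const (by simp), integral_id, intervalIntegral.integral_const, smul_eq_mul]
  ring

lemma kap_nonneg (M y : ℝ) : 0 ≤ kap M y := by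
  rcases eq_or_ne y 0 with rfl | hy
  · rw [kap_zero]; positivity
  have d : ∀ u, HasDerivAt (fun u => (M - u) * Real.sin (u * y) / y - Real.cos (u * y) / y ^ 2) ((M - u) * Real.cos (u * y)) u := by
    intro u
    have a0 : HasDerivAt (fun u : ℝ => u * y) y u := by simpa using (hasDerivAt_id u).mul_const y
    have a := ((((hasDerivAt_id u).const_sub M).mul a0.sin).div_const y).sub (a0.cos.div_const (y ^ 2))
    refine a.congr_deriv ?_
    simp only [id]; field_simp; ring
  rw [kap, intervalIntegral.integral_eq_sub_of_hasDerivAt (fun u _ => d u) ((by fun_prop : Continuous _).intervalIntegrable _ _)]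
  simp only [sub_self, zero_mul, zero_div, Real.sin_zero, mul_zero, Real.cos_zero, zero_sub]
  have : 0 ≤ (1 - Real.cos (M * y)) / y ^ 2 := div_nonneg (by linarith [Real.cos_le_one (M * y)]) (sq_nonneg _)
  have e : -(Real.cos (M * y) / y ^ 2) - -(1 / y ^ 2) = (1 - Real.cos (M * y)) / y ^ 2 := by ring
  rw [e]; exact this

variable {ι : Type*}

lemma pair_id (Z : Finset ι) (d : ι → ℂ) (y : ι → ℝ) (u : ℝ) :
    ‖∑ j ∈ Z, d j * exp ((u * y j : ℝ) * I)‖ ^ 2 + ‖∑ j ∈ Z, d j * exp ((-(u * y j) : ℝ) * I)‖ ^ 2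
      = 2 * ∑ j ∈ Z, ∑ k ∈ Z, ((d j).re * (d k).re + (d j).im * (d k).im) * Real.cos (u * (y j - y k)) := by
  have e : ∀ v : ℝ, ∑ j ∈ Z, d j * exp ((v * y j : ℝ) * I) =
      ((∑ j ∈ Z, (d j).re * Real.cos (v * y j) - ∑ j ∈ Z, (d j).im * Real.sin (v * y j) : ℝ) : ℂ) +
      ((∑ j ∈ Z, (d j).re * Real.sin (v * y j) + ∑ j ∈ Z, (d j).im * Real.cos (v * y j) : ℝ) : ℂ) * I := by
    intro v
    rw [← Finset.sum_sub_distrib, ← Finset.sum_add_distrib, ofReal_sum, ofReal_sum, Finset.sum_mul, ← Finset.sum_add_distrib]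
    refine Finset.sum_congr rfl fun j _ => ?_
    rw [exp_mul_I, ← ofReal_cos, ← ofReal_sin]
    apply Complex.ext <;> simp [-ofReal_cos, -ofReal_sin]
  have e2 : ∀ j, (-(u * y j)) = (-u) * y j := fun j => by ring
  simp only [e2]
  rw [e u, e (-u), ← normSq_eq_norm_sq, ← normSq_eq_norm_sq, normSq_add_mul_I, normSq_add_mul_I]
  simp only [neg_mul, Real.cos_neg, Real.sin_neg, mul_neg, Finset.sum_neg_distrib]
  have r : ∑ j ∈ Z, ∑ k ∈ Z, ((d j).re * (d k).re + (d j).im * (d k).im) * Real.cos (u * (y j - y k)) =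
      (∑ j ∈ Z, (d j).re * Real.cos (u * y j)) ^ 2 + (∑ j ∈ Z, (d j).im * Real.cos (u * y j)) ^ 2
      + (∑ j ∈ Z, (d j).re * Real.sin (u * y j)) ^ 2 + (∑ j ∈ Z, (d j).im * Real.sin (u * y j)) ^ 2 := by
    simp only [sq, Finset.sum_mul_sum, ← Finset.sum_add_distrib]
    refine Finset.sum_congr rfl fun j _ => Finset.sum_congr rfl fun k _ => ?_
    rw [mul_sub, Real.cos_sub]; ring
  rw [r]; ring

lemma gram_int (M : ℝ) (Z : Finset ι) (d : ι → ℂ) (y : ι → ℝ) :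
    ∫ u in (0 : ℝ)..M, (M - u) * (2 * ∑ j ∈ Z, ∑ k ∈ Z, ((d j).re * (d k).re + (d j).im * (d k).im) * Real.cos (u * (y j - y k)))
      = 2 * ∑ j ∈ Z, ∑ k ∈ Z, ((d j).re * (d k).re + (d j).im * (d k).im) * kap M (y j - y k) := by
  have e : ∀ u : ℝ, (M - u) * (2 * ∑ j ∈ Z, ∑ k ∈ Z, ((d j).re * (d k).re + (d j).im * (d k).im) * Real.cos (u * (y j - y k)))
      = ∑ j ∈ Z, ∑ k ∈ Z, 2 * ((d j).re * (d k).re + (d j).im * (d k).im) * ((M - u) * Real.cos (u * (y j - y k))) := by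
    intro u
    simp only [Finset.mul_sum]
    refine Finset.sum_congr rfl fun j _ => Finset.sum_congr rfl fun k _ => by ring
  simp only [e]
  rw [intervalIntegral.integral_finsetSum fun j _ => (by fun_prop : Continuous _).intervalIntegrable _ _, Finset.mul_sum]
  refine Finset.sum_congr rfl fun j _ => ?_
  rw [intervalIntegral.integral_finsetSum fun j _ => (by fun_prop : Continuous _).intervalIntegrable _ _, Finset.mul_sum]
  refine Finset.sum_congr rfl fun k _ => ?_
  rw [intervalIntegral.integral_const_mul, kap]; ring

noncomputable def QQ (M : ℝ) (Z : Finset ι) (p y : ι → ℝ) : ℝ := ∑ j ∈ Z, ∑ k ∈ Z, p j * p k * kap M (y j - y k)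

lemma QQ_eq (M : ℝ) (Z : Finset ι) (p y : ι → ℝ) :
    ∫ u in (0 : ℝ)..M, (M - u) * ‖∑ j ∈ Z, (p j : ℂ) * exp ((u * y j : ℝ) * I)‖ ^ 2 = QQ M Z p y := by
  have h := gram_int M Z (fun j => (p j : ℂ)) y
  simp only [ofReal_re, ofReal_im, mul_zero, add_zero] at h
  have e : ∀ u, ‖∑ j ∈ Z, (p j : ℂ) * exp ((u * y j : ℝ) * I)‖ ^ 2 = ∑ j ∈ Z, ∑ k ∈ Z, (p j * p k) * Real.cos (u * (y j - y k)) := by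
    intro u
    have := pair_id Z (fun j => (p j : ℂ)) y u
    simp only [ofReal_re, ofReal_im, mul_zero, add_zero] at this
    have c : ‖∑ j ∈ Z, (p j : ℂ) * exp ((-(u * y j) : ℝ) * I)‖ = ‖∑ j ∈ Z, (p j : ℂ) * exp ((u * y j : ℝ) * I)‖ := by
      rw [← norm_conj, map_sum]
      congr 1
      refine Finset.sum_congr rfl fun j _ => ?_
      rw [map_mul, ← exp_conj, map_mul, conj_ofReal, conj_ofReal, conj_I]
      push_cast; ring_nf
    rw [c] at this
    linarith
  simp only [e]
  have h2 : ∫ u in (0 : ℝ)..M, (M - u) * (2 * ∑ j ∈ Z, ∑ k ∈ Z, (p j * p k) * Real.cos (u * (y j - y k)))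
      = 2 * ∫ u in (0 : ℝ)..M, (M - u) * (∑ j ∈ Z, ∑ k ∈ Z, (p j * p k) * Real.cos (u * (y j - y k))) := by
    rw [← intervalIntegral.integral_const_mul]
    congr 1; ext u; ring
  rw [h2] at h
  rw [QQ]; linarith

lemma QQ_lower (M : ℝ) (Z : Finset ι) (p y : ι → ℝ) (hp : ∀ j ∈ Z, 0 ≤ p j) :
    M ^ 2 / 2 * ∑ j ∈ Z, p j ^ 2 ≤ QQ M Z p y := by
  rw [QQ, Finset.mul_sum]
  refine Finset.sum_le_sum fun j hj => ?_
  have := Finset.single_le_sum (f := fun k => p j * p k * kap M (y j - y k)) (s := Z)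
    (fun k hk => mul_nonneg (mul_nonneg (hp j hj) (hp k hk)) (kap_nonneg _ _)) hj
  refine le_trans (le_of_eq ?_) this
  simp only [sub_self, kap_zero]; ring

lemma gram_le (M τ : ℝ) (hM : 0 ≤ M) (Z : Finset ι) (p y : ι → ℝ) (d : ι → ℂ) (hp : ∀ j ∈ Z, 0 ≤ p j) (hτ : 0 ≤ τ)
    (hd : ∀ j ∈ Z, ‖d j‖ ≤ τ * p j) :
    ∫ u in (0 : ℝ)..M, (M - u) * ‖∑ j ∈ Z, d j * exp ((u * y j : ℝ) * I)‖ ^ 2 ≤ 2 * τ ^ 2 * QQ M Z p y := by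
  calc _ ≤ ∫ u in (0 : ℝ)..M, (M - u) * (2 * ∑ j ∈ Z, ∑ k ∈ Z, ((d j).re * (d k).re + (d j).im * (d k).im) * Real.cos (u * (y j - y k))) := by
        refine intervalIntegral.integral_mono_on hM ((by fun_prop : Continuous _).intervalIntegrable _ _) ((by fun_prop : Continuous _).intervalIntegrable _ _) ?_
        intro u hu
        refine mul_le_mul_of_nonneg_left ?_ (by linarith [hu.2])
        rw [← pair_id]
        linarith [sq_nonneg ‖∑ j ∈ Z, d j * exp ((-(u * y j) : ℝ) * I)‖]
    _ = _ := gram_int M Z d y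
    _ ≤ _ := by
        rw [mul_assoc]
        refine mul_le_mul_of_nonneg_left ?_ (by norm_num)
        rw [QQ, Finset.mul_sum]
        refine Finset.sum_le_sum fun j hj => ?_
        rw [Finset.mul_sum]
        refine Finset.sum_le_sum fun k hk => ?_
        rw [← mul_assoc]
        refine mul_le_mul_of_nonneg_right ?_ (kap_nonneg _ _)
        have e : (d j).re * (d k).re + (d j).im * (d k).im = (d j * (starRingEnd ℂ) (d k)).re := by simp
        rw [e]
        refine (re_le_norm _).trans ?_
        rw [norm_mul, norm_conj]
        calc _ ≤ (τ * p j) * (τ * p k) := mul_le_mul (hd j hj) (hd k hk) (norm_nonneg _) (mul_nonneg hτ (hp j hj))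
          _ = _ := by ring

set_option maxHeartbeats 1000000 in
lemma lower_abs (M e τ η : ℝ) (hM : 0 ≤ M) (he : 0 ≤ e) (hτ : 0 ≤ τ) (hτ1 : τ ≤ 1) (hx : M * e ≤ 1) (hη : 0 < η)
    (hsm : (1 + 1 / η) * (144 * (M * e) ^ 2 + 4 * τ ^ 2) ≤ η)
    (Z : Finset ι) (p y l : ι → ℝ) (b : ι → ℂ) (hp : ∀ j ∈ Z, 0 ≤ p j) (hb : ∀ j ∈ Z, ‖b j - p j‖ ≤ τ * p j)
    (hl : ∀ j ∈ Z, |l j| ≤ e) :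
    (1 - η) * QQ M Z p y ≤ (1 + η) * ∫ u in (0 : ℝ)..M, (M - u) * ‖∑ j ∈ Z, b j * exp (u * (l j + y j * I))‖ ^ 2 := by
  set S : ℝ → ℂ := fun u => ∑ j ∈ Z, b j * exp (u * (l j + y j * I)) with hS
  set A : ℝ → ℂ := fun u => ∑ j ∈ Z, (b j - p j) * exp ((u * y j : ℝ) * I) with hA
  set V : ℝ → ℂ := fun u => ∑ j ∈ Z, (p j : ℂ) * exp ((u * y j : ℝ) * I) with hV
  set g : ℝ → ℝ → ℂ := fun v u => ∑ j ∈ Z, (b j * (l j * exp (v * l j))) * exp ((u * y j : ℝ) * I) with hg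
  set Q := QQ M Z p y with hQ
  have hQ0 : 0 ≤ Q := le_trans (by positivity) (QQ_lower M Z p y hp)
  have hgc : Continuous (Function.uncurry g) := by
    simp only [hg, Function.uncurry_def]; fun_prop
  have hSc : Continuous S := by simp only [hS]; fun_prop
  have hAc : Continuous A := by simp only [hA]; fun_prop
  have hVc : Continuous V := by simp only [hV]; fun_prop
  have hAQ : ∫ u in (0 : ℝ)..M, (M - u) * ‖A u‖ ^ 2 ≤ 2 * τ ^ 2 * Q := gram_le M τ hM Z p y _ hp hτ hb
  have hgQ : ∀ v ∈ Icc 0 M, ∫ u in (0 : ℝ)..M, (M - u) * ‖g v u‖ ^ 2 ≤ 2 * (6 * e) ^ 2 * Q := by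
    intro v hv
    refine gram_le M (6 * e) hM Z p y _ hp (by positivity) fun j hj => ?_
    have h1 : ‖b j‖ ≤ 2 * p j := by
      have := norm_add_le (b j - p j) (p j)
      rw [sub_add_cancel, norm_real, Real.norm_of_nonneg (hp j hj)] at this
      nlinarith [hb j hj, hp j hj]
    have h2 : ‖exp (v * l j)‖ ≤ 3 := by
      rw [norm_exp]
      have : ((v : ℂ) * (l j : ℂ)).re ≤ 1 := by
        rw [← ofReal_mul, ofReal_re]
        refine (le_abs_self _).trans ?_
        rw [abs_mul, abs_of_nonneg hv.1]
        exact (mul_le_mul hv.2 (hl j hj) (abs_nonneg _) hM).trans hx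
      exact (Real.exp_le_exp.2 this).trans (by linarith [Real.exp_one_lt_d9])
    rw [norm_mul, norm_mul, norm_real, Real.norm_eq_abs]
    calc _ ≤ (2 * p j) * (e * 3) := mul_le_mul h1 (mul_le_mul (hl j hj) h2 (norm_nonneg _) he) (by positivity) (by linarith [hp j hj])
      _ = _ := by ring
  have hgc2 : Continuous (fun q : ℝ × ℝ => ‖g q.1 q.2‖ ^ 2) := (hgc.norm.pow 2)
  have hrep : ∀ u, S u - (A u + V u) = ∫ v in (0 : ℝ)..u, g v u := by
    intro u
    simp only [hg]
    rw [intervalIntegral.integral_finsetSum fun j _ => (by fun_prop : Continuous _).intervalIntegrable _ _]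
    simp only [hS, hA, hV]
    rw [← Finset.sum_add_distrib, ← Finset.sum_sub_distrib]
    refine Finset.sum_congr rfl fun j _ => ?_
    have : ∫ v in (0 : ℝ)..u, (l j : ℂ) * exp (v * l j) = exp (u * l j) - 1 := by
      have d : ∀ v : ℝ, HasDerivAt (fun v : ℝ => exp (v * l j)) ((l j : ℂ) * exp (v * l j)) v := by
        intro v
        have := ((ofRealCLM.hasDerivAt (x := v)).mul_const (l j : ℂ)).cexp
        refine this.congr_deriv ?_
        simp [mul_comm]
      rw [intervalIntegral.integral_eq_sub_of_hasDerivAt (fun v _ => d v) ((by fun_prop : Continuous _).intervalIntegrable _ _)]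
      simp
    rw [intervalIntegral.integral_mul_const, intervalIntegral.integral_const_mul, this, mul_add, exp_add]
    push_cast
    ring_nf
  have hVQ : ∫ u in (0 : ℝ)..M, (M - u) * ‖V u‖ ^ 2 = Q := QQ_eq M Z p y
  suffices hgoal : (1 - η) * Q ≤ (1 + η) * ∫ u in (0 : ℝ)..M, (M - u) * ‖S u‖ ^ 2 from hgoal
  clear_value S A V g Q
  have hDu : ∀ u ∈ Icc 0 M, ‖S u - (A u + V u)‖ ^ 2 ≤ M * ∫ v in (0 : ℝ)..M, ‖g v u‖ ^ 2 := by
    intro u hu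
    have hgu : Continuous fun v => ‖g v u‖ := (hgc.comp (by fun_prop : Continuous fun v : ℝ => (v, u))).norm
    rw [hrep]
    calc _ ≤ (∫ v in (0 : ℝ)..u, ‖g v u‖) ^ 2 := pow_le_pow_left₀ (norm_nonneg _) (intervalIntegral.norm_integral_le_integral_norm hu.1) 2
      _ ≤ u * ∫ v in (0 : ℝ)..u, ‖g v u‖ ^ 2 := cs_int _ hgu u hu.1
      _ ≤ M * ∫ v in (0 : ℝ)..M, ‖g v u‖ ^ 2 := by
        refine mul_le_mul hu.2 ?_ (intervalIntegral.integral_nonneg hu.1 fun _ _ => by positivity) hM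
        refine intervalIntegral.integral_mono_interval le_rfl hu.1 hu.2 (Eventually.of_forall fun _ => by positivity) ((hgu.pow 2).intervalIntegrable _ _)
  have hci : Continuous (fun u => ∫ v in (0 : ℝ)..M, ‖g v u‖ ^ 2) :=
    intervalIntegral.continuous_parametric_intervalIntegral_of_continuous' (f := fun u v => ‖g v u‖ ^ 2) (hgc2.comp continuous_swap) 0 M
  have hDD : ∫ u in (0 : ℝ)..M, (M - u) * ‖S u - (A u + V u)‖ ^ 2 ≤ 72 * (M * e) ^ 2 * Q := by
    calc _ ≤ ∫ u in (0 : ℝ)..M, (M - u) * (M * ∫ v in (0 : ℝ)..M, ‖g v u‖ ^ 2) := by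
          refine intervalIntegral.integral_mono_on hM ((by fun_prop : Continuous _).intervalIntegrable _ _) ((by fun_prop : Continuous _).intervalIntegrable _ _) ?_
          intro u hu
          exact mul_le_mul_of_nonneg_left (hDu u hu) (by linarith [hu.2])
      _ = M * ∫ u in (0 : ℝ)..M, ∫ v in (0 : ℝ)..M, (M - u) * ‖g v u‖ ^ 2 := by
          rw [← intervalIntegral.integral_const_mul]
          congr 1; ext u
          rw [intervalIntegral.integral_const_mul]; ring
      _ = M * ∫ v in (0 : ℝ)..M, ∫ u in (0 : ℝ)..M, (M - u) * ‖g v u‖ ^ 2 := by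
          rw [swap_cont _ _ _ _ _ _ hM hM]
          simp only [Function.uncurry_def]
          exact (by fun_prop : Continuous fun q : ℝ × ℝ => (M - q.1)).mul (hgc2.comp continuous_swap)
      _ ≤ M * ∫ v in (0 : ℝ)..M, 2 * (6 * e) ^ 2 * Q := by
          refine mul_le_mul_of_nonneg_left ?_ hM
          refine intervalIntegral.integral_mono_on hM ?_ intervalIntegrable_const hgQ
          refine Continuous.intervalIntegrable ?_ _ _
          refine intervalIntegral.continuous_parametric_intervalIntegral_of_continuous' (f := fun v u => (M - u) * ‖g v u‖ ^ 2) ?_ 0 M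
          simp only [Function.uncurry_def]
          exact (by fun_prop : Continuous fun q : ℝ × ℝ => (M - q.2)).mul hgc2
      _ = _ := by rw [intervalIntegral.integral_const, smul_eq_mul]; ring
  have hfin : Q ≤ ∫ u in (0 : ℝ)..M, ((1 + η) * ((M - u) * ‖S u‖ ^ 2) + ((2 * (1 + 1 / η)) * ((M - u) * ‖S u - (A u + V u)‖ ^ 2)
      + (2 * (1 + 1 / η)) * ((M - u) * ‖A u‖ ^ 2))) := by
    rw [← hVQ]
    refine intervalIntegral.integral_mono_on hM ((by fun_prop : Continuous _).intervalIntegrable _ _) ((by fun_prop : Continuous _).intervalIntegrable _ _) ?_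
    intro u hu
    have hw : 0 ≤ M - u := by linarith [hu.2]
    set D := S u - (A u + V u) with hD
    have n1 : ‖V u‖ ≤ ‖S u‖ + (‖D‖ + ‖A u‖) := by
      have : V u = S u - (D + A u) := by rw [hD]; ring
      rw [this]
      exact (norm_sub_le _ _).trans (by linarith [norm_add_le D (A u)])
    have n2 := (pow_le_pow_left₀ (norm_nonneg _) n1 2).trans (sq_split _ _ η hη)
    have n3 : (‖D‖ + ‖A u‖) ^ 2 ≤ 2 * ‖D‖ ^ 2 + 2 * ‖A u‖ ^ 2 := by nlinarith [sq_nonneg (‖D‖ - ‖A u‖)]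
    have n4 := mul_le_mul_of_nonneg_left n3 (by positivity : 0 ≤ 1 + 1 / η)
    have n5 := mul_le_mul_of_nonneg_left (n2.trans (add_le_add_right n4 _)) hw
    linarith
  rw [intervalIntegral.integral_add ((by fun_prop : Continuous _).intervalIntegrable _ _) ((by fun_prop : Continuous _).intervalIntegrable _ _),
    intervalIntegral.integral_add ((by fun_prop : Continuous _).intervalIntegrable _ _) ((by fun_prop : Continuous _).intervalIntegrable _ _),
    intervalIntegral.integral_const_mul, intervalIntegral.integral_const_mul, intervalIntegral.integral_const_mul] at hfin
  have z1 := mul_le_mul_of_nonneg_left hDD (by positivity : 0 ≤ 2 * (1 + 1 / η))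
  have z2 := mul_le_mul_of_nonneg_left hAQ (by positivity : 0 ≤ 2 * (1 + 1 / η))
  have z3 := mul_le_mul_of_nonneg_right hsm hQ0
  linarith

end TT

namespace TT
open Complex Metric

lemma ker_close (z : ℂ) (e : ℝ) (h : |z.re| ≤ e) (he : e ≤ 1 / 4) :
    ‖(1 - z ^ 2)⁻¹ - (((1 + z.im ^ 2)⁻¹ : ℝ) : ℂ)‖ ≤ 4 * e * (1 + z.im ^ 2)⁻¹ := by
  have hy : 0 < 1 + z.im ^ 2 := by positivity
  have hyc : ((1 + z.im ^ 2 : ℝ) : ℂ) ≠ 0 := ofReal_ne_zero.2 hy.ne'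
  have hn : 1 - z ^ 2 ≠ 0 := kd_ne z (by linarith)
  have e1 : (1 - z ^ 2)⁻¹ - (((1 + z.im ^ 2)⁻¹ : ℝ) : ℂ) = (z.re * (z.re + 2 * z.im * I)) * (1 - z ^ 2)⁻¹ * (((1 + z.im ^ 2)⁻¹ : ℝ) : ℂ) := by
    rw [ofReal_inv]
    field_simp
    have hz : z ^ 2 = z.re ^ 2 - z.im ^ 2 + 2 * z.re * z.im * I := by
      nth_rw 1 [← re_add_im z]
      linear_combination ((z.im : ℂ) ^ 2) * I_sq
    push_cast
    linear_combination hz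
  rw [e1, norm_mul, norm_mul, norm_mul, norm_real, norm_real, Real.norm_eq_abs, Real.norm_of_nonneg (by positivity : 0 ≤ (1 + z.im ^ 2)⁻¹)]
  refine mul_le_mul_of_nonneg_right ?_ (by positivity)
  rw [norm_inv]
  have he0 : 0 ≤ e := (abs_nonneg _).trans h
  have hre : 15 / 16 + z.im ^ 2 ≤ ‖1 - z ^ 2‖ := by
    refine le_trans ?_ (re_le_norm _)
    have : (1 - z ^ 2).re = 1 - (z.re ^ 2 - z.im ^ 2) := by simp [sq]
    rw [this]
    have : z.re ^ 2 ≤ (1 / 4) ^ 2 := sq_le_sq' (by linarith [neg_le_of_abs_le h]) (by linarith [le_of_abs_le h])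
    linarith
  have h2 : ‖(z.re : ℂ) + 2 * z.im * I‖ ≤ 1 / 4 + 2 * |z.im| := by
    refine (norm_add_le _ _).trans ?_
    simp
    linarith
  have h3 : 1 / 4 + 2 * |z.im| ≤ 4 * ‖1 - z ^ 2‖ := by nlinarith [sq_abs z.im, sq_nonneg (|z.im| - 1)]
  have hp : 0 < ‖1 - z ^ 2‖ := norm_pos_iff.2 hn
  rw [← div_eq_mul_inv, div_le_iff₀ hp]
  calc _ ≤ e * (4 * ‖1 - z ^ 2‖) := mul_le_mul h (h2.trans h3) (norm_nonneg _) he0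
    _ = _ := by ring

noncomputable def pz (ρ : ℂ) (t : ℝ) : ℝ := zetaMult ρ * (1 + (ρ.im - t) ^ 2)⁻¹

lemma pz_nonneg (ρ : ℂ) (t : ℝ) : 0 ≤ pz ρ t := by unfold pz; positivity

lemma pz_close (ρ : ℂ) (t e : ℝ) (h : |ρ.re - 1 / 2| ≤ e) (he : e ≤ 1 / 4) :
    ‖(zetaMult ρ : ℂ) * (1 - (ρ - 1 / 2 - t * I) ^ 2)⁻¹ - pz ρ t‖ ≤ 4 * e * pz ρ t := by
  have hr : (ρ - 1 / 2 - t * I).re = ρ.re - 1 / 2 := by simp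
  have hi : (ρ - 1 / 2 - t * I).im = ρ.im - t := by simp
  have := ker_close (ρ - 1 / 2 - t * I) e (by rw [hr]; exact h) he
  rw [hi] at this
  unfold pz
  rw [ofReal_mul, ofReal_natCast, ← mul_sub, norm_mul, norm_natCast]
  calc _ ≤ (zetaMult ρ : ℝ) * (4 * e * (1 + (ρ.im - t) ^ 2)⁻¹) := mul_le_mul_of_nonneg_left this (by positivity)
    _ = _ := by ring

lemma lower_app (M e η : ℝ) (hM : 0 ≤ M) (he : 0 ≤ e) (he4 : e ≤ 1 / 4) (hx : M * e ≤ 1) (hη : 0 < η) (hη1 : η ≤ 1)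
    (hsm : (1 + 1 / η) * (144 * (M * e) ^ 2 + 64 * e ^ 2) ≤ η) (Z : Finset ℂ) (hZ : ∀ ρ ∈ Z, |ρ.re - 1 / 2| ≤ e) (t : ℝ) :
    (1 - η) * (M ^ 2 / 2 * ∑ ρ ∈ Z, pz ρ t ^ 2) ≤ (1 + η) * ∫ u in (0 : ℝ)..M, (M - u) * ‖SS Z u t‖ ^ 2 := by
  have h1 := lower_abs M e (4 * e) η hM he (by positivity) (by linarith) hx hη (by rw [mul_pow]; linarith) Z (fun ρ => pz ρ t)
    (fun ρ => ρ.im - t) (fun ρ => ρ.re - 1 / 2) (fun ρ => (zetaMult ρ : ℂ) * (1 - (ρ - 1 / 2 - t * I) ^ 2)⁻¹)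
    (fun ρ _ => pz_nonneg ρ t) (fun ρ hρ => pz_close ρ t e (hZ ρ hρ) he4) hZ
  refine le_trans (mul_le_mul_of_nonneg_left (QQ_lower M Z _ (fun ρ => ρ.im - t) (fun ρ _ => pz_nonneg ρ t)) (by linarith)) (h1.trans (le_of_eq ?_))
  congr 2; ext u; congr 3
  unfold SS Gs
  refine Finset.sum_congr rfl fun ρ _ => ?_
  have : (ρ - 1 / 2 - t * I) = ((ρ.re - 1 / 2 : ℝ) : ℂ) + ((ρ.im - t : ℝ) : ℂ) * I := by
    nth_rw 1 [← re_add_im ρ]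
    push_cast; ring
  rw [← this]; ring

lemma ss0 (Z : Finset ℂ) (e t : ℝ) (he4 : e ≤ 1 / 4) (hZ : ∀ ρ ∈ Z, |ρ.re - 1 / 2| ≤ e) :
    (1 - 4 * e) * ∑ ρ ∈ Z, pz ρ t ≤ ‖SS Z 0 t‖ ∧ ‖SS Z 0 t‖ ≤ (1 + 4 * e) * ∑ ρ ∈ Z, pz ρ t := by
  have h : ‖SS Z 0 t - ((∑ ρ ∈ Z, pz ρ t : ℝ) : ℂ)‖ ≤ 4 * e * ∑ ρ ∈ Z, pz ρ t := by
    unfold SS Gs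
    rw [ofReal_sum, ← Finset.sum_sub_distrib, Finset.mul_sum]
    refine (norm_sum_le _ _).trans (Finset.sum_le_sum fun ρ hρ => ?_)
    simpa using pz_close ρ t e (hZ ρ hρ) he4
  have hn : ‖((∑ ρ ∈ Z, pz ρ t : ℝ) : ℂ)‖ = ∑ ρ ∈ Z, pz ρ t := by
    rw [norm_real, Real.norm_of_nonneg (Finset.sum_nonneg fun ρ _ => pz_nonneg ρ t)]
  have h1 := norm_sub_norm_le (SS Z 0 t) ((∑ ρ ∈ Z, pz ρ t : ℝ) : ℂ)
  have h2 := norm_sub_rev (SS Z 0 t) ((∑ ρ ∈ Z, pz ρ t : ℝ) : ℂ) ▸ norm_sub_norm_le ((∑ ρ ∈ Z, pz ρ t : ℝ) : ℂ) (SS Z 0 t)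
  rw [hn] at h1 h2
  constructor <;> linarith

lemma c_cont (y : ℝ) : Continuous fun t : ℝ => (1 + (y - t) ^ 2)⁻¹ :=
  (by fun_prop : Continuous fun t : ℝ => 1 + (y - t) ^ 2).inv₀ fun t => by positivity

lemma c_int (y a b : ℝ) : ∫ t in a..b, (1 + (y - t) ^ 2)⁻¹ = Real.arctan (y - a) - Real.arctan (y - b) := by
  rw [intervalIntegral.integral_comp_sub_left (fun x => (1 + x ^ 2)⁻¹) y, integral_inv_one_add_sq]

lemma c_int_le (y a b : ℝ) : ∫ t in a..b, (1 + (y - t) ^ 2)⁻¹ ≤ Real.pi := by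
  rw [c_int]
  linarith [Real.arctan_lt_pi_div_two (y - a), Real.neg_pi_div_two_lt_arctan (y - b)]

lemma arctan_ge (x D : ℝ) (hD : 0 < D) (h : D ≤ x) : Real.pi / 2 - 1 / D ≤ Real.arctan x := by
  have hx : 0 < x := by linarith
  have h1 := Real.arctan_inv_of_pos hx
  have h2 : Real.arctan x⁻¹ ≤ x⁻¹ := by
    have := Real.le_tan (Real.arctan_nonneg.2 (by positivity : 0 ≤ x⁻¹)) (Real.arctan_lt_pi_div_two _)
    rwa [Real.tan_arctan] at this
  have h3 : x⁻¹ ≤ 1 / D := by rw [one_div]; exact inv_anti₀ hD h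
  linarith

lemma c2_int_ge (y a b D : ℝ) (hD : 0 < D) (ha : a + D ≤ y) (hb : y ≤ b - D) :
    Real.pi / 2 - 1 / D ≤ ∫ t in a..b, ((1 + (y - t) ^ 2)⁻¹) ^ 2 := by
  have d : ∀ x : ℝ, HasDerivAt (fun x : ℝ => (x * (1 + x ^ 2)⁻¹ + Real.arctan x) / 2) (((1 + x ^ 2)⁻¹) ^ 2) x := by
    intro x
    have hx : 1 + x ^ 2 ≠ 0 := by positivity
    have h1 := (((hasDerivAt_id x).pow 2).const_add 1).inv hx
    have h2 := (((hasDerivAt_id x).mul h1).add (Real.hasDerivAt_arctan x)).div_const 2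
    refine h2.congr_deriv ?_
    simp
    field_simp
    ring
  rw [intervalIntegral.integral_comp_sub_left (fun x => ((1 + x ^ 2)⁻¹) ^ 2) y,
    intervalIntegral.integral_eq_sub_of_hasDerivAt (fun x _ => d x) ?_]
  · have h1 := arctan_ge (y - a) D hD (by linarith)
    have h2 := arctan_ge (b - y) D hD (by linarith)
    have h3 : Real.arctan (y - b) = - Real.arctan (b - y) := by rw [← Real.arctan_neg]; congr 1; ring
    have h4 : 0 ≤ (y - a) * (1 + (y - a) ^ 2)⁻¹ := mul_nonneg (by linarith) (by positivity)
    have h5 : 0 ≤ (b - y) * (1 + (y - b) ^ 2)⁻¹ := mul_nonneg (by linarith) (by positivity)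
    have h6 : 1 / D = 2 * (1 / D / 2) := by ring
    rw [h3]; linarith
  · exact (((by fun_prop : Continuous fun t : ℝ => 1 + t ^ 2).inv₀ fun t => by positivity).pow 2).intervalIntegrable _ _

lemma c_int_ge (y a b : ℝ) (ha : a + 1 ≤ y) (hb : y ≤ b - 1) : 1 ≤ ∫ t in a..b, (1 + (y - t) ^ 2)⁻¹ := by
  rw [c_int]
  have h3 : Real.arctan (y - b) = - Real.arctan (b - y) := by rw [← Real.arctan_neg]; congr 1; ring
  have h1 : Real.arctan 1 ≤ Real.arctan (y - a) := Real.arctan_strictMono.monotone (by linarith)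
  have h2 : Real.arctan 1 ≤ Real.arctan (b - y) := Real.arctan_strictMono.monotone (by linarith)
  rw [Real.arctan_one] at h1 h2
  linarith [Real.pi_gt_three]

def Box : Prop := ∀ ε > 0, ∃ T0 : ℝ, ∀ T ≥ T0, ∀ ρ, IsNontrivialZero ρ → T / 4 ≤ ρ.im → |ρ.re - 1 / 2| ≤ ε / Real.log T

lemma box_of (b : ℝ → ℝ) (hblim : Tendsto b atTop (nhds 0))
    (hbox : ∀ᶠ T in atTop, ∀ ρ ∈ zeroBand T, |ρ.re - 1/2| < b T / (2 * Real.log T)) : Box := by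
  intro ε hε
  obtain ⟨T1, hT1⟩ := eventually_atTop.1 (hbox.and (hblim.eventually_lt_const hε))
  refine ⟨max 100 (6 * |T1|), fun T hT ρ hρ hi => ?_⟩
  have h1 : 100 ≤ T := (le_max_left _ _).trans hT
  have h2 : 6 * |T1| ≤ T := (le_max_right _ _).trans hT
  have h3 : T1 ≤ 3 / 4 * ρ.im := by nlinarith [le_abs_self T1, abs_nonneg T1]
  obtain ⟨q1, q2⟩ := hT1 _ h3
  have h4 := q1 ρ ⟨hρ, by linarith, by linarith⟩
  have hL : 0 < Real.log T := Real.log_pos (by linarith)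
  have h5 : Real.log T ≤ 2 * Real.log (3 / 4 * ρ.im) := by
    rw [show (2 : ℝ) * Real.log (3 / 4 * ρ.im) = Real.log ((3 / 4 * ρ.im) ^ 2) by rw [Real.log_pow]; norm_num]
    exact Real.log_le_log (by linarith) (by nlinarith)
  refine h4.le.trans ?_
  exact div_le_div₀ hε.le q2.le hL h5

end TT

namespace TT
open Complex Metric

lemma ss0_bd (Z : Finset ℂ) (C t : ℝ) (h : ‖2 * SS Z 0 t + PP 0 t - Real.log t * Real.exp (-0)‖ ≤ C) (ht : 1 ≤ t) :
    Real.log t - PB - C ≤ 2 * ‖SS Z 0 t‖ ∧ 2 * ‖SS Z 0 t‖ ≤ Real.log t + PB + C := by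
  have h1 := PP_bound 0 t
  have hl : 0 ≤ Real.log t := Real.log_nonneg ht
  rw [mul_zero, Real.exp_zero, one_mul] at h1
  rw [neg_zero, Real.exp_zero, ofReal_one, mul_one] at h
  have h2 : ‖2 * SS Z 0 t‖ = 2 * ‖SS Z 0 t‖ := by rw [norm_mul]; simp
  have h3 : ‖((Real.log t : ℝ) : ℂ)‖ = Real.log t := by rw [norm_real, Real.norm_of_nonneg hl]
  have h4 := norm_add₃_le (a := 2 * SS Z 0 t) (b := PP 0 t) (c := -(2 * SS Z 0 t + PP 0 t - Real.log t))
  have h5 := norm_add₃_le (a := 2 * SS Z 0 t + PP 0 t - Real.log t) (b := - PP 0 t) (c := ((Real.log t : ℝ) : ℂ))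
  rw [norm_neg] at h4 h5
  rw [show 2 * SS Z 0 t + PP 0 t + -(2 * SS Z 0 t + PP 0 t - Real.log t) = ((Real.log t : ℝ) : ℂ) by ring, h3, h2] at h4
  rw [show 2 * SS Z 0 t + PP 0 t - Real.log t + - PP 0 t + ((Real.log t : ℝ) : ℂ) = 2 * SS Z 0 t by ring, h3, h2] at h5
  constructor <;> linarith

lemma pz_cont (ρ : ℂ) : Continuous (pz ρ) := by
  unfold pz
  exact continuous_const.mul (c_cont _)

lemma pz_int (Z : Finset ℂ) (a b : ℝ) : ∫ t in a..b, ∑ ρ ∈ Z, pz ρ t = ∑ ρ ∈ Z, (zetaMult ρ : ℝ) * ∫ t in a..b, (1 + (ρ.im - t) ^ 2)⁻¹ := by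
  rw [intervalIntegral.integral_finsetSum fun ρ _ => (pz_cont ρ).intervalIntegrable _ _]
  refine Finset.sum_congr rfl fun ρ _ => ?_
  unfold pz
  rw [intervalIntegral.integral_const_mul]

lemma log_mul_le (T : ℝ) (hT : 6 ≤ T) : Real.log (6 * T) ≤ 2 * Real.log T := by
  rw [show (2 : ℝ) * Real.log T = Real.log (T ^ 2) by rw [Real.log_pow]; norm_num]
  exact Real.log_le_log (by linarith) (by nlinarith)

lemma log_one_le (T : ℝ) (hT : 6 ≤ T) : 1 ≤ Real.log T := by
  rw [Real.le_log_iff_exp_le (by linarith)]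
  linarith [Real.exp_one_lt_d9]

lemma count1 (hB : Box) : ∃ C T0 : ℝ, 0 < C ∧ 6 ≤ T0 ∧ ∀ S ≥ T0, ∀ W : Finset ℂ,
    (∀ ρ ∈ W, IsNontrivialZero ρ ∧ S ≤ ρ.im ∧ ρ.im ≤ 2 * S) → ∑ ρ ∈ W, (zetaMult ρ : ℝ) ≤ C * S * Real.log S := by
  obtain ⟨C, T1, hC, hE⟩ := explicit
  obtain ⟨T2, hT2⟩ := hB (1 / 8) (by norm_num)
  refine ⟨4 * (2 + PB + C), max 6 (max T1 T2), by linarith [PB_nonneg], le_max_left _ _, fun S hS W hW => ?_⟩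
  have h6 : 6 ≤ S := (le_max_left _ _).trans hS
  have hS1 : T1 ≤ S := (le_max_left _ _).trans ((le_max_right _ _).trans hS)
  have hS2 : T2 ≤ S := (le_max_right _ _).trans ((le_max_right _ _).trans hS)
  have hL := log_one_le S h6
  obtain ⟨Z, hZ1, hZ2, hZ3⟩ := hE S hS1
  have hWZ : W ⊆ Z := fun ρ hρ => hZ2 ρ (hW ρ hρ).1 (by linarith [(hW ρ hρ).2.1]) (by linarith [(hW ρ hρ).2.2])
  have hbox : ∀ ρ ∈ Z, |ρ.re - 1 / 2| ≤ 1 / 8 := fun ρ hρ => (hT2 S hS2 ρ (hZ1 ρ hρ).1 (hZ1 ρ hρ).2.1).trans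
    (div_le_self (by norm_num) hL)
  have hp : ∀ t ∈ Icc (S / 2) (4 * S), ∑ ρ ∈ Z, pz ρ t ≤ (2 + PB + C) * Real.log S := by
    intro t ht
    have h1 := (ss0_bd Z C t (hZ3 t ht 0 ⟨le_rfl, by linarith⟩) (by linarith [ht.1])).2
    have h2 := (ss0 Z (1 / 8) t (by norm_num) hbox).1
    have h3 : Real.log t ≤ 2 * Real.log S := (Real.log_le_log (by linarith [ht.1]) (by linarith [ht.2])).trans (log_mul_le S h6)
    nlinarith [PB_nonneg]
  have h1 : ∑ ρ ∈ W, (zetaMult ρ : ℝ) ≤ ∫ t in (S / 2)..(4 * S), ∑ ρ ∈ Z, pz ρ t := by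
    rw [pz_int]
    calc _ ≤ ∑ ρ ∈ W, (zetaMult ρ : ℝ) * ∫ t in (S / 2)..(4 * S), (1 + (ρ.im - t) ^ 2)⁻¹ := by
          refine Finset.sum_le_sum fun ρ hρ => ?_
          have := c_int_ge ρ.im (S / 2) (4 * S) (by linarith [(hW ρ hρ).2.1]) (by linarith [(hW ρ hρ).2.2])
          exact le_mul_of_one_le_right (by positivity) this
      _ ≤ _ := Finset.sum_le_sum_of_subset_of_nonneg hWZ fun ρ _ _ => mul_nonneg (by positivity)
          (intervalIntegral.integral_nonneg (by linarith) fun t _ => by positivity)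
  refine h1.trans ?_
  have h2 := intervalIntegral.integral_mono_on (μ := volume) (by linarith : S / 2 ≤ 4 * S)
    ((continuous_finsetSum Z fun ρ _ => pz_cont ρ).intervalIntegrable _ _) intervalIntegrable_const hp
  rw [intervalIntegral.integral_const, smul_eq_mul] at h2
  refine h2.trans ?_
  have : 0 ≤ (2 + PB + C) * Real.log S := mul_nonneg (by linarith [PB_nonneg]) (by linarith)
  nlinarith

lemma countZ (hB : Box) : ∃ C T0 : ℝ, 0 < C ∧ ∀ T ≥ T0, ∀ Z : Finset ℂ,
    (∀ ρ ∈ Z, IsNontrivialZero ρ ∧ T / 4 ≤ ρ.im ∧ ρ.im ≤ 6 * T) → ∑ ρ ∈ Z, (zetaMult ρ : ℝ) ≤ C * T * Real.log T := by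
  classical
  obtain ⟨C, T0, hC, h60, hc⟩ := count1 hB
  refine ⟨40 * C, 4 * T0, by positivity, fun T hT Z hZ => ?_⟩
  have h6 : 6 ≤ T := by linarith
  have hL := log_one_le T h6
  have key : ∀ i ∈ Finset.range 5, ∑ ρ ∈ Z.filter (fun ρ => T / 4 * 2 ^ i ≤ ρ.im ∧ ρ.im ≤ 2 * (T / 4 * 2 ^ i)), (zetaMult ρ : ℝ) ≤ 8 * C * T * Real.log T := by
    intro i hi
    have hi5 : i < 5 := Finset.mem_range.1 hi
    have p1 : (1 : ℝ) ≤ 2 ^ i := one_le_pow₀ (by norm_num)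
    have p2 : (2 : ℝ) ^ i ≤ 2 ^ 4 := pow_le_pow_right₀ (by norm_num) (by omega)
    have q1 : T / 4 ≤ T / 4 * 2 ^ i := le_mul_of_one_le_right (by linarith) p1
    have q2 : T / 4 * 2 ^ i ≤ 4 * T := by nlinarith
    have := hc (T / 4 * 2 ^ i) (by linarith) _ fun ρ hρ => ⟨(hZ ρ (Finset.mem_filter.1 hρ).1).1, (Finset.mem_filter.1 hρ).2⟩
    refine this.trans ?_
    have q3 : Real.log (T / 4 * 2 ^ i) ≤ 2 * Real.log T := (Real.log_le_log (by linarith) (by linarith)).trans (log_mul_le T h6)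
    have q4 : 0 ≤ Real.log (T / 4 * 2 ^ i) := Real.log_nonneg (by linarith)
    calc _ ≤ C * (4 * T) * (2 * Real.log T) := mul_le_mul (mul_le_mul_of_nonneg_left q2 hC.le) q3 q4 (by positivity)
      _ = _ := by ring
  calc _ ≤ ∑ ρ ∈ Z, ∑ i ∈ Finset.range 5, if T / 4 * 2 ^ i ≤ ρ.im ∧ ρ.im ≤ 2 * (T / 4 * 2 ^ i) then (zetaMult ρ : ℝ) else 0 := by
        refine Finset.sum_le_sum fun ρ hρ => ?_
        obtain ⟨-, a1, a2⟩ := hZ ρ hρ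
        obtain ⟨i, hi, hh⟩ : ∃ i ∈ Finset.range 5, T / 4 * 2 ^ i ≤ ρ.im ∧ ρ.im ≤ 2 * (T / 4 * 2 ^ i) := by
          by_cases b1 : ρ.im ≤ T / 2
          · exact ⟨0, by simp, by linarith, by linarith⟩
          by_cases b2 : ρ.im ≤ T
          · exact ⟨1, by simp, by linarith, by linarith⟩
          by_cases b3 : ρ.im ≤ 2 * T
          · exact ⟨2, by simp, by linarith, by linarith⟩
          by_cases b4 : ρ.im ≤ 4 * T
          · exact ⟨3, by simp, by linarith, by linarith⟩
          · exact ⟨4, by simp, by linarith, by linarith⟩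
        have := Finset.single_le_sum (f := fun i : ℕ => if T / 4 * 2 ^ i ≤ ρ.im ∧ ρ.im ≤ 2 * (T / 4 * 2 ^ i) then (zetaMult ρ : ℝ) else 0)
          (fun i _ => by positivity) hi
        simp only [if_pos hh] at this
        exact this
    _ = ∑ i ∈ Finset.range 5, ∑ ρ ∈ Z.filter (fun ρ => T / 4 * 2 ^ i ≤ ρ.im ∧ ρ.im ≤ 2 * (T / 4 * 2 ^ i)), (zetaMult ρ : ℝ) := by
        rw [Finset.sum_comm]
        exact Finset.sum_congr rfl fun i _ => (Finset.sum_filter _ _).symm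
    _ ≤ ∑ i ∈ Finset.range 5, 8 * C * T * Real.log T := Finset.sum_le_sum key
    _ = _ := by simp; ring

lemma N_lower (hB : Box) (δ : ℝ) (h0 : 0 < δ) (h1 : δ < 1 / 8) : ∃ T0 : ℝ, ∀ T ≥ T0, ∀ W : Finset ℂ, (∀ ρ, ρ ∈ W ↔ ρ ∈ zeroBand T) →
    (1 - 7 * δ) * (T * Real.log T / 2) ≤ Real.pi * ∑ ρ ∈ W, (zetaMult ρ : ℝ) := by
  classical
  obtain ⟨C, T1, hC, hE⟩ := explicit
  obtain ⟨T2, hT2⟩ := hB (δ / 4) (by positivity)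
  obtain ⟨C3, T3, hC3, hc⟩ := countZ hB
  obtain ⟨T4, hT4⟩ := eventually_atTop.1 (((Real.tendsto_log_atTop.const_mul_atTop h0).eventually_ge_atTop (PB + C)).and
    (eventually_ge_atTop (C3 / δ ^ 2 / δ)))
  refine ⟨max 6 (max (max T1 T2) (max T3 T4)), fun T hT W hW => ?_⟩
  simp only [ge_iff_le, max_le_iff] at hT
  obtain ⟨h6, ⟨hS1, hS2⟩, hS3, hS4⟩ := hT
  have hL := log_one_le T h6
  obtain ⟨hLC, hTC⟩ := hT4 T hS4
  obtain ⟨Z, hZ1, hZ2, hZ3⟩ := hE T hS1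
  have hWZ : W ⊆ Z := fun ρ hρ => by
    obtain ⟨a1, a2, a3⟩ := (hW ρ).1 hρ
    exact hZ2 ρ a1 (by linarith) (by linarith)
  have hbox : ∀ ρ ∈ Z, |ρ.re - 1 / 2| ≤ δ / 4 := fun ρ hρ => (hT2 T hS2 ρ (hZ1 ρ hρ).1 (hZ1 ρ hρ).2.1).trans
    (div_le_self (by positivity) hL)
  have hab : T * (1 + δ) ≤ 2 * T * (1 - δ) := by nlinarith
  have hp : ∀ t ∈ Icc (T * (1 + δ)) (2 * T * (1 - δ)), (1 - δ) * Real.log T / 2 ≤ (1 + δ) * ∑ ρ ∈ Z, pz ρ t := by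
    intro t ht
    have ht1 : T ≤ t := by nlinarith [ht.1]
    have ht2 : t ≤ 2 * T := by nlinarith [ht.2]
    have q1 := (ss0_bd Z C t (hZ3 t ⟨by linarith, by linarith⟩ 0 ⟨le_rfl, by linarith⟩) (by linarith)).1
    have q2 := (ss0 Z (δ / 4) t (by linarith) hbox).2
    have q3 : Real.log T ≤ Real.log t := Real.log_le_log (by linarith) ht1
    rw [show 1 + 4 * (δ / 4) = 1 + δ by ring] at q2
    linarith
  have hcp : Continuous fun t => (1 + δ) * ∑ ρ ∈ Z, pz ρ t := continuous_const.mul (continuous_finsetSum Z fun ρ _ => pz_cont ρ)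
  have i1 := intervalIntegral.integral_mono_on (μ := volume) hab intervalIntegrable_const
    (hcp.intervalIntegrable _ _) hp
  rw [intervalIntegral.integral_const, smul_eq_mul, intervalIntegral.integral_const_mul, pz_int] at i1
  have hfar : ∀ ρ ∈ Z, (zetaMult ρ : ℝ) * ∫ t in (T * (1 + δ))..(2 * T * (1 - δ)), (1 + (ρ.im - t) ^ 2)⁻¹
      ≤ (if ρ ∈ W then Real.pi * (zetaMult ρ : ℝ) else 0) + (zetaMult ρ : ℝ) * (1 / (δ ^ 2 * T)) := by
    intro ρ hρ
    by_cases hw : ρ ∈ W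
    · rw [if_pos hw]
      have := mul_le_mul_of_nonneg_left (c_int_le ρ.im (T * (1 + δ)) (2 * T * (1 - δ))) (by positivity : (0 : ℝ) ≤ zetaMult ρ)
      have : (0 : ℝ) ≤ (zetaMult ρ : ℝ) * (1 / (δ ^ 2 * T)) := by positivity
      linarith
    · rw [if_neg hw, zero_add]
      refine mul_le_mul_of_nonneg_left ?_ (by positivity)
      have hb : ∀ t ∈ Icc (T * (1 + δ)) (2 * T * (1 - δ)), (1 + (ρ.im - t) ^ 2)⁻¹ ≤ ((δ * T) ^ 2)⁻¹ := by
        intro t ht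
        refine inv_anti₀ (by positivity) ?_
        have : δ * T ≤ |ρ.im - t| := by
          by_cases hh : T < ρ.im
          · have : 2 * T < ρ.im := by
              by_contra h3
              exact hw ((hW ρ).2 ⟨(hZ1 ρ hρ).1, hh, not_lt.1 h3⟩)
            refine le_trans ?_ (le_abs_self _)
            nlinarith [ht.2]
          · refine le_trans ?_ (neg_le_abs _)
            nlinarith [ht.1]
        have := pow_le_pow_left₀ (by positivity) this 2
        rw [sq_abs] at this
        linarith
      have := intervalIntegral.integral_mono_on (μ := volume) hab ((c_cont ρ.im).intervalIntegrable _ _) intervalIntegrable_const hb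
      rw [intervalIntegral.integral_const, smul_eq_mul] at this
      refine this.trans ?_
      calc _ ≤ T * ((δ * T) ^ 2)⁻¹ := mul_le_mul_of_nonneg_right (by nlinarith) (by positivity)
        _ = _ := by field_simp
  have i2 := Finset.sum_le_sum hfar
  rw [Finset.sum_add_distrib, ← Finset.sum_mul, Finset.sum_ite_mem, Finset.inter_eq_right.2 hWZ, ← Finset.mul_sum] at i2
  have i3 : (∑ ρ ∈ Z, (zetaMult ρ : ℝ)) * (1 / (δ ^ 2 * T)) ≤ δ * (T * Real.log T) := by
    calc _ ≤ (C3 * T * Real.log T) * (1 / (δ ^ 2 * T)) := mul_le_mul_of_nonneg_right (hc T hS3 Z hZ1) (by positivity)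
      _ = (C3 / δ ^ 2) * Real.log T := by field_simp
      _ ≤ (δ * T) * Real.log T := by
        refine mul_le_mul_of_nonneg_right ?_ (by linarith)
        rwa [div_le_iff₀ h0, mul_comm] at hTC
      _ = _ := by ring
  set N := ∑ ρ ∈ W, (zetaMult ρ : ℝ)
  have i4 := mul_le_mul_of_nonneg_left (i2.trans (add_le_add_right i3 _)) (by linarith : 0 ≤ 1 + δ)
  have i5 := i1.trans i4
  have hX : 0 < T * Real.log T := by positivity
  set X := T * Real.log T
  have i6 : (1 - 3 * δ) * (1 - δ) * X / 2 ≤ (1 + δ) * (Real.pi * N + δ * X) := by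
    refine le_trans (le_of_eq ?_) i5
    simp only [X]; ring
  have i7 : (1 + δ) * ((1 - 7 * δ) * (X / 2)) ≤ (1 + δ) * (Real.pi * N) := by
    refine le_trans ?_ (by linarith : (1 - 3 * δ) * (1 - δ) * X / 2 - (1 + δ) * (δ * X) ≤ _)
    have : 0 ≤ (8 * δ ^ 2) * X := by positivity
    nlinarith
  exact le_of_mul_le_mul_left i7 (by linarith)

end TT

namespace TT
open Complex Metric

lemma sq_lower_int (hB : Box) (δ : ℝ) (h0 : 0 < δ) (h1 : δ < 1 / 8) : ∃ T0 : ℝ, 6 ≤ T0 ∧ ∀ T ≥ T0, ∀ Z : Finset ℂ,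
    (∀ ρ ∈ Z, IsNontrivialZero ρ ∧ T / 4 ≤ ρ.im ∧ ρ.im ≤ 6 * T) → ∀ t,
    (1 - δ) * (((1 - δ) * Real.log T) ^ 2 / 2 * ∑ ρ ∈ Z, pz ρ t ^ 2) ≤
      (1 + δ) * ∫ u in (0 : ℝ)..((1 - δ) * Real.log T), ((1 - δ) * Real.log T - u) * ‖SS Z u t‖ ^ 2 := by
  obtain ⟨T2, hT2⟩ := hB (δ / 20) (by positivity)
  refine ⟨max 6 T2, le_max_left _ _, fun T hT Z hZ t => ?_⟩
  have h6 : 6 ≤ T := (le_max_left _ _).trans hT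
  have hL := log_one_le T h6
  have hL0 : 0 < Real.log T := by linarith
  set M := (1 - δ) * Real.log T with hM
  set e := δ / 20 / Real.log T with he
  have he0 : 0 ≤ e := by positivity
  have he1 : e ≤ δ / 20 := div_le_self (by positivity) hL
  have hMe : M * e = (1 - δ) * (δ / 20) := by rw [hM, he]; field_simp
  have hMe1 : M * e ≤ δ / 20 := by rw [hMe]; nlinarith
  have hMe0 : 0 ≤ M * e := by rw [hMe]; exact mul_nonneg (by linarith) (by positivity)
  refine lower_app M e δ (mul_nonneg (by linarith) hL0.le) he0 (by linarith) (by linarith) h0 (by linarith) ?_ Z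
    (fun ρ hρ => hT2 T ((le_max_right _ _).trans hT) ρ (hZ ρ hρ).1 (hZ ρ hρ).2.1) t
  have a1 := pow_le_pow_left₀ hMe0 hMe1 2
  have a2 := pow_le_pow_left₀ he0 he1 2
  calc _ ≤ (1 + 1 / δ) * (144 * (δ / 20) ^ 2 + 64 * (δ / 20) ^ 2) := by
        refine mul_le_mul_of_nonneg_left (by linarith) (by positivity)
    _ = (208 / 400) * (δ ^ 2 + δ) := by field_simp; ring
    _ ≤ δ := by nlinarith

lemma S2_upper (hB : Box) (δ : ℝ) (h0 : 0 < δ) (h1 : δ < 1 / 8) : ∃ T0 : ℝ, ∀ T ≥ T0, ∀ W : Finset ℂ, (∀ ρ, ρ ∈ W ↔ ρ ∈ zeroBand T) →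
    (1 - δ) ^ 4 * (Real.pi * ∑ ρ ∈ W, (zetaMult ρ : ℝ) ^ 2) ≤ ((1 + δ) ^ 2 * (1 + 3 * δ) * (2 / 3) + 2 * δ) * (T * Real.log T) := by
  obtain ⟨C, T1, hC, hE⟩ := explicit
  obtain ⟨T2, h62, hlow⟩ := sq_lower_int hB δ h0 h1
  obtain ⟨C', T3, hC', hup⟩ := upper (1 - δ) δ C (by linarith) (by linarith) h0 hC.le
  obtain ⟨T4, hT4⟩ := eventually_atTop.1 (((Real.tendsto_log_atTop.const_mul_atTop h0).eventually_ge_atTop C').and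
    (eventually_ge_atTop (1 / δ ^ 2)))
  refine ⟨max (max T1 T2) (max T3 T4), fun T hT W hW => ?_⟩
  simp only [ge_iff_le, max_le_iff] at hT
  obtain ⟨⟨hS1, hS2⟩, hS3, hS4⟩ := hT
  have h6 : 6 ≤ T := h62.trans hS2
  have hL := log_one_le T h6
  obtain ⟨hLC, hTC⟩ := hT4 T hS4
  obtain ⟨Z, hZ1, hZ2, hZ3⟩ := hE T hS1
  have hWZ : W ⊆ Z := fun ρ hρ => by
    obtain ⟨a1, a2, a3⟩ := (hW ρ).1 hρ
    exact hZ2 ρ a1 (by linarith) (by linarith)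
  have hZ0 : ∀ ρ ∈ Z, IsNontrivialZero ρ := fun ρ hρ => (hZ1 ρ hρ).1
  have hab : T * (1 - δ) ≤ 2 * T * (1 + δ) := by nlinarith
  have U := hup T hS3 Z (T * (1 - δ)) (2 * T * (1 + δ)) hZ0 hZ3 (by nlinarith) hab (by nlinarith)
  have V := hlow T hS2 Z hZ1
  clear hup hlow hT4 hE
  generalize Real.log T = L at *
  set M := (1 - δ) * L with hM
  have hM0 : 0 ≤ M := mul_nonneg (by linarith) (by linarith)
  set a := T * (1 - δ) with ha
  set b := 2 * T * (1 + δ) with hb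
  have hSc := SS_cont Z hZ0
  have hc2 : Continuous (fun q : ℝ × ℝ => (M - q.1) * ‖SS Z q.1 q.2‖ ^ 2) :=
    (by fun_prop : Continuous fun q : ℝ × ℝ => (M - q.1)).mul (hSc.norm.pow 2)
  have e1 : ∫ u in (0 : ℝ)..M, (M - u) * ∫ t in a..b, ‖2 * SS Z u t‖ ^ 2 = 4 * ∫ t in a..b, ∫ u in (0 : ℝ)..M, (M - u) * ‖SS Z u t‖ ^ 2 := by
    rw [← swap_cont (fun u t => (M - u) * ‖SS Z u t‖ ^ 2) hc2 _ _ _ _ hM0 hab, ← intervalIntegral.integral_const_mul]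
    congr 1; ext u
    rw [← intervalIntegral.integral_const_mul, ← intervalIntegral.integral_const_mul]
    congr 1; ext t
    rw [norm_mul, mul_pow]
    norm_num
    ring
  rw [e1] at U
  have hci : Continuous fun t => ∫ u in (0 : ℝ)..M, (M - u) * ‖SS Z u t‖ ^ 2 :=
    intervalIntegral.continuous_parametric_intervalIntegral_of_continuous' (f := fun t u => (M - u) * ‖SS Z u t‖ ^ 2) (hc2.comp continuous_swap) 0 M
  have hcp : Continuous fun t => ∑ ρ ∈ Z, pz ρ t ^ 2 := continuous_finsetSum Z fun ρ _ => (pz_cont ρ).pow 2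
  have V2 : ∫ t in a..b, (1 - δ) * (M ^ 2 / 2 * ∑ ρ ∈ Z, pz ρ t ^ 2) ≤ ∫ t in a..b, (1 + δ) * ∫ u in (0 : ℝ)..M, (M - u) * ‖SS Z u t‖ ^ 2 :=
    intervalIntegral.integral_mono_on hab ((by fun_prop : Continuous _).intervalIntegrable _ _) ((by fun_prop : Continuous _).intervalIntegrable _ _) fun t _ => V t
  rw [intervalIntegral.integral_const_mul, intervalIntegral.integral_const_mul, intervalIntegral.integral_const_mul] at V2
  have V3 : (∑ ρ ∈ W, (zetaMult ρ : ℝ) ^ 2) * (Real.pi / 2 * (1 - δ)) ≤ ∫ t in a..b, ∑ ρ ∈ Z, pz ρ t ^ 2 := by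
    have hpc : ∀ ρ, Continuous fun t => pz ρ t ^ 2 := fun ρ => (pz_cont ρ).pow 2
    rw [intervalIntegral.integral_finsetSum fun ρ _ => (hpc ρ).intervalIntegrable _ _, Finset.sum_mul]
    refine (Finset.sum_le_sum fun ρ hρ => ?_).trans (Finset.sum_le_sum_of_subset_of_nonneg hWZ fun ρ _ _ =>
      intervalIntegral.integral_nonneg hab fun t _ => by positivity)
    obtain ⟨-, a2, a3⟩ := (hW ρ).1 hρ
    have q := c2_int_ge ρ.im a b (δ * T) (by positivity) (by rw [ha]; nlinarith) (by rw [hb]; nlinarith)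
    unfold pz
    simp only [mul_pow]
    rw [intervalIntegral.integral_const_mul]
    refine mul_le_mul_of_nonneg_left (le_trans ?_ q) (by positivity)
    have : 1 / (δ * T) ≤ δ := by
      rw [div_le_iff₀ (by positivity)]
      rw [div_le_iff₀ (by positivity)] at hTC
      linarith
    nlinarith [Real.pi_gt_three]
  set S := ∑ ρ ∈ W, (zetaMult ρ : ℝ) ^ 2 with hS
  set J := ∫ t in a..b, ∫ u in (0 : ℝ)..M, (M - u) * ‖SS Z u t‖ ^ 2
  set Y := ∫ t in a..b, ∑ ρ ∈ Z, pz ρ t ^ 2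
  have hTp : 0 < T := by linarith
  clear_value S J Y
  clear V hci hcp hc2 hSc e1 hZ3 hZ2 hZ1 hZ0 hS hWZ hW
  have hba : b - a = T * (1 + 3 * δ) := by rw [ha, hb]; ring
  have w1 : (1 - δ) * (M ^ 2 / 2 * (S * (Real.pi / 2 * (1 - δ)))) ≤ (1 + δ) * J :=
    le_trans (mul_le_mul_of_nonneg_left (mul_le_mul_of_nonneg_left V3 (by positivity)) (by linarith)) V2
  have w2 := mul_le_mul_of_nonneg_left U (by linarith : 0 ≤ 1 + δ)
  have w3 : (1 - δ) ^ 4 * (Real.pi * S) * L ^ 2 ≤ (1 + δ) * ((1 + δ) * (b - a) * (M ^ 3 / 6 + L ^ 2 * M / 2) + C' * T * L ^ 2) := by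
    refine le_trans (le_of_eq ?_) ((mul_le_mul_of_nonneg_left w1 (by norm_num : (0 : ℝ) ≤ 4)).trans ((le_of_eq (by ring)).trans w2))
    rw [hM]; ring
  have hθ : (1 - δ) ^ 3 / 6 + (1 - δ) / 2 ≤ 2 / 3 := by
    have : (1 - δ) ^ 3 ≤ 1 := pow_le_one₀ (by linarith) (by linarith)
    linarith
  have w4 : M ^ 3 / 6 + L ^ 2 * M / 2 ≤ 2 / 3 * L ^ 3 := by
    calc _ = ((1 - δ) ^ 3 / 6 + (1 - δ) / 2) * L ^ 3 := by rw [hM]; ring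
      _ ≤ _ := mul_le_mul_of_nonneg_right hθ (by positivity)
  have w5 : C' * T * L ^ 2 ≤ (δ * L) * T * L ^ 2 := mul_le_mul_of_nonneg_right (mul_le_mul_of_nonneg_right hLC hTp.le) (by positivity)
  have w6 : (1 + δ) * (b - a) * (M ^ 3 / 6 + L ^ 2 * M / 2) ≤ (1 + δ) * (T * (1 + 3 * δ)) * (2 / 3 * L ^ 3) := by
    rw [hba]; exact mul_le_mul_of_nonneg_left w4 (by positivity)
  have w7 := w3.trans (mul_le_mul_of_nonneg_left (add_le_add w6 w5) (by linarith : 0 ≤ 1 + δ))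
  refine le_of_mul_le_mul_right (w7.trans ?_) (by positivity : 0 < L ^ 2)
  have w8 : (1 + δ) * δ ≤ 2 * δ := by nlinarith
  have w9 := mul_le_mul_of_nonneg_right w8 (by positivity : 0 ≤ T * L ^ 3)
  linarith

lemma mult_facts (ρ : ℂ) (h : IsNontrivialZero ρ) (hi : ρ.im ≠ 0) : 1 ≤ zetaMult ρ :=
  mult_pos hi ((ntz_iff hi).1 h)

lemma band_finite (T : ℝ) (hT : 0 < T) : (zeroBand T).Finite := by
  refine (Xi_zeros_finite (Icc 0 1 ×ℂ Icc T (2 * T)) (isCompact_Icc.reProdIm isCompact_Icc).isBounded ?_).subset ?_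
  · intro s hs
    have := (mem_reProdIm.1 hs).2.1
    linarith
  · rintro s ⟨h1, h2, h3⟩
    have hi : s.im ≠ 0 := by linarith
    exact ⟨mem_reProdIm.2 ⟨⟨h1.2.1.le, h1.2.2.le⟩, h2.le, h3⟩, (ntz_iff hi).1 h1⟩

lemma final_quant (hB : Box) (η : ℝ) (hη : 0 < η) : ∀ᶠ T in atTop, 0 < Ntot T ∧ (2 / 3 - η) * Ntot T ≤ Nsimple T := by
  obtain ⟨δ, ⟨hR, hδ1⟩, hδ0⟩ : ∃ δ : ℝ, ((2 / 3 - η) ≤ 2 - (2 * ((1 + δ) ^ 2 * (1 + 3 * δ) * (2 / 3) + 2 * δ) / ((1 - δ) ^ 4 * (1 - 7 * δ))) ∧ δ < 1 / 8) ∧ 0 < δ := by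
    have hc : ContinuousAt (fun δ : ℝ => 2 - (2 * ((1 + δ) ^ 2 * (1 + 3 * δ) * (2 / 3) + 2 * δ) / ((1 - δ) ^ 4 * (1 - 7 * δ)))) 0 := by
      refine ContinuousAt.sub continuousAt_const (ContinuousAt.div (by fun_prop) (by fun_prop) (by norm_num))
    have h1 := hc.tendsto.eventually_const_le (u := 2 / 3 - η) (by norm_num; linarith)
    have h2 : ∀ᶠ δ : ℝ in 𝓝 0, δ < 1 / 8 := eventually_lt_nhds (by norm_num)
    have h3 := (h1.and h2).filter_mono (nhdsWithin_le_nhds (s := Ioi (0 : ℝ)))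
    obtain ⟨δ, hd, hd2⟩ := (h3.and (eventually_mem_nhdsWithin (a := (0 : ℝ)) (s := Ioi (0 : ℝ)))).exists
    exact ⟨δ, hd, hd2⟩
  obtain ⟨T1, hT1⟩ := N_lower hB δ hδ0 hδ1
  obtain ⟨T2, hT2⟩ := S2_upper hB δ hδ0 hδ1
  filter_upwards [eventually_ge_atTop T1, eventually_ge_atTop T2, eventually_ge_atTop 6] with T a1 a2 a6
  have hfin := band_finite T (by linarith)
  have hW : ∀ ρ, ρ ∈ hfin.toFinset ↔ ρ ∈ zeroBand T := fun ρ => hfin.mem_toFinset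
  have b1 := hT1 T a1 _ hW
  have b2 := hT2 T a2 _ hW
  have hN : Ntot T = ∑ ρ ∈ hfin.toFinset, (zetaMult ρ : ℝ) := finsum_mem_eq_finite_toFinset_sum _ hfin
  have hS : Nsimple T = ∑ ρ ∈ hfin.toFinset, if zetaMult ρ = 1 then (1 : ℝ) else 0 := by
    rw [← Finset.sum_filter]
    unfold Nsimple
    rw [← finsum_mem_coe_finset]
    congr 1; ext ρ
    simp
  have hge : 2 * (∑ ρ ∈ hfin.toFinset, (zetaMult ρ : ℝ)) - ∑ ρ ∈ hfin.toFinset, (zetaMult ρ : ℝ) ^ 2 ≤ Nsimple T := by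
    rw [hS, Finset.mul_sum, ← Finset.sum_sub_distrib]
    refine Finset.sum_le_sum fun ρ hρ => ?_
    obtain ⟨c1, c2, c3⟩ := (hW ρ).1 hρ
    have hm := mult_facts ρ c1 (by linarith)
    split_ifs with h
    · rw [h]; norm_num
    · have : (2 : ℝ) ≤ zetaMult ρ := by exact_mod_cast (by omega : 2 ≤ zetaMult ρ)
      nlinarith
  rw [← hN] at b1 hge
  set S := ∑ ρ ∈ hfin.toFinset, (zetaMult ρ : ℝ) ^ 2
  set N := Ntot T
  have hX : 0 < T * Real.log T := mul_pos (by linarith) (by linarith [log_one_le T a6])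
  set X := T * Real.log T
  set A := ((1 + δ) ^ 2 * (1 + 3 * δ) * (2 / 3) + 2 * δ)
  have hA : 0 < A := by positivity
  have d7 : 0 < 1 - 7 * δ := by linarith
  have d1 : 0 < (1 - δ) ^ 4 := pow_pos (by linarith) 4
  have hpi := Real.pi_pos
  have hNp : 0 < N := by
    have : 0 < Real.pi * N := lt_of_lt_of_le (by positivity) b1
    exact (mul_pos_iff_of_pos_left hpi).1 this
  refine ⟨hNp, ?_⟩
  have hSK : S ≤ (2 * A / ((1 - δ) ^ 4 * (1 - 7 * δ))) * N := by
    rw [div_mul_eq_mul_div, le_div_iff₀ (by positivity)]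
    refine le_of_mul_le_mul_left ?_ hpi
    have z1 := mul_le_mul_of_nonneg_right b2 d7.le
    have z2 := mul_le_mul_of_nonneg_left b1 (by positivity : 0 ≤ 2 * A)
    nlinarith
  have := mul_le_mul_of_nonneg_right hR hNp.le
  linarith


lemma main (hB : Box) : ∃ ε : ℝ → ℝ, Tendsto ε atTop (nhds 0) ∧ ∀ᶠ T in atTop, (2/3 + ε T) * Ntot T ≤ Nsimple T := by
  refine ⟨fun T => min 0 (Nsimple T / Ntot T - 2 / 3), ?_, ?_⟩
  · rw [Metric.tendsto_nhds]
    intro η hη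
    filter_upwards [final_quant hB (η / 2) (by positivity)] with T hT
    have : 2 / 3 - η / 2 ≤ Nsimple T / Ntot T := by rw [le_div_iff₀ hT.1]; exact hT.2
    rw [Real.dist_eq, sub_zero, abs_lt]
    constructor
    · exact lt_min (by linarith) (by linarith)
    · exact (min_le_left _ _).trans_lt hη
  · filter_upwards [final_quant hB 1 one_pos] with T hT
    calc _ ≤ (2 / 3 + (Nsimple T / Ntot T - 2 / 3)) * Ntot T := mul_le_mul_of_nonneg_right (add_le_add_right (min_le_right _ _) _) hT.1.le
      _ = Nsimple T := by
        have := hT.1.ne'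
        field_simp
        ring
      _ ≤ _ := le_rfl

end TT

/-- If all nontrivial zeros with `T < γ ≤ 2T` lie in the box of width `b T / log T`
centered at the critical line, with `b T → 0`, then at least `2/3 + o(1)` of the zeros
(counted with multiplicity) are simple. -/
theorem two_thirds_simple (b : ℝ → ℝ) (hbpos : ∀ T, 0 < b T)
    (hblim : Tendsto b atTop (nhds 0))
    (hbox : ∀ᶠ T in atTop, ∀ ρ ∈ zeroBand T, |ρ.re - 1/2| < b T / (2 * Real.log T)) :
    ∃ ε : ℝ → ℝ, Tendsto ε atTop (nhds 0) ∧
      ∀ᶠ T in atTop, (2/3 + ε T) * Ntot T ≤ Nsimple T := by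
  exact TT.main (TT.box_of b hblim hbox)
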